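/- Let β ∈ ℂ with |Re β| < 1/2, let κ ∈ ℂ satisfy κ² = 1 − e^{−2πiβ}, and fix t ∈ ℝ. Then there exists an Ablowitz–Segur Painlevé II function u for κ such that τ ↦ (τ − t)·u(τ)² is absolutely integrable on [t, ∞) and lim_{n→∞} H_n(λ0(n), β) / (e^{iπβn} · H_n(λ0(n), 0)) = exp( − ∫_t^∞ (τ − t)·u(τ)² dτ ). -/

import Mathlib

open MeasureTheory Filter Polynomial

noncomputable section

/-- `A` is the Airy function `Ai` and `A'` its derivative: the unique solution of
`A'' = x·A` with `A 0 = 3^(-2/3)/Γ(2/3)` and `A' 0 = -3^(-1/3)/Γ(1/3)`. -/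
def IsAiry (A A' : ℝ → ℝ) : Prop :=
  (∀ x : ℝ, HasDerivAt A (A' x) x) ∧ (∀ x : ℝ, HasDerivAt A' (x * A x) x) ∧
  A 0 = (3 : ℝ) ^ (-(2 : ℝ) / 3) / Real.Gamma (2 / 3) ∧
  A' 0 = -((3 : ℝ) ^ (-(1 : ℝ) / 3)) / Real.Gamma (1 / 3)

/-- An Ablowitz–Segur Painlevé II function for `κ`: a twice differentiable `u : ℝ → ℂ`
with `u'' τ = τ·u τ + 2·(u τ)^3` for all `τ` and `u τ / Ai τ → κ` as `τ → +∞`. -/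
def IsAblowitzSegur (A : ℝ → ℝ) (κ : ℂ) (u : ℝ → ℂ) : Prop :=
  Differentiable ℝ u ∧ Differentiable ℝ (deriv u) ∧
  (∀ τ : ℝ, deriv (deriv u) τ = (τ : ℂ) * u τ + 2 * u τ ^ 3) ∧
  Tendsto (fun τ : ℝ => u τ / (A τ : ℂ)) atTop (nhds κ)

/-- The discontinuous Gaussian weight `w(x; λ0, β)`. -/
def w (l : ℝ) (β : ℂ) (x : ℝ) : ℂ :=
  (Real.exp (-x ^ 2) : ℝ) *
    (if x < l then Complex.exp (Real.pi * Complex.I * β)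
     else Complex.exp (-(Real.pi * Complex.I * β)))

/-- The Hankel determinant `H_n(λ0, β)` of the moments of `w(·; λ0, β)` (with `H_0 = 1`). -/
def H (n : ℕ) (l : ℝ) (β : ℂ) : ℂ :=
  Matrix.det (Matrix.of fun j k : Fin n =>
    ∫ x : ℝ, (x : ℂ) ^ ((j : ℕ) + (k : ℕ)) * w l β x)

/-- The scaled jump location `λ0(n) = √(2n)·(1 + (t/2)·n^(-2/3))`. -/
def lam0 (t : ℝ) (n : ℕ) : ℝ :=
  Real.sqrt (2 * n) * (1 + t / 2 * (n : ℝ) ^ (-(2 : ℝ) / 3))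

/-- `p` is the monic orthogonal polynomial of degree `n` for the weight `w(·; l, β)`. -/
def MonicOrthPoly (n : ℕ) (l : ℝ) (β : ℂ) (p : Polynomial ℂ) : Prop :=
  p.Monic ∧ p.natDegree = n ∧
  ∀ m : ℕ, m < n → ∫ x : ℝ, p.eval (x : ℂ) * (x : ℂ) ^ m * w l β x = 0

namespace HankelEdge

open Set Topology Asymptotics
open scoped ENNReal

/-- Lebesgue measure on the positive half-line. -/
def halfLine : Measure ℝ := volume.restrict (Ioi (0 : ℝ))

section Shift

set_option linter.unusedSectionVars false

variable {E F : Type*} [NormedAddCommGroup E] [NormedSpace ℂ E]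
  [NormedAddCommGroup F] [NormedSpace ℂ F]

/-- Continuous functions with exponential decay at `+∞`. -/
def Dec (f : ℝ → E) : Prop :=
  Continuous f ∧ f =O[atTop] fun s => Real.exp (-s)

/-- The class in `L²(0,∞)` of the translate `f (t + ·)`. -/
def shiftL2 (f : ℝ → E) (t : ℝ) : Lp E 2 halfLine :=
  open Classical in
  if h : MemLp (fun x => f (t + x)) 2 halfLine then h.toLp else 0

lemma Dec.bound {f : ℝ → E} (hf : Dec f) (T : ℝ) :
    ∃ C, 0 ≤ C ∧ ∀ s, T ≤ s → ‖f s‖ ≤ C * Real.exp (-s) := by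
  obtain ⟨hc, ho⟩ := hf
  obtain ⟨c, hc0, hb⟩ := ho.exists_nonneg
  rw [IsBigOWith, eventually_atTop] at hb
  obtain ⟨M, hM⟩ := hb
  obtain ⟨D, hD⟩ := (isCompact_Icc (a := T) (b := M)).exists_bound_of_continuousOn
    (f := fun s => (Real.exp s : ℂ) • f s) (by fun_prop)
  refine ⟨max c D, le_max_of_le_left hc0, fun s hs => ?_⟩
  rcases le_total M s with h | h
  · refine (hM s h).trans ?_
    rw [Real.norm_of_nonneg (Real.exp_pos _).le]
    gcongr
    exact le_max_left _ _
  · have h1 := hD s ⟨hs, h⟩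
    rw [norm_smul, Complex.norm_real, Real.norm_of_nonneg (Real.exp_pos _).le] at h1
    have h2 : ‖f s‖ ≤ D * Real.exp (-s) := by
      rw [Real.exp_neg, ← div_eq_mul_inv, le_div_iff₀ (Real.exp_pos _), mul_comm]
      exact h1
    refine h2.trans ?_
    gcongr
    exact le_max_right _ _

lemma Dec.add {f g : ℝ → E} (hf : Dec f) (hg : Dec g) : Dec (fun s => f s + g s) :=
  ⟨hf.1.add hg.1, hf.2.add hg.2⟩

lemma Dec.sub {f g : ℝ → E} (hf : Dec f) (hg : Dec g) : Dec (fun s => f s - g s) :=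
  ⟨hf.1.sub hg.1, hf.2.sub hg.2⟩

lemma Dec.neg {f : ℝ → E} (hf : Dec f) : Dec (fun s => -f s) :=
  ⟨hf.1.neg, hf.2.neg_left⟩

lemma Dec.const_smul {f : ℝ → E} (hf : Dec f) (c : ℂ) : Dec (fun s => c • f s) :=
  ⟨hf.1.const_smul c, hf.2.const_smul_left c⟩

lemma Dec.clm {f : ℝ → E} (hf : Dec f) (L : E →L[ℂ] F) : Dec (fun s => L (f s)) :=
  ⟨L.continuous.comp hf.1, (L.isBigO_comp f atTop).trans hf.2⟩

lemma Dec.sum {ι : Type*} {s : Finset ι} {f : ι → ℝ → E} (hf : ∀ i ∈ s, Dec (f i)) :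
    Dec (fun x => ∑ i ∈ s, f i x) :=
  ⟨continuous_finsetSum s fun i hi => (hf i hi).1, by
    have h : (∑ i ∈ s, f i) =O[atTop] fun s => Real.exp (-s) :=
      IsBigO.sum fun i hi => (hf i hi).2
    rwa [Finset.sum_fn] at h⟩

lemma Dec.comp_add {f : ℝ → E} (hf : Dec f) (t : ℝ) : Dec (fun s => f (t + s)) := by
  refine ⟨hf.1.comp (by fun_prop), ?_⟩
  refine (hf.2.comp_tendsto (tendsto_atTop_add_const_left atTop t tendsto_id)).trans ?_
  refine IsBigO.of_bound (Real.exp (-t)) (Eventually.of_forall fun s => ?_)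
  simp only [Function.comp, id]
  rw [neg_add, Real.exp_add, norm_mul, Real.norm_of_nonneg (Real.exp_pos _).le]

lemma Dec.tendsto {f : ℝ → E} (hf : Dec f) : Tendsto f atTop (𝓝 0) :=
  hf.2.trans_tendsto (Real.tendsto_exp_neg_atTop_nhds_zero)

lemma Dec.smul {f : ℝ → ℂ} {g : ℝ → E} (hf : Dec f) (hg : Dec g) :
    Dec (fun s => f s • g s) := by
  refine ⟨hf.1.smul hg.1, ?_⟩
  have h1 : f =O[atTop] fun _ => (1 : ℝ) := hf.tendsto.isBigO_one ℝ
  simpa using h1.smul hg.2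

lemma exp_neg_sq_integrable : Integrable (fun x : ℝ => Real.exp (-x) ^ 2) halfLine := by
  have := integrableOn_exp_mul_Ioi (show (-2 : ℝ) < 0 by norm_num) 0
  refine Integrable.congr this (Eventually.of_forall fun x => ?_)
  simp only
  rw [← Real.exp_nat_mul]; congr 1; push_cast; ring

lemma memLp_exp_neg : MemLp (fun x : ℝ => Real.exp (-x)) 2 halfLine := by
  rw [memLp_two_iff_integrable_sq (by fun_prop)]
  exact exp_neg_sq_integrable

lemma ae_halfLine {p : ℝ → Prop} (h : ∀ x, 0 < x → p x) : ∀ᵐ x ∂halfLine, p x :=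
  (ae_restrict_iff' measurableSet_Ioi).2 (Eventually.of_forall fun x hx => h x hx)

lemma memLp_shift {f : ℝ → E} (hf : Continuous f) {t C : ℝ}
    (hb : ∀ x, 0 < x → ‖f (t + x)‖ ≤ C * Real.exp (-x)) :
    MemLp (fun x => f (t + x)) 2 halfLine := by
  refine (memLp_exp_neg.const_mul C).mono'
    (hf.comp (by fun_prop)).aestronglyMeasurable (ae_halfLine hb)

lemma Dec.bound_shift {f : ℝ → E} (hf : Dec f) (t : ℝ) :
    ∃ C, 0 ≤ C ∧ ∀ x, 0 < x → ‖f (t + x)‖ ≤ C * Real.exp (-x) := by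
  obtain ⟨C, hC, hb⟩ := (hf.comp_add t).bound 0
  exact ⟨C, hC, fun x hx => hb x hx.le⟩

lemma Dec.memLp {f : ℝ → E} (hf : Dec f) (t : ℝ) :
    MemLp (fun x => f (t + x)) 2 halfLine := by
  obtain ⟨C, -, hb⟩ := hf.bound_shift t
  exact memLp_shift hf.1 hb

lemma shiftL2_eq {f : ℝ → E} {t : ℝ} (h : MemLp (fun x => f (t + x)) 2 halfLine) :
    shiftL2 f t = h.toLp := by
  simp [shiftL2, h]

lemma Dec.coeFn {f : ℝ → E} (hf : Dec f) (t : ℝ) :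
    shiftL2 f t =ᵐ[halfLine] fun x => f (t + x) := by
  rw [shiftL2_eq (hf.memLp t)]
  exact MemLp.coeFn_toLp _

/-- The `L²(0,∞)` norm of `e^{-x}`. -/
def expNorm : ℝ := (eLpNorm (fun x : ℝ => Real.exp (-x)) 2 halfLine).toReal

lemma expNorm_nonneg : 0 ≤ expNorm := ENNReal.toReal_nonneg

lemma norm_shiftL2_le {f : ℝ → E} {t C : ℝ} (hC : 0 ≤ C)
    (hb : ∀ x, 0 < x → ‖f (t + x)‖ ≤ C * Real.exp (-x)) :
    ‖shiftL2 f t‖ ≤ C * expNorm := by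
  by_cases h : MemLp (fun x => f (t + x)) 2 halfLine
  · rw [shiftL2_eq h, Lp.norm_toLp, expNorm]
    have h1 : eLpNorm (fun x => f (t + x)) 2 halfLine ≤
        ENNReal.ofReal C * eLpNorm (fun x : ℝ => Real.exp (-x)) 2 halfLine := by
      refine eLpNorm_le_mul_eLpNorm_of_ae_le_mul (ae_halfLine fun x hx => ?_) 2
      rw [Real.norm_of_nonneg (Real.exp_pos _).le]
      exact hb x hx
    have h2 := ENNReal.toReal_mono
      (ENNReal.mul_ne_top ENNReal.ofReal_ne_top memLp_exp_neg.2.ne) h1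
    rwa [ENNReal.toReal_mul, ENNReal.toReal_ofReal hC] at h2
  · simp only [shiftL2, h, dite_false, norm_zero]
    exact mul_nonneg hC expNorm_nonneg

/-- Dominated convergence in `L²(0,∞)` for translates. -/
lemma tendsto_shiftL2 {ι : Type*} {l : Filter ι} [l.IsCountablyGenerated] [l.NeBot]
    {f : ι → ℝ → E} {t : ι → ℝ} {g : ℝ → E} {t₀ C : ℝ}
    (hf : ∀ᶠ i in l, Continuous (f i)) (hg : Continuous g)
    (hlim : ∀ x, 0 < x → Tendsto (fun i => f i (t i + x)) l (𝓝 (g (t₀ + x))))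
    (hb : ∀ᶠ i in l, ∀ x, 0 < x → ‖f i (t i + x)‖ ≤ C * Real.exp (-x)) :
    Tendsto (fun i => shiftL2 (f i) (t i)) l (𝓝 (shiftL2 g t₀)) := by
  have hgb : ∀ x, 0 < x → ‖g (t₀ + x)‖ ≤ C * Real.exp (-x) := fun x hx =>
    le_of_tendsto (hlim x hx).norm (hb.mono fun i hi => hi x hx)
  have hgm := memLp_shift hg hgb
  rw [shiftL2_eq hgm]
  refine Lp.tendsto_Lp_of_tendsto_eLpNorm _ hgm ?_
  have key : Tendsto (fun i => ∫⁻ x, ‖f i (t i + x) - g (t₀ + x)‖ₑ ^ (2 : ℝ) ∂halfLine) l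
      (𝓝 (∫⁻ _, 0 ∂halfLine)) := by
    refine tendsto_lintegral_filter_of_dominated_convergence'
      (fun x => ENNReal.ofReal ((2 * C) ^ 2 * Real.exp (-x) ^ 2)) ?_ ?_ ?_ ?_
    · filter_upwards [hf] with i hi
      exact (((hi.comp (continuous_const.add continuous_id)).sub
        (hg.comp (continuous_const.add continuous_id))).enorm.measurable.pow_const 2).aemeasurable
    · filter_upwards [hb] with i hi
      refine ae_halfLine fun x hx => ?_
      have h1 : ‖f i (t i + x) - g (t₀ + x)‖ ≤ 2 * C * Real.exp (-x) := by
        refine (norm_sub_le _ _).trans ?_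
        linarith [hi x hx, hgb x hx]
      rw [← ofReal_norm, ENNReal.ofReal_rpow_of_nonneg (norm_nonneg _) (by norm_num)]
      apply ENNReal.ofReal_le_ofReal
      rw [Real.rpow_two, ← mul_pow]
      gcongr
    · rw [← ofReal_integral_eq_lintegral_ofReal]
      · exact ENNReal.ofReal_ne_top
      · exact exp_neg_sq_integrable.const_mul _
      · exact Eventually.of_forall fun x => by positivity
    · refine ae_halfLine fun x hx => ?_
      have h1 : Tendsto (fun i => f i (t i + x) - g (t₀ + x)) l (𝓝 0) := by
        simpa using (hlim x hx).sub_const (g (t₀ + x))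
      have h2 := (ENNReal.continuous_rpow_const (y := 2)).tendsto 0 |>.comp
        (by simpa using h1.enorm)
      simpa [Function.comp_def] using h2
  rw [lintegral_zero] at key
  have h3 := (ENNReal.continuous_rpow_const (y := 1 / 2)).tendsto 0 |>.comp key
  rw [ENNReal.zero_rpow_of_pos (by norm_num)] at h3
  refine h3.congr' ?_
  filter_upwards [hf, hb] with i hi hbi
  have hm := memLp_shift hi hbi
  have h4 : eLpNorm (⇑(shiftL2 (f i) (t i)) - fun x => g (t₀ + x)) 2 halfLine =
      eLpNorm (fun x => f i (t i + x) - g (t₀ + x)) 2 halfLine := by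
    apply eLpNorm_congr_ae
    rw [shiftL2_eq hm]
    filter_upwards [hm.coeFn_toLp] with x hx
    simp [hx]
  rw [h4, eLpNorm_eq_lintegral_rpow_enorm_toReal (by norm_num) (by norm_num)]
  simp

lemma Dec.shiftL2 {f : ℝ → E} (hf : Dec f) : Dec (shiftL2 f) := by
  constructor
  · rw [continuous_iff_continuousAt]
    intro t
    obtain ⟨C, hC, hb⟩ := hf.bound (t - 1)
    refine tendsto_shiftL2 (C := C * Real.exp (-(t - 1))) (f := fun _ => f)
      (Eventually.of_forall fun _ => hf.1) hf.1 ?_ ?_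
    · intro x _
      exact (hf.1.tendsto (t + x)).comp ((continuous_id.add continuous_const).tendsto t)
    · filter_upwards [Ici_mem_nhds (show t - 1 < t by linarith)] with r hr x hx
      have hr' : t - 1 ≤ r := hr
      refine (hb (r + x) (by linarith)).trans ?_
      rw [mul_assoc, ← Real.exp_add]
      gcongr
      linarith
  · obtain ⟨C, hC, hb⟩ := hf.bound 0
    refine IsBigO.of_bound (C * expNorm) ?_
    filter_upwards [eventually_ge_atTop 0] with t ht
    rw [Real.norm_of_nonneg (Real.exp_pos _).le]
    refine (norm_shiftL2_le (C := C * Real.exp (-t)) (by positivity) fun x hx => ?_).trans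
      (le_of_eq (by ring))
    rw [mul_assoc, ← Real.exp_add]
    convert hb (t + x) (by linarith) using 3
    ring

lemma shiftL2_add {f g : ℝ → E} (hf : Dec f) (hg : Dec g) (t : ℝ) :
    shiftL2 (fun s => f s + g s) t = shiftL2 f t + shiftL2 g t := by
  rw [shiftL2_eq (hf.memLp t), shiftL2_eq (hg.memLp t), shiftL2_eq ((hf.add hg).memLp t),
    ← MemLp.toLp_add]
  rfl

lemma shiftL2_sub {f g : ℝ → E} (hf : Dec f) (hg : Dec g) (t : ℝ) :
    shiftL2 (fun s => f s - g s) t = shiftL2 f t - shiftL2 g t := by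
  rw [shiftL2_eq (hf.memLp t), shiftL2_eq (hg.memLp t), shiftL2_eq ((hf.sub hg).memLp t),
    ← MemLp.toLp_sub]
  rfl

lemma shiftL2_smul {f : ℝ → E} (hf : Dec f) (c : ℂ) (t : ℝ) :
    shiftL2 (fun s => c • f s) t = c • shiftL2 f t := by
  rw [shiftL2_eq (hf.memLp t), shiftL2_eq ((hf.const_smul c).memLp t), ← MemLp.toLp_const_smul]
  rfl

lemma shiftL2_clm {f : ℝ → E} (hf : Dec f) (L : E →L[ℂ] F) (t : ℝ) :
    shiftL2 (fun s => L (f s)) t = L.compLp (shiftL2 f t) := by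
  apply Lp.ext
  filter_upwards [(hf.clm L).coeFn t, hf.coeFn t, L.coeFn_compLp (shiftL2 f t)] with x h1 h2 h3
  rw [h1, h3, h2]

lemma hasDerivAt_shiftL2 {f f₁ : ℝ → E} (hd : ∀ s, HasDerivAt f (f₁ s) s) (hf : Dec f)
    (hf₁ : Dec f₁) (t : ℝ) : HasDerivAt (shiftL2 f) (shiftL2 f₁ t) t := by
  rw [hasDerivAt_iff_tendsto_slope_zero]
  obtain ⟨C, hC, hb⟩ := hf₁.bound (t - 1)
  have key : Tendsto (fun h : ℝ => shiftL2 (fun s => h⁻¹ • (f (h + s) - f s)) t) (𝓝[≠] 0)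
      (𝓝 (shiftL2 f₁ t)) := by
    refine tendsto_shiftL2 (C := C * Real.exp (-(t - 1)))
      (Eventually.of_forall fun h => ?_) hf₁.1 ?_ ?_
    · have := hf.1
      fun_prop
    · intro x _
      have := (hasDerivAt_iff_tendsto_slope_zero.1 (hd (t + x)))
      refine this.congr fun h => ?_
      rw [add_comm h]
    · filter_upwards [mem_nhdsWithin_of_mem_nhds (Metric.ball_mem_nhds (0:ℝ) one_pos),
        self_mem_nhdsWithin] with h hh hh0 x hx
      rw [mem_ball_zero_iff, Real.norm_eq_abs, abs_lt] at hh
      have h1 : ‖f (h + (t + x)) - f (t + x)‖ ≤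
          C * Real.exp (-(t - 1 + x)) * ‖h + (t + x) - (t + x)‖ := by
        refine (convex_Ici (t - 1 + x)).norm_image_sub_le_of_norm_hasDerivWithin_le
          (fun s _ => (hd s).hasDerivWithinAt) (fun s hs => ?_) ?_ ?_
        · have hs' : t - 1 + x ≤ s := hs
          refine (hb s (by linarith)).trans ?_
          gcongr
        · simp only [mem_Ici]; linarith
        · simp only [mem_Ici]; linarith [hh.1]
      rw [norm_smul, norm_inv]
      have h0 : 0 < ‖h‖ := norm_pos_iff.2 hh0
      rw [inv_mul_le_iff₀ h0]
      refine h1.trans (le_of_eq ?_)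
      rw [add_sub_cancel_right, neg_add, Real.exp_add]
      ring
  refine key.congr fun h => ?_
  have e1 := hf.comp_add h
  have e2 : shiftL2 (fun s => h⁻¹ • (f (h + s) - f s)) t =
      ((h⁻¹ : ℝ) : ℂ) • shiftL2 (fun s => f (h + s) - f s) t := by
    rw [← shiftL2_smul (e1.sub hf)]
    rfl
  have e3 : shiftL2 (fun s => f (h + s)) t = shiftL2 f (t + h) := by
    rw [shiftL2_eq (e1.memLp t), shiftL2_eq (hf.memLp (t + h))]
    refine MemLp.toLp_congr _ _ (Eventually.of_forall fun x => ?_)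
    simp only
    congr 1
    ring
  rw [e2, shiftL2_sub e1 hf, e3]
  rfl

end Shift

section Pair

set_option linter.unusedSectionVars false

variable {E F : Type*} [NormedAddCommGroup E] [NormedSpace ℂ E] [CompleteSpace E]
  [NormedAddCommGroup F] [NormedSpace ℂ F] [CompleteSpace F]

/-- The complex Hilbert space `L²(0,∞)`. -/
abbrev HalfL2 : Type := Lp ℂ 2 halfLine

/-- The bilinear pairing `(f, g) ↦ ∫ f • g` over the half-line. -/
def pair : HalfL2 →L[ℂ] Lp E 2 halfLine →L[ℂ] E :=
  (ContinuousLinearMap.lsmul ℂ ℂ).lpPairing halfLine 2 2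

lemma pair_eq_integral (f : HalfL2) (g : Lp E 2 halfLine) :
    pair f g = ∫ x, f x • g x ∂halfLine := by
  simp [pair, ContinuousLinearMap.lpPairing_eq_integral]

lemma integrable_pair (f : HalfL2) (g : Lp E 2 halfLine) :
    Integrable (fun x => f x • g x) halfLine := by
  have := MemLp.smul (p := 2) (q := 2) (r := 1) (Lp.memLp g) (Lp.memLp f)
  exact memLp_one_iff_integrable.1 this

lemma pair_comm (f g : HalfL2) : pair f g = pair g f := by
  simp only [pair_eq_integral, smul_eq_mul, mul_comm]

lemma clm_pair (L : E →L[ℂ] F) (f : HalfL2)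
    (g : Lp E 2 halfLine) : L (pair f g) = pair f (L.compLp g) := by
  rw [pair_eq_integral, pair_eq_integral, ← L.integral_comp_comm (integrable_pair f g)]
  refine integral_congr_ae ?_
  filter_upwards [L.coeFn_compLp g] with x hx
  rw [hx, map_smul]

lemma clm_pair_shiftL2 (L : E →L[ℂ] F) (f : HalfL2)
    {g : ℝ → E} (hg : Dec g) (t : ℝ) :
    L (pair f (shiftL2 g t)) = pair f (shiftL2 (fun s => L (g s)) t) := by
  rw [clm_pair, shiftL2_clm hg]

lemma pair_shiftL2 {f : ℝ → ℂ} {g : ℝ → E} (hf : Dec f) (hg : Dec g) (s t : ℝ) :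
    pair (shiftL2 f s) (shiftL2 g t) = ∫ x in Ioi (0 : ℝ), f (s + x) • g (t + x) := by
  rw [pair_eq_integral]
  refine integral_congr_ae ?_
  filter_upwards [hf.coeFn s, hg.coeFn t] with x h1 h2
  rw [h1, h2]

lemma pair_shiftL2_const (f : HalfL2) {g : ℝ → ℂ} (hg : Dec g) (t : ℝ)
    (v : E) : pair f (shiftL2 (fun s => g s • v) t) = pair f (shiftL2 g t) • v := by
  have := clm_pair_shiftL2 ((ContinuousLinearMap.id ℂ ℂ).smulRight v) f hg t
  simpa using this.symm

lemma Dec.integrable {f : ℝ → E} (hf : Dec f) (t : ℝ) : IntegrableOn f (Ioi t) := by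
  obtain ⟨C, hC, hb⟩ := hf.bound t
  refine Integrable.mono' ((integrableOn_exp_neg_Ioi t).const_mul C)
    hf.1.aestronglyMeasurable ?_
  rw [ae_restrict_iff' measurableSet_Ioi]
  exact Eventually.of_forall fun x hx => hb x (le_of_lt hx)

/-- Integration by parts for the pairing of two translates. -/
lemma pair_deriv_add_pair_deriv {f f₁ : ℝ → ℂ} {g g₁ : ℝ → E}
    (hf : Dec f) (hf₁ : Dec f₁) (hg : Dec g) (hg₁ : Dec g₁)
    (hdf : ∀ s, HasDerivAt f (f₁ s) s) (hdg : ∀ s, HasDerivAt g (g₁ s) s) (s t : ℝ) :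
    pair (shiftL2 f₁ s) (shiftL2 g t) + pair (shiftL2 f s) (shiftL2 g₁ t) = -(f s • g t) := by
  have i1 := ((hf₁.comp_add s).smul (hg.comp_add t)).integrable 0
  have i2 := ((hf.comp_add s).smul (hg₁.comp_add t)).integrable 0
  rw [pair_shiftL2 hf₁ hg, pair_shiftL2 hf hg₁, ← integral_add i1 i2]
  have := integral_Ioi_of_hasDerivAt_of_tendsto' (a := (0:ℝ))
    (f := fun x => f (s + x) • g (t + x)) (m := 0)
    (f' := fun x => f₁ (s + x) • g (t + x) + f (s + x) • g₁ (t + x))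
    (fun x _ => ?_) (i1.add i2) ((hf.comp_add s).smul (hg.comp_add t)).tendsto
  · rw [this]; simp
  · have h1 := (hdf (s + x)).comp_const_add s x
    have h2 := (hdg (t + x)).comp_const_add t x
    rw [add_comm]
    exact h1.smul h2

/-- Fubini for kernels with exponential decay. -/
lemma pair_pair_swap {k : ℝ → ℝ → ℂ} (hk : Continuous (Function.uncurry k)) {C : ℝ}
    (hb : ∀ x y, 0 < x → 0 < y → ‖k x y‖ ≤ C * Real.exp (-x) * Real.exp (-y))
    {Φ Ψ : Lp HalfL2 2 halfLine}
    (hΦ : ∀ᵐ y ∂halfLine, Φ y =ᵐ[halfLine] fun x => k x y)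
    (hΨ : ∀ᵐ x ∂halfLine, Ψ x =ᵐ[halfLine] fun y => k x y) (f g : HalfL2) :
    pair f (pair g Φ) = pair g (pair f Ψ) := by
  have : SFinite halfLine := by unfold halfLine; infer_instance
  have hfe : Integrable (fun x => Real.exp (-x) * ‖f x‖) halfLine := by
    have := memLp_exp_neg.smul (p := 2) (q := 2) (r := 1) (Lp.memLp f).norm
    have := memLp_one_iff_integrable.1 this
    refine this.congr (Eventually.of_forall fun x => ?_)
    simp [mul_comm]
  have hge : Integrable (fun x => Real.exp (-x) * ‖g x‖) halfLine := by
    have := memLp_exp_neg.smul (p := 2) (q := 2) (r := 1) (Lp.memLp g).norm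
    have := memLp_one_iff_integrable.1 this
    refine this.congr (Eventually.of_forall fun x => ?_)
    simp [mul_comm]
  have hInt : Integrable (fun p : ℝ × ℝ => f p.1 * (g p.2 * k p.1 p.2))
      (halfLine.prod halfLine) := by
    refine Integrable.mono' ((hfe.mul_prod hge).const_mul C) ?_ ?_
    · exact (Lp.aestronglyMeasurable f).comp_fst.mul
        ((Lp.aestronglyMeasurable g).comp_snd.mul hk.aestronglyMeasurable)
    · have : halfLine.prod halfLine = (volume.prod volume).restrict (Ioi 0 ×ˢ Ioi 0) := by
        rw [halfLine, Measure.prod_restrict]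
      rw [this, ae_restrict_iff' (measurableSet_Ioi.prod measurableSet_Ioi)]
      refine Eventually.of_forall fun p hp => ?_
      rw [norm_mul, norm_mul]
      calc ‖f p.1‖ * (‖g p.2‖ * ‖k p.1 p.2‖)
          ≤ ‖f p.1‖ * (‖g p.2‖ * (C * Real.exp (-p.1) * Real.exp (-p.2))) := by
            gcongr
            exact hb _ _ hp.1 hp.2
        _ = _ := by ring
  have e1 : pair f (pair g Φ) = ∫ y, ∫ x, f x * (g y * k x y) ∂halfLine ∂halfLine := by
    rw [clm_pair (pair (E := ℂ) f), pair_eq_integral]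
    refine integral_congr_ae ?_
    filter_upwards [(pair (E := ℂ) f).coeFn_compLp Φ, hΦ] with y h1 h2
    rw [h1, pair_eq_integral, smul_eq_mul, ← integral_const_mul]
    refine integral_congr_ae ?_
    filter_upwards [h2] with x hx
    rw [hx, smul_eq_mul]; ring
  have e2 : pair g (pair f Ψ) = ∫ x, ∫ y, f x * (g y * k x y) ∂halfLine ∂halfLine := by
    rw [clm_pair (pair (E := ℂ) g), pair_eq_integral]
    refine integral_congr_ae ?_
    filter_upwards [(pair (E := ℂ) g).coeFn_compLp Ψ, hΨ] with y h1 h2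
    rw [h1, pair_eq_integral, smul_eq_mul, ← integral_const_mul]
    refine integral_congr_ae ?_
    filter_upwards [h2] with x hx
    rw [hx, smul_eq_mul]
  rw [e1, e2]
  exact (integral_integral_swap hInt).symm

/-- The operator on `L²(0,∞)` with kernel `φ (t + x + y)`. -/
def hankelOp (φ : ℝ → ℂ) (t : ℝ) : HalfL2 →L[ℂ] HalfL2 :=
  pair.flip (shiftL2 (shiftL2 φ) t)

lemma hankelOp_apply (φ : ℝ → ℂ) (t : ℝ) (f : HalfL2) :
    hankelOp φ t f = pair f (shiftL2 (shiftL2 φ) t) := rfl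

lemma hasDerivAt_hankelOp {φ φ₁ : ℝ → ℂ} (hd : ∀ s, HasDerivAt φ (φ₁ s) s) (h : Dec φ)
    (h₁ : Dec φ₁) (t : ℝ) : HasDerivAt (hankelOp φ) (hankelOp φ₁ t) t := by
  have := hasDerivAt_shiftL2 (fun s => hasDerivAt_shiftL2 hd h h₁ s) h.shiftL2 h₁.shiftL2 t
  exact ((pair (E := HalfL2)).flip.restrictScalars ℝ).hasFDerivAt.comp_hasDerivAt t this

lemma pair_hankelOp_comm {φ : ℝ → ℂ} (h : Dec φ) (t : ℝ) (f g : HalfL2) :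
    pair f (hankelOp φ t g) = pair g (hankelOp φ t f) := by
  obtain ⟨C, hC, hb⟩ := h.bound t
  refine pair_pair_swap (k := fun x y => φ (t + x + y)) (C := C * Real.exp (-t)) ?_ ?_ ?_ ?_ f g
  · have := h.1
    simp only [Function.uncurry_def]
    fun_prop
  · intro x y hx hy
    refine (hb (t + x + y) (by linarith)).trans (le_of_eq ?_)
    rw [neg_add, neg_add, Real.exp_add, Real.exp_add]
    ring
  · filter_upwards [h.shiftL2.coeFn t] with y hy
    rw [hy]
    filter_upwards [h.coeFn (t + y)] with x hx
    rw [hx]; congr 1; ring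
  · filter_upwards [h.shiftL2.coeFn t] with y hy
    rw [hy]
    filter_upwards [h.coeFn (t + y)] with x hx
    rw [hx]

end Pair

section EdgeAlgebra

variable {X : Type*} [NormedAddCommGroup X] [NormedSpace ℂ X]

/-- The commutation relations satisfied at a fixed `t` by the Airy Hankel operator `B`, its
derivatives `B₁`, `B₂`, and the functions `a`, `a₁`, `a₂`. -/
structure EdgeRel (pr : X →L[ℂ] X →L[ℂ] ℂ) (B B₁ B₂ P : X →L[ℂ] X) (a a₁ a₂ : X)
    (t α α₁ : ℂ) : Prop where
  comm : ∀ f g, pr f g = pr g f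
  symm : ∀ f g, pr f (B g) = pr g (B f)
  symm₁ : ∀ f g, pr f (B₁ g) = pr g (B₁ f)
  symm₂ : ∀ f g, pr f (B₂ g) = pr g (B₂ f)
  rel₁ : ∀ f, B₁ (B f) + B (B₁ f) = -(pr a f • a)
  rel₁a : B₁ a + B a₁ = -(α • a)
  aa₁ : 2 * pr a a₁ = -α ^ 2
  rel₂ : ∀ f, B (B₂ f) - B₂ (B f) = pr a f • a₁ - pr a₁ f • a
  rel₂a : B₂ a - B a₂ = α₁ • a - α • a₁
  adj : ∀ f g, pr f (B₂ g - t • B g - P g) = pr (P f) g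
  inter : ∀ f, B (B₂ f - t • B f - P f) = P (B f)
  intera : B (a₂ - t • a) = P a

variable {pr : X →L[ℂ] X →L[ℂ] ℂ} {B B₁ B₂ P : X →L[ℂ] X} {a a₁ a₂ v w : X} {t α α₁ κ : ℂ}

lemma EdgeRel.pr_B₁ (R : EdgeRel pr B B₁ B₂ P a a₁ a₂ t α α₁) (hv : κ • B w = v - κ • a) :
    κ ^ 2 * pr a (B₁ w) =
      -(κ * α) * (κ * pr a w) - κ * pr a₁ v - κ ^ 2 * α ^ 2 / 2 := by
  have h1 := congrArg (pr w) R.rel₁a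
  have h2 := congrArg (pr a₁) hv
  simp only [map_add, map_neg, map_smul, map_sub, smul_eq_mul] at h1 h2
  rw [R.symm w a₁, R.comm w a] at h1
  rw [R.symm₁ a w]
  linear_combination κ ^ 2 * h1 - κ * h2 + κ ^ 2 * R.comm a₁ a + κ ^ 2 / 2 * R.aa₁

lemma EdgeRel.pr_B₁' (R : EdgeRel pr B B₁ B₂ P a a₁ a₂ t α α₁) (hv : κ • B w = v - κ • a)
    (hw : w = κ • B v) :
    2 * (κ ^ 2 * pr a (B₁ w)) = (κ * pr a w) ^ 2 - (κ * pr a v) ^ 2 := by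
  have h1 := congrArg (pr (B₁ w)) hv
  have h2 := congrArg (pr w) (R.rel₁ w)
  have h3 := congrArg (pr v) (R.rel₁ v)
  have h4 := congrArg (pr (B₁ v)) hw
  simp only [map_add, map_neg, map_smul, map_sub, smul_eq_mul] at h1 h2 h3 h4
  rw [R.symm₁ w, R.symm w] at h2
  rw [R.symm₁ v, R.symm v] at h3
  rw [R.comm (B w)] at h2
  rw [R.comm (B v)] at h3
  rw [R.comm w a] at h2
  rw [R.comm v a] at h3
  have h5 := R.comm (B₁ w) v
  have h6 := R.symm₁ v w
  have h7 := R.comm w (B₁ v)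
  have h8 := R.comm (B₁ w) a
  linear_combination (2 * κ) * h1 - κ ^ 2 * h2 + κ ^ 2 * h3 + 2 * κ * h4 + 2 * κ * h5
    + 2 * κ * h6 + 2 * κ * h7 - 2 * κ ^ 2 * h8

lemma EdgeRel.two_h (R : EdgeRel pr B B₁ B₂ P a a₁ a₂ t α α₁) (hv : κ • B w = v - κ • a)
    (hw : w = κ • B v) :
    2 * (κ * pr a₁ v) = (κ * pr a v) ^ 2 - (κ * α + κ * pr a w) ^ 2 := by
  linear_combination 2 * R.pr_B₁ hv - R.pr_B₁' hv hw

lemma EdgeRel.pr_a₂ (R : EdgeRel pr B B₁ B₂ P a a₁ a₂ t α α₁) (hv : κ • B w = v - κ • a)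
    (hw : w = κ • B v) :
    κ * pr a₂ w = t * (κ * pr a w) + κ * pr a v * (κ * α₁ + κ * pr a₁ w)
      - (κ * α + κ * pr a w) * (κ * pr a₁ v) := by
  have A1 : κ * pr v (B₂ v) - κ * pr w (B₂ w) =
      κ * pr a₂ w + κ * pr a v * (κ * α₁ + κ * pr a₁ w)
      - (κ * α + κ * pr a w) * (κ * pr a₁ v) := by
    have e1 : pr w (B₂ w) = κ * pr v (B (B₂ w)) := by
      conv_lhs => rw [R.comm, hw]
      rw [map_smul, smul_eq_mul, ← hw, R.symm]
    have e2 := congrArg (pr v) (R.rel₂ w)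
    have e3 := congrArg (fun x => pr v (B₂ x)) hv
    have e4 := congrArg (pr v) R.rel₂a
    have e5 : pr w a₂ = κ * pr v (B a₂) := by
      conv_lhs => rw [R.comm, hw]
      rw [map_smul, smul_eq_mul, R.symm]
    simp only [map_smul, map_sub, smul_eq_mul] at e2 e3 e4
    have := R.comm a₁ v
    have := R.comm a v
    have := R.comm a₂ w
    grind
  have A2 : κ * pr v (B₂ v) - κ * pr w (B₂ w) =
      2 * (κ * pr a₂ w - t * (κ * pr a w)) + t * (κ * pr a w) := by
    have e1 := R.adj v v
    have e2 := R.adj w w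
    have e3 : pr w (B₂ w - t • B w - P w) = κ * pr v (P (B w)) := by
      conv_lhs => rw [R.comm, hw]
      rw [map_smul, smul_eq_mul, ← hw, R.symm, R.inter]
    have e4 := congrArg (fun x => pr v (P x)) hv
    have e5 := congrArg (pr v) hw
    have e6 := congrArg (pr w) hv
    have e7 : pr w (a₂ - t • a) = κ * pr v (P a) := by
      conv_lhs => rw [R.comm, hw]
      rw [map_smul, smul_eq_mul, R.symm, R.intera]
    simp only [map_smul, map_sub, smul_eq_mul] at e1 e2 e3 e4 e5 e6 e7
    have := R.comm (P v) v
    have := R.comm (P w) w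
    have := R.comm a₂ w
    have := R.comm a w
    have := R.comm v w
    grind
  linear_combination A1 - A2

lemma EdgeRel.deriv_w (R : EdgeRel pr B B₁ B₂ P a a₁ a₂ t α α₁) (hv : κ • B w = v - κ • a)
    (hw : w = κ • B v) {v' w' : X} (hw' : w' = κ • B₁ v + κ • B v')
    (hv' : v' = κ • a₁ + κ • B₁ w + κ • B w')
    (hinj : ∀ x, x = κ ^ 2 • B (B x) → x = 0) :
    w' = -((κ * α + κ * pr a w) • v) ∧
      v' = κ • a₁ + κ • B₁ w - (κ * α + κ * pr a w) • w := by
  set u := κ * α + κ * pr a w with hu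
  have key : w' + u • v = 0 := by
    apply hinj
    have h1 := congrArg (fun x => κ • B x) hv'
    have h2 := congrArg (fun x => κ • B₁ x) hv
    have h3 := congrArg (fun x => κ • x) R.rel₁a
    have h4 := R.rel₁ w
    have h5 : κ • B w' = v' - κ • a₁ - κ • B₁ w := by rw [hv']; abel
    have h6 := congrArg (fun x => κ • B x) h5
    simp only [map_add, map_sub, map_smul, smul_add, smul_sub, smul_neg, smul_smul] at h1 h2 h3 h4 h6
    simp only [map_add, map_smul, smul_add, smul_smul]
    have h7 : κ ^ 2 • B (B v) = v - κ • a := by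
      rw [← hv]; conv_rhs => rw [hw]
      rw [map_smul, smul_smul, sq]
    have h8 : (κ ^ 2 * u) • B (B v) = u • (v - κ • a) := by
      rw [← h7, smul_smul, mul_comm]
    rw [h8, sq, h6]
    have h9 : (κ * κ) • B a₁ = -((κ * κ * α) • a) - (κ * κ) • B₁ a := by
      rw [eq_sub_iff_add_eq, ← smul_add, add_comm, R.rel₁a, smul_neg, smul_smul]
    have h10 : (κ * κ) • B (B₁ w) = -((κ * κ * pr a w) • a) - (κ * κ) • B₁ (B w) := by
      rw [eq_sub_iff_add_eq, ← smul_add, add_comm, h4, smul_neg, smul_smul]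
    rw [h9, h10, h2, hw', smul_sub, smul_smul, hu]
    module
  have h1 : w' = -(u • v) := eq_neg_of_add_eq_zero_left key
  refine ⟨h1, ?_⟩
  rw [hv', h1, hw]
  simp only [map_neg, map_smul, smul_neg, smul_smul]
  module

end EdgeAlgebra

/-- Solutions of the Airy equation with exponential decay. -/
structure AiryLike (A A₁ : ℝ → ℂ) : Prop where
  deriv : ∀ s, HasDerivAt A (A₁ s) s
  deriv₁ : ∀ s : ℝ, HasDerivAt A₁ (s * A s) s
  decay : A =O[atTop] fun s => Real.exp (-(2 * s))
  decay₁ : A₁ =O[atTop] fun s => Real.exp (-(2 * s))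

lemma exp_neg_two_isBigO : (fun s : ℝ => Real.exp (-(2 * s))) =O[atTop] fun s => Real.exp (-s) := by
  refine IsBigO.of_bound 1 ?_
  filter_upwards [eventually_ge_atTop 0] with s hs
  rw [Real.norm_of_nonneg (Real.exp_pos _).le, Real.norm_of_nonneg (Real.exp_pos _).le, one_mul]
  gcongr
  linarith

lemma mul_exp_neg_two_isBigO :
    (fun s : ℝ => s * Real.exp (-(2 * s))) =O[atTop] fun s => Real.exp (-s) := by
  refine IsBigO.of_bound 1 ?_
  filter_upwards [eventually_ge_atTop 0] with s hs
  rw [norm_mul, Real.norm_of_nonneg (Real.exp_pos _).le, Real.norm_of_nonneg (Real.exp_pos _).le,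
    one_mul, Real.norm_of_nonneg hs]
  have h1 : s ≤ Real.exp s := by linarith [Real.add_one_le_exp s]
  calc s * Real.exp (-(2 * s)) ≤ Real.exp s * Real.exp (-(2 * s)) := by gcongr
    _ = Real.exp (-s) := by rw [← Real.exp_add]; congr 1; ring

lemma dec_smul_shiftL2 {f : ℝ → ℂ} (hf : Continuous f)
    (ho : f =O[atTop] fun s => Real.exp (-(2 * s))) (t : ℝ) :
    Dec (fun s : ℝ => ((s : ℂ) - t) • shiftL2 f s) := by
  have hd : Dec f := ⟨hf, ho.trans exp_neg_two_isBigO⟩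
  have h2 : Dec (fun s => (Real.exp s : ℂ) * f s) := by
    refine ⟨by fun_prop, ?_⟩
    have h3 : (fun s : ℝ => (Real.exp s : ℂ)) =O[atTop] fun s => Real.exp s :=
      IsBigO.of_bound 1 (Eventually.of_forall fun s => by
        rw [Complex.norm_real, one_mul])
    refine (h3.mul ho).congr_right fun s => ?_
    rw [← Real.exp_add]; congr 1; ring
  obtain ⟨C, hC, hb⟩ := h2.bound 0
  have h4 : shiftL2 f =O[atTop] fun s => Real.exp (-(2 * s)) := by
    refine IsBigO.of_bound (C * expNorm) ?_
    filter_upwards [eventually_ge_atTop 0] with s hs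
    rw [Real.norm_of_nonneg (Real.exp_pos _).le]
    refine (norm_shiftL2_le (C := C * Real.exp (-(2 * s)))
      (mul_nonneg hC (Real.exp_pos _).le) fun x hx => ?_).trans (le_of_eq (by ring))
    have h5 := hb (s + x) (by linarith)
    rw [norm_mul, Complex.norm_real, Real.norm_of_nonneg (Real.exp_pos _).le] at h5
    have h6 : ‖f (s + x)‖ ≤ C * Real.exp (-(s + x)) / Real.exp (s + x) := by
      rw [le_div_iff₀ (Real.exp_pos _), mul_comm]; exact h5
    refine h6.trans ?_
    rw [mul_div_assoc, ← Real.exp_sub, mul_assoc, ← Real.exp_add]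
    gcongr
    linarith
  refine ⟨by have := hd.shiftL2.1; fun_prop, ?_⟩
  have h7 : (fun s : ℝ => (s : ℂ) • shiftL2 f s) =O[atTop] fun s => Real.exp (-s) := by
    have h3 : (fun s : ℝ => (s : ℂ)) =O[atTop] fun s => s :=
      IsBigO.of_bound 1 (Eventually.of_forall fun s => by
        rw [Complex.norm_real, one_mul])
    exact (h3.smul h4).trans mul_exp_neg_two_isBigO
  have h8 : (fun s : ℝ => (t : ℂ) • shiftL2 f s) =O[atTop] fun s => Real.exp (-s) :=
    (hd.shiftL2.const_smul (t : ℂ)).2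
  simp only [sub_smul]
  exact h7.sub h8

/-- The operator on `L²(0,∞)` with kernel `y ↦ y · φ (t + x + y)` acting on the variable `y`. -/
def mulHankelOp (φ : ℝ → ℂ) (t : ℝ) : HalfL2 →L[ℂ] HalfL2 :=
  pair.flip (shiftL2 (fun s => ((s : ℂ) - t) • shiftL2 φ s) t)

lemma mulHankelOp_apply (φ : ℝ → ℂ) (t : ℝ) (f : HalfL2) :
    mulHankelOp φ t f = pair f (shiftL2 (fun s => ((s : ℂ) - t) • shiftL2 φ s) t) := rfl

namespace AiryLike

variable {A A₁ : ℝ → ℂ} (h : AiryLike A A₁)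
include h

lemma continuous : Continuous A := continuous_iff_continuousAt.2 fun s => (h.deriv s).continuousAt

lemma continuous₁ : Continuous A₁ :=
  continuous_iff_continuousAt.2 fun s => (h.deriv₁ s).continuousAt

lemma dec : Dec A := ⟨h.continuous, h.decay.trans exp_neg_two_isBigO⟩

lemma dec₁ : Dec A₁ := ⟨h.continuous₁, h.decay₁.trans exp_neg_two_isBigO⟩

lemma dec₂ : Dec (fun s : ℝ => (s : ℂ) * A s) := by
  refine ⟨by have := h.continuous; fun_prop, ?_⟩
  have h3 : (fun s : ℝ => (s : ℂ)) =O[atTop] fun s => s :=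
    IsBigO.of_bound 1 (Eventually.of_forall fun s => by rw [Complex.norm_real, one_mul])
  exact (h3.mul h.decay).trans mul_exp_neg_two_isBigO

lemma dec_mul (t : ℝ) : Dec (fun s : ℝ => ((s : ℂ) - t) • shiftL2 A s) :=
  dec_smul_shiftL2 h.continuous h.decay t

lemma hasDerivAt_shift (t : ℝ) : HasDerivAt (shiftL2 A) (shiftL2 A₁ t) t :=
  hasDerivAt_shiftL2 h.deriv h.dec h.dec₁ t

lemma hasDerivAt_shift₁ (t : ℝ) :
    HasDerivAt (shiftL2 A₁) (shiftL2 (fun s : ℝ => (s : ℂ) * A s) t) t :=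
  hasDerivAt_shiftL2 h.deriv₁ h.dec₁ h.dec₂ t

lemma op₁_shift_add (s t : ℝ) :
    hankelOp A₁ t (shiftL2 A s) + hankelOp A t (shiftL2 A₁ s) = -(A s • shiftL2 A t) := by
  rw [add_comm]
  exact pair_deriv_add_pair_deriv h.dec h.dec₁ h.dec.shiftL2 h.dec₁.shiftL2 h.deriv
    h.hasDerivAt_shift s t

lemma op_shift₂_sub (s t : ℝ) :
    hankelOp A t (shiftL2 (fun s : ℝ => (s : ℂ) * A s) s) -
      hankelOp (fun s : ℝ => (s : ℂ) * A s) t (shiftL2 A s) =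
      A s • shiftL2 A₁ t - A₁ s • shiftL2 A t := by
  have e1 := pair_deriv_add_pair_deriv h.dec₁ h.dec₂ h.dec.shiftL2 h.dec₁.shiftL2 h.deriv₁
    h.hasDerivAt_shift s t
  have e2 := pair_deriv_add_pair_deriv h.dec h.dec₁ h.dec₁.shiftL2 h.dec₂.shiftL2 h.deriv
    h.hasDerivAt_shift₁ s t
  simp only [hankelOp_apply]
  rw [← add_sub_add_right_eq_sub, e1, add_comm, e2]
  abel

lemma shift₂_sub (s : ℝ) :
    shiftL2 (fun s : ℝ => (s : ℂ) * A s) s - (s : ℂ) • shiftL2 A s =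
      shiftL2 (fun r : ℝ => ((r : ℂ) - s) * A r) s := by
  rw [← shiftL2_smul h.dec, ← shiftL2_sub h.dec₂ (h.dec.const_smul _)]
  congr 1
  ext r
  rw [smul_eq_mul]; ring

lemma dec_sub_mul (s : ℝ) : Dec (fun r : ℝ => ((r : ℂ) - s) * A r) := by
  have := h.dec₂.sub (h.dec.const_smul (s : ℂ))
  simpa only [smul_eq_mul, ← sub_mul] using this

lemma mulHankelOp_shift (s t : ℝ) :
    hankelOp A t (shiftL2 (fun s : ℝ => (s : ℂ) * A s) s - (s : ℂ) • shiftL2 A s) =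
      mulHankelOp A t (shiftL2 A s) := by
  rw [h.shift₂_sub, hankelOp_apply, mulHankelOp_apply,
    pair_shiftL2 (h.dec_sub_mul s) h.dec.shiftL2, pair_shiftL2 h.dec (h.dec_mul t)]
  congr 1
  ext1 x
  rw [smul_smul]
  congr 1
  push_cast
  ring

lemma commutator_kernel (t : ℝ) (g : HalfL2) :
    hankelOp (fun s : ℝ => (s : ℂ) * A s) t g - (t : ℂ) • hankelOp A t g - mulHankelOp A t g =
      pair g (shiftL2 (fun s : ℝ => shiftL2 (fun s : ℝ => (s : ℂ) * A s) s
        - (s : ℂ) • shiftL2 A s) t) := by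
  have e : (fun s : ℝ => shiftL2 (fun s : ℝ => (s : ℂ) * A s) s - (s : ℂ) • shiftL2 A s) =
      fun s => shiftL2 (fun s : ℝ => (s : ℂ) * A s) s - (t : ℂ) • shiftL2 A s
        - ((s : ℂ) - t) • shiftL2 A s := by
    ext1 s
    module
  rw [e, shiftL2_sub (h.dec₂.shiftL2.sub (h.dec.shiftL2.const_smul _)) (h.dec_mul t),
    shiftL2_sub h.dec₂.shiftL2 (h.dec.shiftL2.const_smul _), shiftL2_smul h.dec.shiftL2]
  simp only [map_sub, map_smul, hankelOp_apply, mulHankelOp_apply]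

lemma dec_commutator :
    Dec (fun s : ℝ => shiftL2 (fun s : ℝ => (s : ℂ) * A s) s - (s : ℂ) • shiftL2 A s) := by
  have := h.dec₂.shiftL2.sub (h.dec_mul 0)
  simpa using this

lemma adj (t : ℝ) (f g : HalfL2) :
    pair f (hankelOp (fun s : ℝ => (s : ℂ) * A s) t g - (t : ℂ) • hankelOp A t g
      - mulHankelOp A t g) = pair (mulHankelOp A t f) g := by
  rw [h.commutator_kernel, pair_comm _ g, mulHankelOp_apply]
  obtain ⟨C, hC, hb⟩ := (h.dec_sub_mul t).bound t
  obtain ⟨D, hD, hbD⟩ := h.decay.exists_nonneg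
  obtain ⟨C, hC, hb⟩ : ∃ C, 0 ≤ C ∧ ∀ x y : ℝ, 0 < x → 0 < y →
      ‖(x : ℂ) * A (t + x + y)‖ ≤ C * Real.exp (-x) * Real.exp (-y) := by
    refine ⟨C * Real.exp (-t), by positivity, fun x y hx hy => ?_⟩
    refine le_trans ?_ ((hb (t + x + y) (by linarith)).trans (le_of_eq ?_))
    · rw [norm_mul, norm_mul]
      gcongr
      rw [Complex.norm_real, ← Complex.ofReal_sub, Complex.norm_real,
        Real.norm_of_nonneg hx.le, Real.norm_of_nonneg (by linarith)]
      linarith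
    · rw [neg_add, neg_add, Real.exp_add, Real.exp_add]
      ring
  refine pair_pair_swap (k := fun x y => (x : ℂ) * A (t + x + y)) (C := C) ?_ hb ?_ ?_ f g
  · have := h.continuous
    simp only [Function.uncurry_def]
    fun_prop
  · filter_upwards [h.dec_commutator.coeFn t] with y hy
    rw [hy, h.shift₂_sub]
    filter_upwards [(h.dec_sub_mul (t + y)).coeFn (t + y)] with x hx
    rw [hx]
    have : t + y + x = t + x + y := by ring
    rw [this]
    push_cast
    ring
  · filter_upwards [(h.dec_mul t).coeFn t] with x hx
    rw [hx]
    filter_upwards [h.dec.coeFn (t + x), Lp.coeFn_smul (((t + x : ℝ) : ℂ) - t)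
      (shiftL2 A (t + x))] with y h1 h2
    rw [h2, Pi.smul_apply, h1, smul_eq_mul]
    push_cast
    ring

lemma edgeRel (t : ℝ) :
    EdgeRel pair (hankelOp A t) (hankelOp A₁ t) (hankelOp (fun s : ℝ => (s : ℂ) * A s) t)
      (mulHankelOp A t) (shiftL2 A t) (shiftL2 A₁ t) (shiftL2 (fun s : ℝ => (s : ℂ) * A s) t)
      t (A t) (A₁ t) where
  comm := pair_comm
  symm := pair_hankelOp_comm h.dec t
  symm₁ := pair_hankelOp_comm h.dec₁ t
  symm₂ := pair_hankelOp_comm h.dec₂ t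
  rel₁ f := by
    rw [hankelOp_apply A t f, hankelOp_apply A₁ t f, clm_pair_shiftL2 _ _ h.dec.shiftL2,
      clm_pair_shiftL2 _ _ h.dec₁.shiftL2, ← map_add,
      ← shiftL2_add (h.dec.shiftL2.clm _) (h.dec₁.shiftL2.clm _)]
    have e : (fun s => hankelOp A₁ t (shiftL2 A s) + hankelOp A t (shiftL2 A₁ s)) =
        fun s => A s • -shiftL2 A t := by
      ext1 s
      rw [h.op₁_shift_add, smul_neg]
    rw [e, pair_shiftL2_const _ h.dec, smul_neg, pair_comm f]
  rel₁a := h.op₁_shift_add t t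
  aa₁ := by
    have := pair_deriv_add_pair_deriv h.dec h.dec₁ h.dec h.dec₁ h.deriv h.deriv t t
    rw [pair_comm (shiftL2 A₁ t), smul_eq_mul] at this
    linear_combination this
  rel₂ f := by
    have d1 : Dec (fun s => A s • shiftL2 A₁ t) :=
      h.dec.clm ((ContinuousLinearMap.id ℂ ℂ).smulRight (shiftL2 A₁ t))
    have d2 : Dec (fun s => A₁ s • shiftL2 A t) :=
      h.dec₁.clm ((ContinuousLinearMap.id ℂ ℂ).smulRight (shiftL2 A t))
    rw [hankelOp_apply (fun s : ℝ => (s : ℂ) * A s) t f, hankelOp_apply A t f,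
      clm_pair_shiftL2 _ _ h.dec₂.shiftL2, clm_pair_shiftL2 _ _ h.dec.shiftL2, ← map_sub,
      ← shiftL2_sub (h.dec₂.shiftL2.clm _) (h.dec.shiftL2.clm _)]
    simp only [h.op_shift₂_sub]
    rw [shiftL2_sub d1 d2, map_sub, pair_shiftL2_const _ h.dec, pair_shiftL2_const _ h.dec₁,
      pair_comm f, pair_comm f]
  rel₂a := by
    rw [← neg_sub, h.op_shift₂_sub, neg_sub]
  adj := h.adj t
  inter f := by
    rw [h.commutator_kernel, clm_pair_shiftL2 _ _ h.dec_commutator, hankelOp_apply A t f,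
      clm_pair_shiftL2 _ _ h.dec.shiftL2]
    simp only [h.mulHankelOp_shift]
  intera := h.mulHankelOp_shift t t

end AiryLike

set_option linter.unusedSectionVars false

section Resolvent

variable {X : Type*} [NormedAddCommGroup X] [NormedSpace ℂ X]

/-- `1 - γ T` is invertible, with inverse of norm at most `1 / c`. -/
structure Resolvable (γ : ℂ) (c : ℝ) (T : X →L[ℂ] X) : Prop where
  pos : 0 < c
  isUnit : IsUnit (1 - γ • T)
  le : ∀ x, c * ‖x‖ ≤ ‖x - γ • T x‖

/-- The inverse of `1 - γ T`. -/
def resolv (γ : ℂ) (T : X →L[ℂ] X) : X →L[ℂ] X := Ring.inverse (1 - γ • T)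

variable {γ : ℂ} {c : ℝ} {T : X →L[ℂ] X} (h : Resolvable γ c T)
include h

lemma Resolvable.resolv_apply (x : X) : resolv γ T x - γ • T (resolv γ T x) = x := by
  have := congrArg (fun L : X →L[ℂ] X => L x) (Ring.mul_inverse_cancel _ h.isUnit)
  simpa [resolv] using this

lemma Resolvable.norm_resolv_le (x : X) : c * ‖resolv γ T x‖ ≤ ‖x‖ := by
  have := h.le (resolv γ T x)
  rwa [h.resolv_apply] at this

lemma Resolvable.inj {x y : X} (hxy : x - γ • T x = y - γ • T y) : x = y := by
  have h1 := h.le (x - y)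
  have h2 : x - y - γ • T (x - y) = 0 := by
    rw [map_sub, smul_sub, sub_sub_sub_comm, hxy, sub_self]
  rw [h2, norm_zero] at h1
  have := nonpos_of_mul_nonpos_right h1 h.pos
  exact sub_eq_zero.1 (norm_le_zero_iff.1 this)

lemma Resolvable.eq_resolv {x y : X} (hxy : x - γ • T x = y) : x = resolv γ T y :=
  h.inj (hxy.trans (h.resolv_apply y).symm)

end Resolvent

section Deriv

variable {E F G : Type*} [NormedAddCommGroup E] [NormedSpace ℂ E] [NormedAddCommGroup F]
  [NormedSpace ℂ F] [NormedAddCommGroup G] [NormedSpace ℂ G]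

lemma hasDerivAt_bilin (L : E →L[ℂ] F →L[ℂ] G) {f : ℝ → E} {g : ℝ → F} {f' : E} {g' : F} {t : ℝ}
    (hf : HasDerivAt f f' t) (hg : HasDerivAt g g' t) :
    HasDerivAt (fun s => L (f s) (g s)) (L f' (g t) + L (f t) g') t := by
  rw [add_comm]
  exact (L.bilinearRestrictScalars ℝ).hasDerivAt_of_bilinear (fun _ => hf) (fun _ => hg)

lemma hasDerivAt_op {f : ℝ → E →L[ℂ] F} {g : ℝ → E} {f' : E →L[ℂ] F} {g' : E} {t : ℝ}
    (hf : HasDerivAt f f' t) (hg : HasDerivAt g g' t) :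
    HasDerivAt (fun s => f s (g s)) (f' (g t) + f t g') t :=
  hasDerivAt_bilin (ContinuousLinearMap.id ℂ (E →L[ℂ] F)) hf hg

lemma exists_hasDerivAt_resolv [CompleteSpace E] {γ : ℂ} {c : ℝ} {T : ℝ → E →L[ℂ] E}
    {T' : E →L[ℂ] E} {t : ℝ} (hT : HasDerivAt T T' t) (h : Resolvable γ c (T t)) :
    ∃ R', HasDerivAt (fun s => resolv γ (T s)) R' t := by
  have h1 : DifferentiableAt ℝ (@Ring.inverse (E →L[ℂ] E) _) (1 - γ • T t) :=
    (differentiableAt_inverse (𝕜 := ℂ) h.isUnit).restrictScalars ℝ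
  have h2 : HasDerivAt (fun s => 1 - γ • T s) (-(γ • T')) t := (hT.const_smul γ).const_sub 1
  exact ⟨_, h1.hasFDerivAt.comp_hasDerivAt t h2⟩

end Deriv

/-- The vector `κ (1 - κ² B²)⁻¹ a`. -/
def edgeV (A : ℝ → ℂ) (κ : ℂ) (t : ℝ) : HalfL2 :=
  κ • resolv (κ ^ 2) (hankelOp A t * hankelOp A t) (shiftL2 A t)

/-- The vector `κ² B (1 - κ² B²)⁻¹ a`. -/
def edgeW (A : ℝ → ℂ) (κ : ℂ) (t : ℝ) : HalfL2 := κ • hankelOp A t (edgeV A κ t)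

/-- The Ablowitz–Segur transcendent. -/
def edgeU (A : ℝ → ℂ) (κ : ℂ) (t : ℝ) : ℂ := κ * A t + κ * pair (shiftL2 A t) (edgeW A κ t)

/-- The logarithmic derivative of the limiting determinant. -/
def edgeQ (A : ℝ → ℂ) (κ : ℂ) (t : ℝ) : ℂ := κ * pair (shiftL2 A t) (edgeV A κ t)

namespace AiryLike

variable {A A₁ : ℝ → ℂ} (h : AiryLike A A₁) {κ : ℂ} {c : ℝ}
  (hc : ∀ t, Resolvable (κ ^ 2) c (hankelOp A t * hankelOp A t))
include h hc

omit h in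
lemma edgeV_eq (t : ℝ) :
    κ • hankelOp A t (edgeW A κ t) = edgeV A κ t - κ • shiftL2 A t := by
  have h1 := (hc t).resolv_apply (shiftL2 A t)
  set r := resolv (κ ^ 2) (hankelOp A t * hankelOp A t) (shiftL2 A t) with hr
  rw [eq_sub_iff_add_eq, ← h1]
  simp only [edgeW, edgeV, ← hr, map_smul, mul_apply_eq_comp]
  module

omit h in
lemma edge_inj (t : ℝ) (x : HalfL2) (hx : x = κ ^ 2 • hankelOp A t (hankelOp A t x)) :
    x = 0 := by
  apply (hc t).inj
  rw [map_zero, smul_zero, sub_zero, sub_eq_zero]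
  exact hx

lemma hasDerivAt_edgeVW (t : ℝ) :
    HasDerivAt (edgeW A κ) (-(edgeU A κ t • edgeV A κ t)) t ∧
    HasDerivAt (edgeV A κ) (κ • shiftL2 A₁ t + κ • hankelOp A₁ t (edgeW A κ t)
      - edgeU A κ t • edgeW A κ t) t := by
  have hB := hasDerivAt_hankelOp h.deriv h.dec h.dec₁ t
  have hBB := hasDerivAt_bilin (ContinuousLinearMap.compL ℂ HalfL2 HalfL2 HalfL2) hB hB
  obtain ⟨R', hR'⟩ := exists_hasDerivAt_resolv hBB (hc t)
  obtain ⟨v', hv'⟩ : ∃ v', HasDerivAt (edgeV A κ) v' t :=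
    ⟨_, (hasDerivAt_op hR' (h.hasDerivAt_shift t)).const_smul κ⟩
  have hw' : HasDerivAt (edgeW A κ)
      (κ • (hankelOp A₁ t (edgeV A κ t) + hankelOp A t v')) t :=
    (hasDerivAt_op hB hv').const_smul κ
  obtain ⟨w', hw'', hw'e⟩ : ∃ w', HasDerivAt (edgeW A κ) w' t ∧
      w' = κ • hankelOp A₁ t (edgeV A κ t) + κ • hankelOp A t v' := ⟨_, hw', smul_add _ _ _⟩
  have hv'' : HasDerivAt (edgeV A κ) (κ • shiftL2 A₁ t +
      κ • (hankelOp A₁ t (edgeW A κ t) + hankelOp A t w')) t := by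
    have e : edgeV A κ = fun s => κ • shiftL2 A s + κ • hankelOp A s (edgeW A κ s) := by
      ext1 s
      rw [edgeV_eq hc]; abel
    rw [e]
    exact ((h.hasDerivAt_shift t).const_smul κ).add ((hasDerivAt_op hB hw'').const_smul κ)
  have hv'e := hv'.unique hv''
  rw [smul_add, ← add_assoc] at hv'e
  obtain ⟨e1, e2⟩ := (h.edgeRel t).deriv_w (edgeV_eq hc t) rfl hw'e hv'e (edge_inj hc t)
  exact ⟨e1 ▸ hw'', e2 ▸ hv'⟩

lemma hasDerivAt_edgeQ (t : ℝ) : HasDerivAt (edgeQ A κ) (-edgeU A κ t ^ 2) t := by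
  have h1 := (hasDerivAt_bilin (pair (E := ℂ)) (h.hasDerivAt_shift t)
    (h.hasDerivAt_edgeVW hc t).2).const_mul κ
  refine h1.congr_deriv ?_
  have e1 := (h.edgeRel t).pr_B₁ (edgeV_eq hc t)
  have e2 := (h.edgeRel t).aa₁
  simp only [map_add, map_sub, map_smul, smul_eq_mul]
  have e3 : edgeU A κ t = κ * A t + κ * pair (shiftL2 A t) (edgeW A κ t) := rfl
  rw [e3]
  linear_combination e1 + κ ^ 2 / 2 * e2

lemma hasDerivAt_edgeU (t : ℝ) : HasDerivAt (edgeU A κ)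
    (κ * A₁ t + κ * pair (shiftL2 A₁ t) (edgeW A κ t) - edgeU A κ t * edgeQ A κ t) t := by
  have h1 := ((h.deriv t).const_mul κ).add ((hasDerivAt_bilin (pair (E := ℂ))
    (h.hasDerivAt_shift t) (h.hasDerivAt_edgeVW hc t).1).const_mul κ)
  refine h1.congr_deriv ?_
  simp only [map_neg, map_smul, smul_eq_mul, edgeQ]
  ring

lemma deriv_edgeU : _root_.deriv (edgeU A κ) = fun t : ℝ =>
    κ * A₁ t + κ * pair (shiftL2 A₁ t) (edgeW A κ t) - edgeU A κ t * edgeQ A κ t :=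
  funext fun t => (h.hasDerivAt_edgeU hc t).deriv

lemma hasDerivAt_deriv_edgeU (t : ℝ) : HasDerivAt (_root_.deriv (edgeU A κ))
    (t * edgeU A κ t + 2 * edgeU A κ t ^ 3) t := by
  rw [h.deriv_edgeU hc]
  have h1 := (((h.deriv₁ t).const_mul κ).add ((hasDerivAt_bilin (pair (E := ℂ))
    (h.hasDerivAt_shift₁ t) (h.hasDerivAt_edgeVW hc t).1).const_mul κ)).sub
    ((h.hasDerivAt_edgeU hc t).mul (h.hasDerivAt_edgeQ hc t))
  refine h1.congr_deriv ?_
  have e1 := (h.edgeRel t).two_h (edgeV_eq hc t) rfl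
  have e2 := (h.edgeRel t).pr_a₂ (edgeV_eq hc t) rfl
  have e3 : edgeU A κ t = κ * A t + κ * pair (shiftL2 A t) (edgeW A κ t) := rfl
  have e4 : edgeQ A κ t = κ * pair (shiftL2 A t) (edgeV A κ t) := rfl
  simp only [map_neg, map_smul, smul_eq_mul]
  rw [← e3, ← e4] at e1 e2
  linear_combination e2 - edgeU A κ t * e1 - (t : ℂ) * e3

lemma norm_edgeV_le (t : ℝ) : ‖edgeV A κ t‖ ≤ ‖κ‖ / c * ‖shiftL2 A t‖ := by
  rw [edgeV, norm_smul, div_mul_eq_mul_div, mul_div_assoc]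
  gcongr
  rw [le_div_iff₀ (hc t).pos, mul_comm]
  exact (hc t).norm_resolv_le _

lemma edgeV_isBigO : edgeV A κ =O[atTop] fun s => Real.exp (-s) :=
  (IsBigO.of_bound (‖κ‖ / c) (Eventually.of_forall (h.norm_edgeV_le hc))).trans h.dec.shiftL2.2

lemma edgeQ_isBigO : edgeQ A κ =O[atTop] fun s => Real.exp (-(2 * s)) := by
  have h1 : edgeQ A κ =O[atTop] fun s => ‖shiftL2 A s‖ * ‖edgeV A κ s‖ := by
    refine IsBigO.of_bound (‖κ‖ * ‖(pair (E := ℂ))‖) (Eventually.of_forall fun s => ?_)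
    rw [edgeQ, norm_mul, mul_assoc, Real.norm_of_nonneg (by positivity), ← mul_assoc ‖pair (E := ℂ)‖]
    gcongr
    exact (pair (E := ℂ)).le_opNorm₂ _ _
  refine (h1.trans (h.dec.shiftL2.2.norm_left.mul (h.edgeV_isBigO hc).norm_left)).congr_right ?_
  intro s
  rw [← Real.exp_add]; congr 1; ring

lemma edgeW_isBigO : edgeW A κ =O[atTop] fun s => Real.exp (-s) := by
  have h1 : edgeW A κ =O[atTop] fun s => ‖hankelOp A s‖ * ‖edgeV A κ s‖ := by
    refine IsBigO.of_bound ‖κ‖ (Eventually.of_forall fun s => ?_)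
    rw [edgeW, norm_smul, Real.norm_of_nonneg (by positivity)]
    gcongr
    exact (hankelOp A s).le_opNorm _
  have h2 : (hankelOp A) =O[atTop] fun _ => (1 : ℝ) := by
    have : Tendsto (hankelOp A) atTop (𝓝 ((pair (E := HalfL2)).flip 0)) :=
      ((pair (E := HalfL2)).flip.continuous.tendsto 0).comp h.dec.shiftL2.shiftL2.tendsto
    exact this.isBigO_one ℝ
  refine (h1.trans (h2.norm_left.mul (h.edgeV_isBigO hc).norm_left)).congr_right ?_
  intro s
  rw [one_mul]

lemma continuous_edgeU : Continuous (edgeU A κ) :=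
  continuous_iff_continuousAt.2 fun t => (h.hasDerivAt_edgeU hc t).continuousAt

lemma continuous_edgeQ : Continuous (edgeQ A κ) :=
  continuous_iff_continuousAt.2 fun t => (h.hasDerivAt_edgeQ hc t).continuousAt

lemma edgeU_isBigO : edgeU A κ =O[atTop] fun s => Real.exp (-s) := by
  have h1 : (fun s => κ * pair (shiftL2 A s) (edgeW A κ s)) =O[atTop]
      fun s => ‖shiftL2 A s‖ * ‖edgeW A κ s‖ := by
    refine IsBigO.of_bound (‖κ‖ * ‖(pair (E := ℂ))‖) (Eventually.of_forall fun s => ?_)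
    rw [norm_mul, mul_assoc, Real.norm_of_nonneg (by positivity), ← mul_assoc ‖pair (E := ℂ)‖]
    gcongr
    exact (pair (E := ℂ)).le_opNorm₂ _ _
  have h2 := h1.trans (h.dec.shiftL2.2.norm_left.mul (h.edgeW_isBigO hc).norm_left)
  have h3 : (fun s : ℝ => Real.exp (-s) * Real.exp (-s)) =O[atTop] fun s => Real.exp (-s) := by
    refine exp_neg_two_isBigO.congr_left fun s => ?_
    rw [← Real.exp_add]; congr 1; ring
  exact (h.dec.2.const_mul_left κ).add (h2.trans h3)

lemma edgeU_sq_dec (t : ℝ) : Dec (fun s : ℝ => ((s : ℂ) - t) * edgeU A κ s ^ 2) := by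
  refine ⟨by have := h.continuous_edgeU hc; fun_prop, ?_⟩
  have h1 : (fun s => edgeU A κ s ^ 2) =O[atTop] fun s : ℝ => Real.exp (-(2 * s)) := by
    refine ((h.edgeU_isBigO hc).pow 2).congr_right fun s => ?_
    rw [← Real.exp_nat_mul]; congr 1; push_cast; ring
  have h3 : (fun s : ℝ => (s : ℂ)) =O[atTop] fun s => s :=
    IsBigO.of_bound 1 (Eventually.of_forall fun s => by rw [Complex.norm_real, one_mul])
  simp only [sub_mul]
  exact ((h3.mul h1).trans mul_exp_neg_two_isBigO).sub
    ((h1.const_mul_left _).trans exp_neg_two_isBigO)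

lemma edgeQ_dec : Dec (edgeQ A κ) :=
  ⟨h.continuous_edgeQ hc, (h.edgeQ_isBigO hc).trans exp_neg_two_isBigO⟩

lemma integral_edgeQ (t : ℝ) :
    ∫ s in Ioi t, edgeQ A κ s = ∫ s in Ioi t, ((s : ℂ) - t) * edgeU A κ s ^ 2 := by
  have i1 := (h.edgeQ_dec hc).integrable t
  have i2 := (h.edgeU_sq_dec hc t).integrable t
  rw [← sub_eq_zero, ← integral_sub i1 i2]
  have := integral_Ioi_of_hasDerivAt_of_tendsto' (a := t) (m := 0)
    (f := fun s : ℝ => ((s : ℂ) - t) * edgeQ A κ s)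
    (f' := fun s : ℝ => edgeQ A κ s - ((s : ℂ) - t) * edgeU A κ s ^ 2)
    (fun s _ => ?_) (i1.sub i2) ?_
  · rw [this]; simp
  · have h1 : HasDerivAt (fun s : ℝ => (s : ℂ) - t) 1 s :=
      (Complex.ofRealCLM.hasDerivAt (x := s)).sub_const _
    refine (h1.mul (h.hasDerivAt_edgeQ hc s)).congr_deriv ?_
    ring
  · have h3 : (fun s : ℝ => (s : ℂ)) =O[atTop] fun s => s :=
      IsBigO.of_bound 1 (Eventually.of_forall fun s => by rw [Complex.norm_real, one_mul])
    have h4 : (fun s : ℝ => ((s : ℂ) - t) * edgeQ A κ s) =O[atTop] fun s => Real.exp (-s) := by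
      simp only [sub_mul]
      exact ((h3.mul (h.edgeQ_isBigO hc)).trans mul_exp_neg_two_isBigO).sub
        ((h.edgeQ_dec hc).2.const_mul_left _)
    exact h4.trans_tendsto Real.tendsto_exp_neg_atTop_nhds_zero

lemma tendsto_edgeU_div (hA : ∀ᶠ t in atTop, A t ≠ 0 ∧
    ∀ x, 0 < x → ‖A (t + x)‖ ≤ ‖A t‖ * Real.exp (-x)) :
    Tendsto (fun t => edgeU A κ t / A t) atTop (𝓝 κ) := by
  have h1 : Tendsto (fun t => κ * pair (shiftL2 A t) (edgeW A κ t) / A t) atTop (𝓝 0) := by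
    have hw : Tendsto (edgeW A κ) atTop (𝓝 0) :=
      (h.edgeW_isBigO hc).trans_tendsto Real.tendsto_exp_neg_atTop_nhds_zero
    have h2 : Tendsto (fun t => ‖κ‖ * ‖(pair (E := ℂ))‖ * expNorm * ‖edgeW A κ t‖) atTop (𝓝 0) := by
      simpa using hw.norm.const_mul (‖κ‖ * ‖(pair (E := ℂ))‖ * expNorm)
    refine squeeze_zero_norm' ?_ h2
    filter_upwards [hA] with t ⟨h0, hb⟩
    have h3 := norm_shiftL2_le (norm_nonneg _) hb
    have h4 : 0 < ‖A t‖ := norm_pos_iff.2 h0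
    rw [norm_div, norm_mul, div_le_iff₀ h4]
    calc ‖κ‖ * ‖pair (shiftL2 A t) (edgeW A κ t)‖
        ≤ ‖κ‖ * (‖(pair (E := ℂ))‖ * ‖shiftL2 A t‖ * ‖edgeW A κ t‖) := by
          gcongr; exact (pair (E := ℂ)).le_opNorm₂ _ _
      _ ≤ ‖κ‖ * (‖(pair (E := ℂ))‖ * (‖A t‖ * expNorm) * ‖edgeW A κ t‖) := by gcongr
      _ = _ := by ring
  have h5 := h1.const_add κ
  rw [add_zero] at h5
  refine h5.congr' ?_
  filter_upwards [hA] with t ht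
  rw [edgeU, add_div, mul_div_cancel_right₀ _ ht.1]

end AiryLike

section Form

set_option linter.unusedSectionVars false

lemma inner_eq_pair (f g : HalfL2) : inner ℂ f g = pair (star f) g := by
  rw [L2.inner_def, pair_eq_integral]
  refine integral_congr_ae ?_
  filter_upwards [Lp.coeFn_star f] with x hx
  rw [hx, RCLike.inner_apply, smul_eq_mul, mul_comm]
  rfl

lemma eq_of_pair_eq {f g : HalfL2} (h : ∀ k, pair k f = pair k g) : f = g := by
  refine ext_inner_left ℂ fun k => ?_
  rw [inner_eq_pair, inner_eq_pair, h]

lemma star_shiftL2 {f : ℝ → ℂ} (hf : Dec f) (hr : ∀ s, star (f s) = f s) (t : ℝ) :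
    star (shiftL2 f t) = shiftL2 f t := by
  apply Lp.ext
  filter_upwards [Lp.coeFn_star (shiftL2 f t), hf.coeFn t] with x h1 h2
  rw [h1, Pi.star_apply, h2, hr]

lemma hankelOp_eq_shiftL2 {φ : ℝ → ℂ} (h : Dec φ) (t : ℝ) (f : HalfL2) :
    hankelOp φ t f = shiftL2 (fun s => pair f (shiftL2 φ s)) t := by
  refine eq_of_pair_eq fun k => ?_
  rw [pair_hankelOp_comm h, hankelOp_apply]
  exact (clm_pair_shiftL2 (pair f) k h.shiftL2 t)

/-- The quadratic form of `T` is real with values between `0` and `‖x‖²`. -/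
def UnitForm (T : HalfL2 →L[ℂ] HalfL2) : Prop :=
  ∀ x, inner ℂ x (T x) ∈ Complex.ofReal '' Icc 0 (‖x‖ ^ 2)

lemma UnitForm.of_tendsto {ι : Type*} {l : Filter ι} [l.NeBot]
    {K : ι → HalfL2 →L[ℂ] HalfL2} {T : HalfL2 →L[ℂ] HalfL2}
    (h : ∀ᶠ i in l, UnitForm (K i)) (hlim : Tendsto K l (𝓝 T)) : UnitForm T := by
  intro x
  have hcl : IsClosed (Complex.ofReal '' Icc 0 (‖x‖ ^ 2)) :=
    (isCompact_Icc.image Complex.continuous_ofReal).isClosed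
  have h1 : Tendsto (fun i => K i x) l (𝓝 (T x)) :=
    ((ContinuousLinearMap.apply ℂ HalfL2 x).continuous.tendsto T).comp hlim
  refine hcl.mem_of_tendsto (tendsto_const_nhds.inner h1) (h.mono fun i hi => hi x)

lemma UnitForm.resolvable {T : HalfL2 →L[ℂ] HalfL2} (h : UnitForm T) {γ : ℂ} {c : ℝ}
    (hc : 0 < c) (hγ : ∀ r ∈ Icc (0 : ℝ) 1, c ≤ ‖1 - γ * r‖) : Resolvable γ c T := by
  have key : ∀ x, ‖x‖ ^ 2 * c ≤ ‖inner ℂ x (x - γ • T x)‖ := by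
    intro x
    rcases eq_or_ne x 0 with rfl | hx
    · simp
    obtain ⟨r, hr, he⟩ := h x
    have hx' : 0 < ‖x‖ ^ 2 := by positivity
    rw [inner_sub_right, inner_smul_right, ← he, inner_self_eq_norm_sq_to_K]
    have h2 := hγ (r / ‖x‖ ^ 2) ⟨div_nonneg hr.1 hx'.le, (div_le_one hx').2 hr.2⟩
    have h3 : ((‖x‖ : ℂ) ^ 2 - γ * (r : ℂ)) =
        ((‖x‖ ^ 2 : ℝ) : ℂ) * (1 - γ * ((r / ‖x‖ ^ 2 : ℝ) : ℂ)) := by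
      have : (‖x‖ : ℂ) ^ 2 ≠ 0 := by exact_mod_cast hx'.ne'
      push_cast
      rw [mul_sub, mul_one, mul_div_assoc', mul_div_cancel₀ _ this]
    have h4 : ‖((‖x‖ : ℂ) ^ 2 - γ * (r : ℂ))‖ = ‖x‖ ^ 2 * ‖1 - γ * ((r / ‖x‖ ^ 2 : ℝ) : ℂ)‖ := by
      rw [h3, norm_mul, Complex.norm_real, Real.norm_of_nonneg hx'.le]
    refine le_trans (mul_le_mul_of_nonneg_left h2 hx'.le) h4.ge
  refine ⟨hc, ?_, ?_⟩
  · refine ContinuousLinearMap.isUnit_of_forall_le_norm_inner_map _ (c := ⟨c, hc.le⟩) hc fun x => ?_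
    rw [norm_inner_symm]
    exact key x
  · intro x
    rcases eq_or_ne x 0 with rfl | hx
    · simp
    have h1 := (key x).trans (norm_inner_le_norm _ _)
    have h2 : 0 < ‖x‖ := norm_pos_iff.2 hx
    nlinarith

end Form

lemma hasDerivAt_det {ι : Type*} [Fintype ι] [DecidableEq ι] {M : ℝ → Matrix ι ι ℂ}
    {M' : Matrix ι ι ℂ} {t : ℝ} (h : ∀ i j, HasDerivAt (fun s => M s i j) (M' i j) t) :
    HasDerivAt (fun s => (M s).det) (∑ i, ((M t).updateRow i (M' i)).det) t := by
  let L : ContinuousMultilinearMap ℂ (fun _ : ι => ι → ℂ) ℂ :=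
    { (Matrix.detRowAlternating (R := ℂ) (n := ι)).toMultilinearMap with
      cont := Continuous.matrix_det (A := fun x : ι → ι → ℂ => (x : Matrix ι ι ℂ)) continuous_id }
  have h1 : HasDerivAt (fun s => (M s : ι → ι → ℂ)) (M' : ι → ι → ℂ) t :=
    hasDerivAt_pi.2 fun i => hasDerivAt_pi.2 fun j => h i j
  have h2 := (L.hasFDerivAt (x := (M t : ι → ι → ℂ))).restrictScalars ℝ
  have h3 := h2.comp_hasDerivAt t h1
  refine HasDerivAt.congr_deriv h3 ?_
  exact L.linearDeriv_apply _ _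

lemma eq_exp_neg_integral {D R : ℝ → ℂ} (hR : Dec R) (hD : ∀ s, HasDerivAt D (R s * D s) s)
    (hlim : Tendsto D atTop (𝓝 1)) (t : ℝ) : D t = Complex.exp (-∫ s in Ioi t, R s) := by
  have h1 : ∀ s, HasDerivAt (fun s => D s * Complex.exp (-∫ x in t..s, R x)) 0 s := by
    intro s
    have h2 : HasDerivAt (fun s => ∫ x in t..s, R x) (R s) s :=
      intervalIntegral.integral_hasDerivAt_right (hR.1.intervalIntegrable _ _)
        (hR.1.stronglyMeasurableAtFilter _ _) hR.1.continuousAt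
    refine ((hD s).mul h2.neg.cexp).congr_deriv ?_
    ring
  have h3 := is_const_of_deriv_eq_zero (fun s => (h1 s).differentiableAt) (fun s => (h1 s).deriv)
  have h4 : Tendsto (fun s => D s * Complex.exp (-∫ x in t..s, R x)) atTop
      (𝓝 (1 * Complex.exp (-∫ x in Ioi t, R x))) :=
    hlim.mul ((Complex.continuous_exp.tendsto _).comp
      (intervalIntegral_tendsto_integral_Ioi t (hR.integrable t) tendsto_id).neg)
  have h5 : (fun s => D s * Complex.exp (-∫ x in t..s, R x)) = fun _ => D t := by
    funext s
    rw [h3 s t]; simp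
  rw [h5, one_mul] at h4
  exact tendsto_nhds_unique tendsto_const_nhds h4

/-- Real-valued decaying functions whose restrictions to half-lines satisfy the Bessel bound
of an orthonormal family. -/
structure OrthoFam {n : ℕ} (ψ ψ₁ : Fin n → ℝ → ℂ) : Prop where
  deriv : ∀ j s, HasDerivAt (ψ j) (ψ₁ j s) s
  dec : ∀ j, Dec (ψ j)
  dec₁ : ∀ j, Dec (ψ₁ j)
  real : ∀ j s, star (ψ j s) = ψ j s
  bessel : ∀ t (c : Fin n → ℂ), ‖∑ j, c j • shiftL2 (ψ j) t‖ ^ 2 ≤ ∑ j, ‖c j‖ ^ 2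

section Fam

set_option linter.unusedSectionVars false

variable {n : ℕ} (ψ : Fin n → ℝ → ℂ)

/-- The Gram matrix of the family on a half-line. -/
def gram (t : ℝ) : Matrix (Fin n) (Fin n) ℂ :=
  Matrix.of fun i j => pair (shiftL2 (ψ i) t) (shiftL2 (ψ j) t)

/-- The Christoffel–Darboux operator of the family on a half-line. -/
def famOp (t : ℝ) : HalfL2 →L[ℂ] HalfL2 :=
  ∑ j, (pair (shiftL2 (ψ j) t)).smulRight (shiftL2 (ψ j) t)

/-- The Christoffel–Darboux kernel with one variable frozen. -/
def famVec (t : ℝ) : HalfL2 := ∑ j, ψ j t • shiftL2 (ψ j) t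

/-- The Fredholm determinant of the family on a half-line. -/
def famDet (γ : ℂ) (t : ℝ) : ℂ := (1 - γ • gram ψ t).det

/-- The logarithmic derivative of the Fredholm determinant. -/
def famLog (γ : ℂ) (t : ℝ) : ℂ :=
  γ * (∑ j, ψ j t ^ 2 + γ * pair (famVec ψ t) (resolv γ (famOp ψ t) (famVec ψ t)))

lemma famOp_apply (t : ℝ) (f : HalfL2) :
    famOp ψ t f = ∑ j, pair (shiftL2 (ψ j) t) f • shiftL2 (ψ j) t := by
  simp [famOp]

lemma famOp_sum (t : ℝ) (v : Fin n → ℂ) :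
    famOp ψ t (∑ j, v j • shiftL2 (ψ j) t) =
      ∑ j, ((gram ψ t).mulVec v j) • shiftL2 (ψ j) t := by
  rw [famOp_apply]
  refine Finset.sum_congr rfl fun i _ => ?_
  rw [map_sum]
  congr 1
  simp only [map_smul, smul_eq_mul, Matrix.mulVec, dotProduct, gram, Matrix.of_apply]
  exact Finset.sum_congr rfl fun j _ => mul_comm _ _

lemma gram_transpose (t : ℝ) : (gram ψ t).transpose = gram ψ t := by
  ext i j
  exact pair_comm _ _

variable {ψ} {ψ₁ : Fin n → ℝ → ℂ} (h : OrthoFam ψ ψ₁)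
include h

lemma OrthoFam.unitForm (t : ℝ) : UnitForm (famOp ψ t) := by
  intro f
  set c : Fin n → ℂ := fun j => pair (shiftL2 (ψ j) t) f with hc
  have h1 : inner ℂ f (famOp ψ t f) = ((∑ j, ‖c j‖ ^ 2 : ℝ) : ℂ) := by
    rw [famOp_apply, inner_sum, Complex.ofReal_sum]
    refine Finset.sum_congr rfl fun j _ => ?_
    rw [inner_smul_right, ← inner_conj_symm, inner_eq_pair,
      star_shiftL2 (h.dec j) (h.real j), RCLike.mul_conj]
    norm_cast
  refine ⟨_, ⟨by positivity, ?_⟩, h1.symm⟩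
  have h2 : (∑ j, ‖c j‖ ^ 2) ≤ ‖f‖ * ‖famOp ψ t f‖ := by
    have := norm_inner_le_norm (𝕜 := ℂ) f (famOp ψ t f)
    rwa [h1, Complex.norm_real, Real.norm_of_nonneg (by positivity)] at this
  have h3 : ‖famOp ψ t f‖ ^ 2 ≤ ∑ j, ‖c j‖ ^ 2 := by
    rw [famOp_apply]; exact h.bessel t c
  set S := ∑ j, ‖c j‖ ^ 2
  have hS : 0 ≤ S := by positivity
  have h4 : S ^ 2 ≤ ‖f‖ ^ 2 * S := by
    calc S ^ 2 ≤ (‖f‖ * ‖famOp ψ t f‖) ^ 2 := by gcongr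
      _ = ‖f‖ ^ 2 * ‖famOp ψ t f‖ ^ 2 := by ring
      _ ≤ _ := by gcongr
  rcases hS.eq_or_lt with h0 | h0
  · rw [← h0]; positivity
  · nlinarith

variable {γ : ℂ} {c : ℝ}

lemma OrthoFam.famDet_ne_zero {t : ℝ} (hr : Resolvable γ c (famOp ψ t)) :
    famDet ψ γ t ≠ 0 := by
  intro h0
  obtain ⟨v, hv, hM⟩ := Matrix.exists_mulVec_eq_zero_iff.2 h0
  rw [Matrix.sub_mulVec, Matrix.one_mulVec, Matrix.smul_mulVec, sub_eq_zero] at hM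
  have hx : ∑ j, v j • shiftL2 (ψ j) t = 0 := by
    refine hr.inj ?_
    rw [famOp_sum, map_zero, smul_zero, sub_zero, sub_eq_zero, Finset.smul_sum]
    refine Finset.sum_congr rfl fun j _ => ?_
    rw [smul_smul]
    exact congrArg (· • _) (congrFun hM j)
  have hg : (gram ψ t).mulVec v = 0 := by
    ext i
    have := congrArg (pair (shiftL2 (ψ i) t)) hx
    rw [map_sum, map_zero] at this
    rw [Pi.zero_apply, ← this]
    simp only [map_smul, smul_eq_mul, Matrix.mulVec, dotProduct, gram, Matrix.of_apply]
    exact Finset.sum_congr rfl fun j _ => mul_comm _ _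
  rw [hg, smul_zero] at hM
  exact hv hM

lemma OrthoFam.hasDerivAt_gram (i j : Fin n) (t : ℝ) :
    HasDerivAt (fun s => gram ψ s i j) (-(ψ i t * ψ j t)) t := by
  have := hasDerivAt_bilin (pair (E := ℂ)) (hasDerivAt_shiftL2 (h.deriv i) (h.dec i) (h.dec₁ i) t)
    (hasDerivAt_shiftL2 (h.deriv j) (h.dec j) (h.dec₁ j) t)
  rwa [pair_deriv_add_pair_deriv (h.dec i) (h.dec₁ i) (h.dec j) (h.dec₁ j) (h.deriv i)
    (h.deriv j)] at this

lemma OrthoFam.hasDerivAt_famDet {t : ℝ} (hr : Resolvable γ c (famOp ψ t)) :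
    HasDerivAt (famDet ψ γ) (famLog ψ γ t * famDet ψ γ t) t := by
  set M := 1 - γ • gram ψ t with hM
  have hD : M.det ≠ 0 := h.famDet_ne_zero hr
  have hT : M.transpose = M := by
    rw [hM, Matrix.transpose_sub, Matrix.transpose_smul, gram_transpose, Matrix.transpose_one]
  have h1 := hasDerivAt_det (M := fun s => 1 - γ • gram ψ s) (t := t)
    (M' := Matrix.of fun i j => γ * (ψ i t * ψ j t)) (fun i j => by
      have := ((h.hasDerivAt_gram i j t).const_mul γ).const_sub ((1 : Matrix _ _ ℂ) i j)
      simpa using this)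
  refine h1.congr_deriv ?_
  set p : Fin n → ℂ := fun j => ψ j t with hp
  set v : Fin n → ℂ := M.det⁻¹ • M.cramer p with hv
  have hMv : M.mulVec v = p := by
    rw [hv, Matrix.mulVec_smul, Matrix.mulVec_cramer, smul_smul, inv_mul_cancel₀ hD, one_smul]
  have hv' : ∀ j, v j = p j + γ * (gram ψ t).mulVec v j := by
    intro j
    rw [hM, Matrix.sub_mulVec, Matrix.one_mulVec, Matrix.smul_mulVec] at hMv
    have := congrFun hMv j
    simp only [Pi.sub_apply, Pi.smul_apply, smul_eq_mul] at this
    rw [← this, sub_add_cancel]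
  have hx : ∑ j, v j • shiftL2 (ψ j) t = resolv γ (famOp ψ t) (famVec ψ t) := by
    refine hr.eq_resolv ?_
    rw [famOp_sum, famVec, Finset.smul_sum, ← Finset.sum_sub_distrib]
    refine Finset.sum_congr rfl fun j _ => ?_
    rw [smul_smul, ← sub_smul]
    congr 1
    exact sub_eq_iff_eq_add.2 (hv' j)
  have hsum : ∀ i, (M.updateRow i (fun j => γ * (ψ i t * ψ j t))).det =
      γ * (p i * v i) * M.det := by
    intro i
    have : (fun j => γ * (ψ i t * ψ j t)) = (γ * p i) • p := by
      ext j; simp [hp, mul_assoc]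
    rw [this, Matrix.det_updateRow_smul, ← Matrix.cramer_transpose_apply, hT, hv]
    simp only [Pi.smul_apply, smul_eq_mul]
    field_simp
  have hgo : ∑ i, (M.updateRow i (fun j => γ * (ψ i t * ψ j t))).det =
      famLog ψ γ t * M.det := by
    rw [Finset.sum_congr rfl fun i _ => hsum i, ← Finset.sum_mul, ← Finset.mul_sum, famLog, ← hx]
    congr 2
    have : ∀ i, p i * v i = p i ^ 2 + γ * (p i * (gram ψ t).mulVec v i) := by
      intro i
      rw [pow_two, mul_left_comm, ← mul_add, ← hv']
    rw [Finset.sum_congr rfl fun i _ => this i, Finset.sum_add_distrib, ← Finset.mul_sum]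
    congr 2
    rw [famVec, pair_comm, map_sum]
    refine Finset.sum_congr rfl fun i _ => ?_
    rw [map_smul, pair_comm, map_sum, smul_eq_mul]
    congr 1
    simp only [map_smul, smul_eq_mul, Matrix.mulVec, dotProduct, gram, Matrix.of_apply]
    exact Finset.sum_congr rfl fun j _ => mul_comm _ _
  exact hgo

lemma OrthoFam.famVec_dec : Dec (famVec ψ) :=
  Dec.sum fun j _ => (h.dec j).smul (h.dec j).shiftL2

lemma OrthoFam.continuous_resolv (hr : ∀ t, Resolvable γ c (famOp ψ t)) :
    Continuous fun t => resolv γ (famOp ψ t) := by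
  have h1 : Continuous (famOp ψ) := by
    refine continuous_finsetSum _ fun j _ => ?_
    have := (h.dec j).shiftL2.1
    exact ((ContinuousLinearMap.smulRightL ℂ HalfL2 HalfL2).continuous.comp
      (pair.continuous.comp this)).clm_apply this
  refine continuous_iff_continuousAt.2 fun t => ?_
  obtain ⟨u, hu⟩ := (hr t).isUnit
  have h2 := NormedRing.inverse_continuousAt u
  rw [hu] at h2
  have h3 : Continuous fun t => 1 - γ • famOp ψ t := by fun_prop
  exact h2.comp (f := fun t => 1 - γ • famOp ψ t) h3.continuousAt

lemma OrthoFam.famLog_dec (hr : ∀ t, Resolvable γ c (famOp ψ t)) : Dec (famLog ψ γ) := by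
  have hk := h.famVec_dec
  have hc := (hr 0).pos
  have h1 : Dec fun t => resolv γ (famOp ψ t) (famVec ψ t) := by
    refine ⟨(h.continuous_resolv hr).clm_apply hk.1, IsBigO.trans ?_ hk.2⟩
    refine IsBigO.of_bound c⁻¹ (Eventually.of_forall fun t => ?_)
    rw [← div_eq_inv_mul, le_div_iff₀' hc]
    exact (hr t).norm_resolv_le _
  have h2 : Dec fun t => pair (famVec ψ t) (resolv γ (famOp ψ t) (famVec ψ t)) := by
    refine ⟨(pair.continuous.comp hk.1).clm_apply h1.1, ?_⟩
    have h3 : (fun t => ‖famVec ψ t‖ * ‖resolv γ (famOp ψ t) (famVec ψ t)‖) =O[atTop]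
        fun s => Real.exp (-s) := by
      have := hk.tendsto.isBigO_one ℝ
      simpa using this.norm_left.mul h1.2.norm_left
    refine IsBigO.trans (IsBigO.of_bound ‖pair (E := ℂ)‖ (Eventually.of_forall fun t => ?_)) h3
    rw [Real.norm_of_nonneg (by positivity), ← mul_assoc]
    exact (pair (E := ℂ)).le_opNorm₂ _ _
  have h4 : Dec fun t => ∑ j, ψ j t ^ 2 := by
    simpa only [smul_eq_mul, pow_two] using Dec.sum (s := Finset.univ)
      fun j _ => (h.dec j).smul (h.dec j)
  exact (h4.add (h2.const_smul γ)).const_smul γ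

lemma OrthoFam.famDet_eq (hr : ∀ t, Resolvable γ c (famOp ψ t)) (t : ℝ) :
    famDet ψ γ t = Complex.exp (-∫ s in Ioi t, famLog ψ γ s) := by
  refine eq_exp_neg_integral (h.famLog_dec hr) (fun s => h.hasDerivAt_famDet (hr s)) ?_ t
  have h1 : Tendsto (fun t => gram ψ t) atTop (𝓝 0) := by
    refine tendsto_pi_nhds.2 fun i => tendsto_pi_nhds.2 fun j => ?_
    have h2 := ((pair (E := ℂ)).continuous₂.tendsto (0, 0)).comp
      ((h.dec i).shiftL2.tendsto.prodMk_nhds (h.dec j).shiftL2.tendsto)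
    rw [Function.uncurry_apply_pair, map_zero] at h2
    exact h2
  have h3 : Continuous fun M : Matrix (Fin n) (Fin n) ℂ => (1 - γ • M).det := by fun_prop
  have h4 := (h3.tendsto 0).comp h1
  rw [smul_zero, sub_zero, Matrix.det_one] at h4
  exact h4

end Fam

lemma sum_smul_shiftL2 {n : ℕ} {ψ : Fin n → ℝ → ℂ} (h : ∀ j, Dec (ψ j)) (c : Fin n → ℂ) (t : ℝ) :
    ∑ j, c j • shiftL2 (ψ j) t = shiftL2 (fun s => ∑ j, c j • ψ j s) t := by
  have (v : Finset (Fin n)) : ∑ j ∈ v, c j • shiftL2 (ψ j) t =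
      shiftL2 (fun s => ∑ j ∈ v, c j • ψ j s) t := by
    induction v using Finset.cons_induction with
    | empty =>
      have hz : Dec fun _ : ℝ => (0 : ℂ) := ⟨continuous_const, isBigO_zero _ _⟩
      simpa using (shiftL2_smul hz 0 t).symm
    | cons i v hi ih =>
      simp only [Finset.sum_cons]
      rw [ih, shiftL2_add ((h i).const_smul _) (Dec.sum fun j _ => (h j).const_smul _),
        shiftL2_smul (h i)]
  exact this Finset.univ

section CD

set_option linter.unusedSectionVars false

/-- A family whose kernel has a Christoffel–Darboux derivative of rank two. -/
structure EdgeFam {n : ℕ} (ψ ψ₁ : Fin n → ℝ → ℂ) (a b : ℝ → ℂ) : Prop extends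
    OrthoFam ψ ψ₁ where
  dec_left : Dec a
  dec_right : Dec b
  telescope : ∀ x y, ∑ j, (ψ₁ j x * ψ j y + ψ j x * ψ₁ j y) =
    -((1 / 2 : ℂ) * (a x * b y + b x * a y))

variable {n : ℕ} {ψ ψ₁ : Fin n → ℝ → ℂ} {a b : ℝ → ℂ} (h : EdgeFam ψ ψ₁ a b)
include h

lemma EdgeFam.kernel_eq (x y : ℝ) : ∑ j, ψ j x * ψ j y =
    (1 / 2 : ℂ) * (pair (shiftL2 a x) (shiftL2 b y) + pair (shiftL2 b x) (shiftL2 a y)) := by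
  have h1 : ∀ j, ψ j x * ψ j y = -∫ s in Ioi (0 : ℝ),
      (ψ₁ j (x + s) * ψ j (y + s) + ψ j (x + s) * ψ₁ j (y + s)) := by
    intro j
    have i1 := (((h.dec₁ j).comp_add x).smul ((h.dec j).comp_add y)).integrable 0
    have i2 := (((h.dec j).comp_add x).smul ((h.dec₁ j).comp_add y)).integrable 0
    have := pair_deriv_add_pair_deriv (h.dec j) (h.dec₁ j) (h.dec j) (h.dec₁ j) (h.deriv j)
      (h.deriv j) x y
    rw [pair_shiftL2 (h.dec₁ j) (h.dec j), pair_shiftL2 (h.dec j) (h.dec₁ j),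
      ← integral_add i1 i2] at this
    simp only [smul_eq_mul] at this
    rw [this, neg_neg]
  have h2 : ∀ j ∈ Finset.univ, IntegrableOn
      (fun s => ψ₁ j (x + s) * ψ j (y + s) + ψ j (x + s) * ψ₁ j (y + s)) (Ioi (0 : ℝ)) := by
    intro j _
    exact ((((h.dec₁ j).comp_add x).smul ((h.dec j).comp_add y)).add
      (((h.dec j).comp_add x).smul ((h.dec₁ j).comp_add y))).integrable 0
  rw [Finset.sum_congr rfl fun j _ => h1 j, Finset.sum_neg_distrib, ← integral_finsetSum _ h2]
  simp only [h.telescope]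
  rw [integral_neg, neg_neg, integral_const_mul, pair_shiftL2 h.dec_left h.dec_right,
    pair_shiftL2 h.dec_right h.dec_left, ← integral_add
      (((h.dec_left.comp_add x).smul (h.dec_right.comp_add y)).integrable 0)
      (((h.dec_right.comp_add x).smul (h.dec_left.comp_add y)).integrable 0)]
  rfl

lemma EdgeFam.sum_sq (t : ℝ) : ∑ j, ψ j t ^ 2 = pair (shiftL2 a t) (shiftL2 b t) := by
  simp only [pow_two]
  rw [h.kernel_eq, pair_comm (shiftL2 b t)]
  ring

lemma EdgeFam.sum_smul_eq (y t : ℝ) : ∑ j, ψ j y • shiftL2 (ψ j) t =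
    (1 / 2 : ℂ) • (hankelOp b t (shiftL2 a y) + hankelOp a t (shiftL2 b y)) := by
  have da := h.dec_left
  have db := h.dec_right
  have d1 : Dec fun s => pair (shiftL2 a y) (shiftL2 b s) := db.shiftL2.clm _
  have d2 : Dec fun s => pair (shiftL2 b y) (shiftL2 a s) := da.shiftL2.clm _
  rw [sum_smul_shiftL2 h.dec, hankelOp_eq_shiftL2 db, hankelOp_eq_shiftL2 da, ← shiftL2_add d1 d2,
    ← shiftL2_smul (d1.add d2)]
  congr 1
  funext s
  exact h.kernel_eq y s

lemma EdgeFam.famVec_eq (t : ℝ) : famVec ψ t =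
    (1 / 2 : ℂ) • (hankelOp b t (shiftL2 a t) + hankelOp a t (shiftL2 b t)) :=
  h.sum_smul_eq t t

lemma EdgeFam.famOp_eq (t : ℝ) : famOp ψ t =
    (1 / 2 : ℂ) • (hankelOp a t * hankelOp b t + hankelOp b t * hankelOp a t) := by
  have da := h.dec_left
  have db := h.dec_right
  ext1 f
  have d1 : Dec fun s => pair (hankelOp b t f) (shiftL2 a s) := da.shiftL2.clm _
  have d2 : Dec fun s => pair (hankelOp a t f) (shiftL2 b s) := db.shiftL2.clm _
  rw [famOp_apply, sum_smul_shiftL2 h.dec]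
  change _ = (1 / 2 : ℂ) • (hankelOp a t (hankelOp b t f) + hankelOp b t (hankelOp a t f))
  rw [hankelOp_eq_shiftL2 da, hankelOp_eq_shiftL2 db t (hankelOp a t f), ← shiftL2_add d1 d2,
    ← shiftL2_smul (d1.add d2)]
  congr 1
  funext s
  have e1 : ∑ j, pair (shiftL2 (ψ j) t) f • ψ j s = pair f (∑ j, ψ j s • shiftL2 (ψ j) t) := by
    rw [map_sum]
    refine Finset.sum_congr rfl fun j _ => ?_
    rw [map_smul, smul_eq_mul, smul_eq_mul, pair_comm f, mul_comm]
  rw [e1, h.sum_smul_eq, map_smul, map_add, pair_hankelOp_comm db, pair_hankelOp_comm da,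
    pair_comm _ (shiftL2 a s), pair_comm _ (shiftL2 b s)]

end CD

section Limit

set_option linter.unusedSectionVars false

/-- Convergence of functions, locally dominated by a multiple of `e^{-s}` on half-lines. -/
structure EdgeConv (a : ℕ → ℝ → ℂ) (A : ℝ → ℂ) : Prop where
  dec : ∀ᶠ n in atTop, Dec (a n)
  lim : ∀ s, Tendsto (fun n => a n s) atTop (𝓝 (A s))
  bound : ∀ T, ∃ C, 0 ≤ C ∧ ∀ᶠ n in atTop, ∀ s, T ≤ s → ‖a n s‖ ≤ C * Real.exp (-s)

variable {a b : ℕ → ℝ → ℂ} {A : ℝ → ℂ}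

lemma EdgeConv.tendsto_shiftL2 (h : EdgeConv a A) (hA : Dec A) (s : ℝ) :
    Tendsto (fun n => shiftL2 (a n) s) atTop (𝓝 (shiftL2 A s)) := by
  obtain ⟨C, hC, hb⟩ := h.bound s
  refine HankelEdge.tendsto_shiftL2 (C := C * Real.exp (-s)) (h.dec.mono fun n hn => hn.1) hA.1
    (fun x _ => h.lim (s + x)) (hb.mono fun n hn x hx => ?_)
  have := hn (s + x) (by linarith)
  rwa [neg_add, Real.exp_add, ← mul_assoc] at this

lemma EdgeConv.norm_shiftL2 (h : EdgeConv a A) (T : ℝ) :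
    ∃ C, 0 ≤ C ∧ ∀ᶠ n in atTop, ∀ s, T ≤ s → ‖shiftL2 (a n) s‖ ≤ C * Real.exp (-s) := by
  obtain ⟨C, hC, hb⟩ := h.bound T
  have := expNorm_nonneg
  refine ⟨C * expNorm, by positivity, hb.mono fun n hn s hs => ?_⟩
  have h1 : ‖shiftL2 (a n) s‖ ≤ C * Real.exp (-s) * expNorm := by
    refine norm_shiftL2_le (by positivity) fun x hx => ?_
    have := hn (s + x) (by linarith)
    rwa [neg_add, Real.exp_add, ← mul_assoc] at this
  linarith

lemma EdgeConv.tendsto_hankelOp (h : EdgeConv a A) (hA : Dec A) (s : ℝ) :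
    Tendsto (fun n => hankelOp (a n) s) atTop (𝓝 (hankelOp A s)) := by
  obtain ⟨C, hC, hb⟩ := h.norm_shiftL2 s
  refine ((pair (E := HalfL2)).flip.continuous.tendsto _).comp ?_
  refine HankelEdge.tendsto_shiftL2 (C := C * Real.exp (-s)) (h.dec.mono fun n hn => hn.shiftL2.1)
    hA.shiftL2.1 (fun x _ => h.tendsto_shiftL2 hA (s + x)) (hb.mono fun n hn x hx => ?_)
  have := hn (s + x) (by linarith)
  rwa [neg_add, Real.exp_add, ← mul_assoc] at this

lemma EdgeConv.norm_hankelOp (h : EdgeConv a A) (T : ℝ) :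
    ∃ C, 0 ≤ C ∧ ∀ᶠ n in atTop, ∀ s, T ≤ s → ‖hankelOp (a n) s‖ ≤ C * Real.exp (-s) := by
  obtain ⟨C, hC, hb⟩ := h.norm_shiftL2 T
  have := expNorm_nonneg
  refine ⟨‖(pair (E := HalfL2)).flip‖ * (C * expNorm), by positivity, hb.mono fun n hn s hs => ?_⟩
  have h1 : ‖shiftL2 (shiftL2 (a n)) s‖ ≤ C * Real.exp (-s) * expNorm := by
    refine norm_shiftL2_le (by positivity) fun x hx => ?_
    have := hn (s + x) (by linarith)
    rwa [neg_add, Real.exp_add, ← mul_assoc] at this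
  calc _ ≤ ‖(pair (E := HalfL2)).flip‖ * ‖shiftL2 (shiftL2 (a n)) s‖ :=
        (pair (E := HalfL2)).flip.le_opNorm _
    _ ≤ ‖(pair (E := HalfL2)).flip‖ * (C * Real.exp (-s) * expNorm) := by gcongr
    _ = _ := by ring

variable {d : ℕ → ℕ} {ψ ψ₁ : ∀ n, Fin (d n) → ℝ → ℂ}
  (h : ∀ᶠ n in atTop, EdgeFam (ψ n) (ψ₁ n) (a n) (b n)) (ha : EdgeConv a A) (hb : EdgeConv b A)
  (hA : Dec A)
include h ha hb

lemma EdgeConv.norm_famVec (T : ℝ) :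
    ∃ C, 0 ≤ C ∧ ∀ᶠ n in atTop, ∀ s, T ≤ s → ‖famVec (ψ n) s‖ ≤ C * Real.exp (-s) := by
  obtain ⟨C₁, h₁, e₁⟩ := ha.norm_shiftL2 T
  obtain ⟨C₂, h₂, e₂⟩ := hb.norm_shiftL2 T
  obtain ⟨C₃, h₃, e₃⟩ := ha.norm_hankelOp T
  obtain ⟨C₄, h₄, e₄⟩ := hb.norm_hankelOp T
  refine ⟨(C₁ * C₄ + C₂ * C₃) * Real.exp (-T), by positivity, ?_⟩
  filter_upwards [h, e₁, e₂, e₃, e₄] with n hn f₁ f₂ f₃ f₄ s hs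
  rw [hn.famVec_eq]
  have k1 := ((hankelOp (b n) s).le_opNorm (shiftL2 (a n) s)).trans
    (mul_le_mul (f₄ s hs) (f₁ s hs) (norm_nonneg _) (by positivity))
  have k2 := ((hankelOp (a n) s).le_opNorm (shiftL2 (b n) s)).trans
    (mul_le_mul (f₃ s hs) (f₂ s hs) (norm_nonneg _) (by positivity))
  have k3 : Real.exp (-s) ≤ Real.exp (-T) := Real.exp_le_exp.2 (by linarith)
  rw [norm_smul]
  have k4 : ‖(1 / 2 : ℂ)‖ ≤ 1 := by norm_num
  calc _ ≤ 1 * (C₄ * Real.exp (-s) * (C₁ * Real.exp (-s)) +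
        C₃ * Real.exp (-s) * (C₂ * Real.exp (-s))) := by
        gcongr
        exact (norm_add_le _ _).trans (add_le_add k1 k2)
    _ = (C₁ * C₄ + C₂ * C₃) * Real.exp (-s) * Real.exp (-s) := by ring
    _ ≤ _ := by gcongr

variable {γ : ℂ} {c : ℝ} (hc : 0 < c) (hγ : ∀ r ∈ Icc (0 : ℝ) 1, c ≤ ‖1 - γ * r‖)
include hc hγ

lemma EdgeConv.norm_famLog (T : ℝ) :
    ∃ C, 0 ≤ C ∧ ∀ᶠ n in atTop, ∀ s, T ≤ s → ‖famLog (ψ n) γ s‖ ≤ C * Real.exp (-s) := by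
  obtain ⟨C₁, h₁, e₁⟩ := ha.norm_shiftL2 T
  obtain ⟨C₂, h₂, e₂⟩ := hb.norm_shiftL2 T
  obtain ⟨C₃, h₃, e₃⟩ := EdgeConv.norm_famVec h ha hb T
  set P := ‖pair (E := ℂ)‖
  have hP : 0 ≤ P := norm_nonneg (pair (E := ℂ))
  refine ⟨‖γ‖ * (P * C₁ * C₂ + ‖γ‖ * (P * C₃ * (c⁻¹ * C₃))) * Real.exp (-T), by positivity, ?_⟩
  filter_upwards [h, e₁, e₂, e₃] with n hn f₁ f₂ f₃ s hs
  have hr := (hn.unitForm s).resolvable hc hγ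
  rw [famLog, hn.sum_sq]
  have k1 := (pair (E := ℂ)).le_opNorm₂ (shiftL2 (a n) s) (shiftL2 (b n) s)
  have k2 := (pair (E := ℂ)).le_opNorm₂ (famVec (ψ n) s) (resolv γ (famOp (ψ n) s) (famVec (ψ n) s))
  have k3 : Real.exp (-s) ≤ Real.exp (-T) := Real.exp_le_exp.2 (by linarith)
  have k4 : ‖resolv γ (famOp (ψ n) s) (famVec (ψ n) s)‖ ≤ c⁻¹ * (C₃ * Real.exp (-s)) := by
    rw [← div_eq_inv_mul, le_div_iff₀' hc]
    exact (hr.norm_resolv_le _).trans (f₃ s hs)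
  rw [norm_mul]
  calc _ ≤ ‖γ‖ * (P * (C₁ * Real.exp (-s)) * (C₂ * Real.exp (-s)) +
        ‖γ‖ * (P * (C₃ * Real.exp (-s)) * (c⁻¹ * (C₃ * Real.exp (-s))))) := by
        gcongr
        refine (norm_add_le _ _).trans (add_le_add (k1.trans ?_) ?_)
        · gcongr
          · exact f₁ s hs
          · exact f₂ s hs
        · rw [norm_mul]
          gcongr
          refine k2.trans ?_
          gcongr
          exact f₃ s hs
    _ = ‖γ‖ * (P * C₁ * C₂ + ‖γ‖ * (P * C₃ * (c⁻¹ * C₃))) * Real.exp (-s) * Real.exp (-s) := by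
        ring
    _ ≤ _ := by gcongr

include hA

lemma EdgeConv.tendsto_famOp (s : ℝ) :
    Tendsto (fun n => famOp (ψ n) s) atTop (𝓝 (hankelOp A s * hankelOp A s)) := by
  have h1 := ha.tendsto_hankelOp hA s
  have h2 := hb.tendsto_hankelOp hA s
  have h3 := ((h1.mul h2).add (h2.mul h1)).const_smul (1 / 2 : ℂ)
  rw [← two_smul ℂ, smul_smul, one_div, inv_mul_cancel₀ two_ne_zero, one_smul] at h3
  refine h3.congr' (h.mono fun n hn => ?_)
  simp only [hn.famOp_eq, one_div]

lemma EdgeConv.resolvable (s : ℝ) : Resolvable γ c (hankelOp A s * hankelOp A s) :=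
  (UnitForm.of_tendsto (h.mono fun _ hn => hn.unitForm s)
    (EdgeConv.tendsto_famOp h ha hb hA hc hγ s)).resolvable hc hγ

lemma EdgeConv.tendsto_famVec (s : ℝ) :
    Tendsto (fun n => famVec (ψ n) s) atTop (𝓝 (hankelOp A s (shiftL2 A s))) := by
  have h1 := ha.tendsto_hankelOp hA s
  have h2 := hb.tendsto_hankelOp hA s
  have h3 := ha.tendsto_shiftL2 hA s
  have h4 := hb.tendsto_shiftL2 hA s
  have hap := (isBoundedBilinearMap_apply (𝕜 := ℂ) (E := HalfL2) (F := HalfL2)).continuous.tendsto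
    (hankelOp A s, shiftL2 A s)
  have h5 := ((hap.comp (h2.prodMk_nhds h3)).add (hap.comp (h1.prodMk_nhds h4))).const_smul
    (1 / 2 : ℂ)
  rw [← two_smul ℂ, smul_smul, one_div, inv_mul_cancel₀ two_ne_zero, one_smul] at h5
  refine h5.congr' (h.mono fun n hn => ?_)
  simp only [hn.famVec_eq, one_div]
  rfl

lemma EdgeConv.tendsto_famLog (s : ℝ) : Tendsto (fun n => famLog (ψ n) γ s) atTop
    (𝓝 (γ * pair (shiftL2 A s) (resolv γ (hankelOp A s * hankelOp A s) (shiftL2 A s)))) := by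
  have hr := EdgeConv.resolvable h ha hb hA hc hγ s
  set B := hankelOp A s with hB
  set x := shiftL2 A s with hx
  have hcomm : B (resolv γ (B * B) x) = resolv γ (B * B) (B x) := by
    refine hr.eq_resolv ?_
    have := congrArg B (hr.resolv_apply x)
    rwa [map_sub, map_smul] at this
  have hval : pair x (resolv γ (B * B) x) = pair x x + γ * pair (B x) (resolv γ (B * B) (B x)) := by
    have h1 := congrArg (pair x) (hr.resolv_apply x)
    rw [map_sub, map_smul, sub_eq_iff_eq_add] at h1
    rw [h1, ← hcomm]
    congr 1
    rw [smul_eq_mul]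
    congr 1
    change pair x (B (B _)) = _
    rw [hB, pair_hankelOp_comm hA, pair_comm]
  rw [hval]
  have h1 := EdgeConv.tendsto_famOp h ha hb hA hc hγ s
  have h2 := EdgeConv.tendsto_famVec h ha hb hA hc hγ s
  obtain ⟨u, hu⟩ := hr.isUnit
  have h3 : Tendsto (fun n => resolv γ (famOp (ψ n) s)) atTop (𝓝 (resolv γ (B * B))) := by
    have h4 := NormedRing.inverse_continuousAt u
    rw [hu] at h4
    exact h4.tendsto.comp ((h1.const_smul γ).const_sub 1)
  have hap := (isBoundedBilinearMap_apply (𝕜 := ℂ) (E := HalfL2) (F := HalfL2)).continuous.tendsto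
    (resolv γ (B * B), B x)
  have h5 := hap.comp (h3.prodMk_nhds h2)
  have h6 := ((pair (E := ℂ)).continuous₂.tendsto (_, _)).comp (h2.prodMk_nhds h5)
  have h7 := ((pair (E := ℂ)).continuous₂.tendsto (_, _)).comp
    ((ha.tendsto_shiftL2 hA s).prodMk_nhds (hb.tendsto_shiftL2 hA s))
  refine ((h7.add (h6.const_mul γ)).const_mul γ).congr' (h.mono fun n hn => ?_)
  simp only [famLog, hn.sum_sq]
  rfl

lemma EdgeConv.tendsto_famDet (t : ℝ) : Tendsto (fun n => famDet (ψ n) γ t) atTop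
    (𝓝 (Complex.exp (-∫ s in Ioi t,
      γ * pair (shiftL2 A s) (resolv γ (hankelOp A s * hankelOp A s) (shiftL2 A s))))) := by
  obtain ⟨C, hC, hbd⟩ := EdgeConv.norm_famLog h ha hb hc hγ t
  have hr : ∀ᶠ n in atTop, ∀ s, Resolvable γ c (famOp (ψ n) s) :=
    h.mono fun n hn s => (hn.unitForm s).resolvable hc hγ
  have h1 : Tendsto (fun n => ∫ s in Ioi t, famLog (ψ n) γ s) atTop (𝓝 (∫ s in Ioi t,
      γ * pair (shiftL2 A s) (resolv γ (hankelOp A s * hankelOp A s) (shiftL2 A s)))) := by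
    refine tendsto_integral_filter_of_dominated_convergence (fun s => C * Real.exp (-s)) ?_ ?_ ?_ ?_
    · filter_upwards [h, hr] with n hn hrn
      exact (hn.famLog_dec hrn).1.aestronglyMeasurable
    · filter_upwards [hbd] with n hn
      exact (ae_restrict_iff' measurableSet_Ioi).2
        (Eventually.of_forall fun s hs => hn s (le_of_lt hs))
    · exact (integrableOn_exp_neg_Ioi t).const_mul C
    · exact Eventually.of_forall fun s => EdgeConv.tendsto_famLog h ha hb hA hc hγ s
  refine ((Complex.continuous_exp.tendsto _).comp h1.neg).congr' ?_
  filter_upwards [h, hr] with n hn hrn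
  exact (hn.famDet_eq hrn t).symm

end Limit

section Hermite

/-- The monic orthogonal polynomials of the weight `e^{-x²}`. -/
def herm : ℕ → ℝ[X]
  | 0 => 1
  | n + 1 => X * herm n - C (1 / 2) * derivative (herm n)

lemma derivative_herm_succ (n : ℕ) : derivative (herm (n + 1)) = C ((n : ℝ) + 1) * herm n := by
  induction n with
  | zero => simp [herm]
  | succ n ih =>
    rw [herm, derivative_sub, derivative_mul, derivative_X, derivative_C_mul, ih, derivative_C_mul]
    have : herm (n + 1) = X * herm n - C (1 / 2) * derivative (herm n) := rfl
    push_cast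
    simp only [C_add, C_1] at *
    linear_combination (C (n : ℝ) + 1) * (-this)

lemma herm_monic_natDegree (n : ℕ) : (herm n).Monic ∧ (herm n).natDegree = n := by
  induction n with
  | zero => simp [herm]
  | succ n ih =>
    have h2 : (X * herm n).natDegree = n + 1 := by
      rw [monic_X.natDegree_mul ih.1, natDegree_X, ih.2, add_comm]
    have h1 : (C (1 / 2) * derivative (herm n)).degree < (X * herm n).degree := by
      rw [degree_eq_natDegree (monic_X.mul ih.1).ne_zero, h2]
      rw [degree_C_mul (by norm_num)]
      refine (degree_derivative_le).trans_lt ?_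
      rw [degree_eq_natDegree ih.1.ne_zero, ih.2]
      exact_mod_cast Nat.lt_succ_self n
    refine ⟨(monic_X.mul ih.1).sub_of_left h1, ?_⟩
    rw [herm, natDegree_eq_of_degree_eq (degree_sub_eq_left_of_degree_lt h1), h2]

lemma integrable_eval_mul_exp (p : ℝ[X]) :
    Integrable fun x : ℝ => p.eval x * Real.exp (-x ^ 2) := by
  induction p using Polynomial.induction_on' with
  | add p q hp hq =>
    simp only [eval_add, add_mul]
    exact hp.add hq
  | monomial n a =>
    have := (integrable_rpow_mul_exp_neg_mul_sq (b := 1) one_pos (s := n)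
      (by have := n.cast_nonneg (α := ℝ); linarith)).const_mul a
    simpa [mul_assoc] using this

lemma hasDerivAt_exp_neg_sq (x : ℝ) :
    HasDerivAt (fun x : ℝ => Real.exp (-x ^ 2)) (-(2 * x) * Real.exp (-x ^ 2)) x := by
  have := ((hasDerivAt_pow 2 x).neg).exp
  refine this.congr_deriv ?_
  simp; ring

/-- The inner product of two polynomials in the weight `e^{-x²}`. -/
def gauss (p q : ℝ[X]) : ℝ := ∫ x : ℝ, p.eval x * q.eval x * Real.exp (-x ^ 2)

lemma gauss_comm (p q : ℝ[X]) : gauss p q = gauss q p := by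
  simp only [gauss, mul_comm (eval _ p)]

lemma gauss_herm_succ (p : ℝ[X]) (n : ℕ) :
    gauss p (herm (n + 1)) = gauss (derivative p) (herm n) / 2 := by
  have h1 : ∀ x, HasDerivAt (fun x => (p * herm n).eval x * Real.exp (-x ^ 2))
      ((derivative p * herm n - C 2 * (p * herm (n + 1))).eval x * Real.exp (-x ^ 2)) x := by
    intro x
    refine (((p * herm n).hasDerivAt x).mul (hasDerivAt_exp_neg_sq x)).congr_deriv ?_
    simp [herm]
    ring
  have h2 := integral_eq_zero_of_hasDerivAt_of_integrable h1 (integrable_eval_mul_exp _)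
    (integrable_eval_mul_exp _)
  have i1 := integrable_eval_mul_exp (derivative p * herm n)
  have i2 := (integrable_eval_mul_exp (p * herm (n + 1))).const_mul 2
  have h3 := integral_sub i1 i2
  rw [integral_const_mul] at h3
  simp only [gauss, eval_sub, eval_mul, eval_C] at *
  have h4 : (∫ x, (eval x (derivative p) * eval x (herm n) -
      2 * (eval x p * eval x (herm (n + 1)))) * Real.exp (-x ^ 2)) = ∫ x,
      eval x (derivative p) * eval x (herm n) * Real.exp (-x ^ 2) -
      2 * (eval x p * eval x (herm (n + 1)) * Real.exp (-x ^ 2)) := by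
    congr 1; funext x; ring
  rw [h4, h3] at h2
  linarith

/-- The squared norm of `herm n`. -/
def hermNorm (n : ℕ) : ℝ := Real.sqrt Real.pi * n.factorial / 2 ^ n

lemma hermNorm_pos (n : ℕ) : 0 < hermNorm n := by
  unfold hermNorm; positivity

lemma hermNorm_succ (n : ℕ) : hermNorm (n + 1) = ((n : ℝ) + 1) / 2 * hermNorm n := by
  unfold hermNorm
  rw [Nat.factorial_succ]; push_cast; field_simp; ring

lemma gauss_herm (m n : ℕ) : gauss (herm m) (herm n) = if m = n then hermNorm n else 0 := by
  have hC : ∀ (c : ℝ) p q, gauss (C c * p) q = c * gauss p q := by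
    intro c p q
    simp only [gauss, eval_mul, eval_C, ← integral_const_mul, mul_assoc]
  induction n generalizing m with
  | zero =>
    cases m with
    | zero =>
      have := integral_gaussian 1
      simp only [neg_mul, one_mul, div_one] at this
      simp [gauss, herm, hermNorm, this]
    | succ m =>
      rw [gauss_comm, gauss_herm_succ]
      simp [herm, gauss]
  | succ n ih =>
    rw [gauss_herm_succ]
    cases m with
    | zero => simp [herm, gauss]
    | succ m =>
      rw [derivative_herm_succ, hC, ih]
      by_cases h : m = n
      · subst h
        simp [hermNorm_succ]; ring
      · simp [h]

end Hermite

section Hankel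

variable (l : ℝ) (β : ℂ)

lemma w_eq (x : ℝ) : w l β x = Complex.exp (Real.pi * Complex.I * β) *
    ((Real.exp (-x ^ 2) : ℂ) - (1 - Complex.exp (-(2 * Real.pi * Complex.I * β))) *
      (Ici l).indicator (fun x : ℝ => (Real.exp (-x ^ 2) : ℂ)) x) := by
  have h2 : Complex.exp (-(Real.pi * Complex.I * β)) = Complex.exp (Real.pi * Complex.I * β) *
      Complex.exp (-(2 * Real.pi * Complex.I * β)) := by
    rw [← Complex.exp_add]; congr 1; ring
  by_cases h : x < l
  · have : x ∉ Ici l := by simpa using h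
    simp [w, h]
    ring
  · have : x ∈ Ici l := by simpa using h
    simp only [w, h, if_false, indicator_of_mem this, h2]
    push_cast
    ring

lemma eval_mul_w (p : ℝ[X]) (x : ℝ) : ((p.eval x : ℝ) : ℂ) * w l β x =
    Complex.exp (Real.pi * Complex.I * β) *
    (((p.eval x * Real.exp (-x ^ 2) : ℝ) : ℂ) -
      (1 - Complex.exp (-(2 * Real.pi * Complex.I * β))) *
      (Ici l).indicator (fun x : ℝ => ((p.eval x * Real.exp (-x ^ 2) : ℝ) : ℂ)) x) := by
  rw [w_eq]
  by_cases h : x ∈ Ici l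
  · simp only [indicator_of_mem h]; push_cast; ring
  · simp only [indicator_of_notMem h]; push_cast; ring

lemma integrable_eval_mul_w (p : ℝ[X]) : Integrable fun x : ℝ => ((p.eval x : ℝ) : ℂ) * w l β x := by
  simp only [eval_mul_w]
  have h := (integrable_eval_mul_exp p).ofReal (𝕜 := ℂ)
  exact (h.sub ((h.indicator measurableSet_Ici).const_mul _)).const_mul _

lemma integral_eval_mul_w (p : ℝ[X]) : ∫ x : ℝ, ((p.eval x : ℝ) : ℂ) * w l β x =
    Complex.exp (Real.pi * Complex.I * β) * ((∫ x : ℝ, p.eval x * Real.exp (-x ^ 2) : ℝ) -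
      (1 - Complex.exp (-(2 * Real.pi * Complex.I * β))) *
      ((∫ x in Ioi l, p.eval x * Real.exp (-x ^ 2) : ℝ) : ℂ)) := by
  simp only [eval_mul_w]
  have h := (integrable_eval_mul_exp p).ofReal (𝕜 := ℂ)
  have h' := (h.indicator (measurableSet_Ici (a := l))).const_mul
    (1 - Complex.exp (-(2 * Real.pi * Complex.I * β)))
  rw [integral_const_mul]
  congr 1
  refine (integral_sub h h').trans ?_
  rw [integral_const_mul, integral_indicator measurableSet_Ici, integral_Ici_eq_integral_Ioi]
  congr 1
  · exact integral_ofReal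
  · congr 1
    exact integral_ofReal

/-- Integration against the weight as a linear functional on polynomials. -/
def moment : ℝ[X] →ₗ[ℝ] ℂ where
  toFun p := ∫ x : ℝ, ((p.eval x : ℝ) : ℂ) * w l β x
  map_add' p q := by
    rw [← integral_add (integrable_eval_mul_w l β p) (integrable_eval_mul_w l β q)]
    congr 1; funext x; simp [add_mul]
  map_smul' c p := by
    simp only [RingHom.id_apply, Complex.real_smul]
    rw [← integral_const_mul]
    congr 1; funext x; simp [mul_assoc]

lemma H_eq_det_moment (n : ℕ) : H n l β =
    Matrix.det (Matrix.of fun j k : Fin n => moment l β (herm j * herm k)) := by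
  let P : Matrix (Fin n) (Fin n) ℂ :=
    (Matrix.of fun i j : Fin n => (herm j).coeff i).map Complex.ofRealHom
  have hP : P.det = 1 := by
    have := Matrix.det_matrixOfPolynomials (fun i : Fin n => herm i)
      (fun i => (herm_monic_natDegree i).2) (fun i => (herm_monic_natDegree i).1)
    change (Complex.ofRealHom.mapMatrix _).det = 1
    rw [← RingHom.map_det, this, map_one]
  have hM : (Matrix.of fun j k : Fin n => moment l β (herm j * herm k)) = P.transpose *
      (Matrix.of fun j k : Fin n => ∫ x : ℝ, (x : ℂ) ^ ((j : ℕ) + (k : ℕ)) * w l β x) * P := by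
    ext j k
    have hs : ∀ i : Fin n, herm i = ∑ a : Fin n, (herm i).coeff a • (X : ℝ[X]) ^ (a : ℕ) := by
      intro i
      have h1 := as_sum_range' (herm i) n (by rw [(herm_monic_natDegree i).2]; exact i.2)
      rw [← Fin.sum_univ_eq_sum_range (fun a => monomial a ((herm i).coeff a))] at h1
      conv_lhs => rw [h1]
      refine Finset.sum_congr rfl fun a _ => ?_
      rw [smul_X_eq_monomial]
    have hX : ∀ a : ℕ, ∫ x : ℝ, (x : ℂ) ^ a * w l β x = moment l β (X ^ a) := by
      intro a
      simp [moment]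
    simp only [Matrix.of_apply, Matrix.mul_apply, Matrix.transpose_apply, hX]
    conv_lhs => rw [hs j, hs k]
    rw [Finset.sum_mul_sum, Finset.sum_comm, map_sum]
    refine Finset.sum_congr rfl fun b _ => ?_
    rw [map_sum, Finset.sum_mul]
    refine Finset.sum_congr rfl fun a _ => ?_
    have hPv : ∀ a j : Fin n, P a j = ((herm j).coeff a : ℂ) := fun _ _ => rfl
    rw [smul_mul_smul_comm, ← pow_add, map_smul, hPv, hPv, Complex.real_smul]
    push_cast
    ring
  rw [hM, Matrix.det_mul, Matrix.det_mul, Matrix.det_transpose, hP, one_mul, mul_one]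
  rfl

/-- The orthonormal Hermite functions. -/
def hermFun (k : ℕ) (x : ℝ) : ℝ :=
  (herm k).eval x * Real.exp (-x ^ 2 / 2) / Real.sqrt (hermNorm k)

lemma hermFun_mul (j k : ℕ) (x : ℝ) : (herm j * herm k).eval x * Real.exp (-x ^ 2) =
    Real.sqrt (hermNorm j) * Real.sqrt (hermNorm k) * (hermFun j x * hermFun k x) := by
  have h1 := (Real.sqrt_pos.2 (hermNorm_pos j)).ne'
  have h2 := (Real.sqrt_pos.2 (hermNorm_pos k)).ne'
  have h3 : Real.exp (-x ^ 2) = Real.exp (-x ^ 2 / 2) * Real.exp (-x ^ 2 / 2) := by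
    rw [← Real.exp_add]; congr 1; ring
  rw [h3, hermFun, hermFun, eval_mul]
  field_simp

lemma integral_hermFun_mul (j k : ℕ) :
    ∫ x, hermFun j x * hermFun k x = if j = k then 1 else 0 := by
  have h1 := (Real.sqrt_pos.2 (hermNorm_pos j)).ne'
  have h2 := (Real.sqrt_pos.2 (hermNorm_pos k)).ne'
  have h3 := gauss_herm j k
  simp only [gauss, ← eval_mul, hermFun_mul, integral_const_mul] at h3
  by_cases h : j = k
  · subst h
    rw [if_pos rfl] at h3 ⊢
    rw [Real.mul_self_sqrt (hermNorm_pos j).le] at h3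
    exact (mul_eq_left₀ (hermNorm_pos j).ne').1 h3
  · rw [if_neg h] at h3 ⊢
    exact (mul_eq_zero.1 h3).resolve_left (mul_ne_zero h1 h2)

lemma H_eq (n : ℕ) : H n l β = Complex.exp (Real.pi * Complex.I * β * n) *
    ((∏ j : Fin n, hermNorm j : ℝ) : ℂ) *
    (1 - (1 - Complex.exp (-(2 * Real.pi * Complex.I * β))) •
      (Matrix.of fun j k : Fin n => ((∫ x in Ioi l, hermFun j x * hermFun k x : ℝ) : ℂ))).det := by
  set D : Matrix (Fin n) (Fin n) ℂ := Matrix.diagonal fun j => (Real.sqrt (hermNorm j) : ℂ) with hD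
  have h1 : (Matrix.of fun j k : Fin n => moment l β (herm j * herm k)) =
      Complex.exp (Real.pi * Complex.I * β) • (D *
    (1 - (1 - Complex.exp (-(2 * Real.pi * Complex.I * β))) •
      (Matrix.of fun j k : Fin n => ((∫ x in Ioi l, hermFun j x * hermFun k x : ℝ) : ℂ))) * D) := by
    ext j k
    have e1 : (1 : Matrix (Fin n) (Fin n) ℂ) j k = ((∫ x, hermFun j x * hermFun k x : ℝ) : ℂ) := by
      rw [integral_hermFun_mul, Matrix.one_apply]
      simp only [Fin.ext_iff]
      split_ifs <;> simp
    rw [Matrix.of_apply, Matrix.smul_apply, hD, Matrix.mul_diagonal, Matrix.diagonal_mul,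
      Matrix.sub_apply, e1]
    change (∫ x : ℝ, (((herm j * herm k).eval x : ℝ) : ℂ) * w l β x) = _
    rw [integral_eval_mul_w]
    simp only [hermFun_mul, integral_const_mul, smul_eq_mul, Matrix.smul_apply, Matrix.of_apply]
    push_cast
    ring
  rw [H_eq_det_moment, h1, Matrix.det_smul, Matrix.det_mul, Matrix.det_mul, hD, Matrix.det_diagonal,
    Fintype.card_fin, ← Complex.exp_nat_mul]
  have h2 : ((∏ j : Fin n, hermNorm j : ℝ) : ℂ) = (∏ j : Fin n, (Real.sqrt (hermNorm j) : ℂ)) *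
      ∏ j : Fin n, (Real.sqrt (hermNorm j) : ℂ) := by
    rw [← Finset.prod_mul_distrib]
    push_cast
    refine Finset.prod_congr rfl fun j _ => ?_
    rw [← Complex.ofReal_mul, Real.mul_self_sqrt (hermNorm_pos j).le]
  rw [h2]
  have h3 : (n : ℂ) * (Real.pi * Complex.I * β) = Real.pi * Complex.I * β * n := by ring
  rw [h3]
  ring

lemma H_div (n : ℕ) : H n l β / (Complex.exp (Real.pi * Complex.I * β * n) * H n l 0) =
    (1 - (1 - Complex.exp (-(2 * Real.pi * Complex.I * β))) •
      (Matrix.of fun j k : Fin n => ((∫ x in Ioi l, hermFun j x * hermFun k x : ℝ) : ℂ))).det := by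
  rw [H_eq l β, H_eq l 0]
  have h1 : ((∏ j : Fin n, hermNorm j : ℝ) : ℂ) ≠ 0 :=
    Complex.ofReal_ne_zero.2 (Finset.prod_pos fun (j : Fin n) _ => hermNorm_pos j).ne'
  have h2 := Complex.exp_ne_zero (Real.pi * Complex.I * β * n)
  simp only [mul_zero, zero_mul, neg_zero, Complex.exp_zero, sub_self, zero_smul, sub_zero,
    Matrix.det_one, one_mul, mul_one]
  field_simp

end Hankel

section Functions

lemma continuous_hermFun (k : ℕ) : Continuous (hermFun k) := by
  unfold hermFun; fun_prop

lemma integrable_hermFun_mul (j k : ℕ) : Integrable fun x => hermFun j x * hermFun k x := by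
  have h1 := (Real.sqrt_pos.2 (hermNorm_pos j)).ne'
  have h2 := (Real.sqrt_pos.2 (hermNorm_pos k)).ne'
  have := (integrable_eval_mul_exp (herm j * herm k)).const_mul
    (Real.sqrt (hermNorm j) * Real.sqrt (hermNorm k))⁻¹
  refine this.congr (Eventually.of_forall fun x => ?_)
  simp only [hermFun_mul]
  field_simp

/-- The derivative of `hermFun k`. -/
def hermFunDeriv (k : ℕ) (x : ℝ) : ℝ :=
  Real.sqrt (k / 2) * hermFun (k - 1) x - Real.sqrt ((k + 1) / 2) * hermFun (k + 1) x

lemma sqrt_hermNorm_succ (k : ℕ) : Real.sqrt (hermNorm (k + 1)) =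
    Real.sqrt ((k + 1) / 2) * Real.sqrt (hermNorm k) := by
  rw [hermNorm_succ, Real.sqrt_mul (by positivity)]

lemma hasDerivAt_hermFun (k : ℕ) (x : ℝ) : HasDerivAt (hermFun k) (hermFunDeriv k x) x := by
  have he : HasDerivAt (fun x : ℝ => Real.exp (-x ^ 2 / 2)) (-x * Real.exp (-x ^ 2 / 2)) x := by
    have := (((hasDerivAt_pow 2 x).neg).div_const 2).exp
    refine this.congr_deriv ?_
    simp; ring
  have h := (((herm k).hasDerivAt x).mul he).div_const (Real.sqrt (hermNorm k))
  refine h.congr_deriv ?_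
  have h0 := (Real.sqrt_pos.2 (hermNorm_pos k)).ne'
  have hs : Real.sqrt (((k : ℝ) + 1) / 2) * hermFun (k + 1) x =
      (herm (k + 1)).eval x * Real.exp (-x ^ 2 / 2) / Real.sqrt (hermNorm k) := by
    have h1 : Real.sqrt (((k : ℝ) + 1) / 2) ≠ 0 := (Real.sqrt_pos.2 (by positivity)).ne'
    rw [hermFun, sqrt_hermNorm_succ]
    field_simp
  have hp : Real.sqrt ((k : ℝ) / 2) * hermFun (k - 1) x =
      (derivative (herm k)).eval x / 2 * Real.exp (-x ^ 2 / 2) / Real.sqrt (hermNorm k) := by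
    cases k with
    | zero => simp [herm]
    | succ m =>
      have h1 : Real.sqrt (((m : ℝ) + 1) / 2) ≠ 0 := (Real.sqrt_pos.2 (by positivity)).ne'
      have h2 := (Real.sqrt_pos.2 (hermNorm_pos m)).ne'
      have h3 : Real.sqrt (((m : ℝ) + 1) / 2) ^ 2 = ((m : ℝ) + 1) / 2 := Real.sq_sqrt (by positivity)
      rw [derivative_herm_succ, hermFun, sqrt_hermNorm_succ]
      simp only [Nat.add_sub_cancel, eval_mul, eval_C]
      push_cast
      field_simp
      rw [h3]
      ring
  rw [hermFunDeriv, hs, hp, herm]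
  simp only [eval_sub, eval_mul, eval_X, eval_C]
  field_simp
  ring

lemma sum_hermFunDeriv (n : ℕ) (x y : ℝ) :
    ∑ k ∈ Finset.range n, (hermFunDeriv k x * hermFun k y + hermFun k x * hermFunDeriv k y) =
      -(Real.sqrt (n / 2) * (hermFun n x * hermFun (n - 1) y + hermFun (n - 1) x * hermFun n y)) := by
  induction n with
  | zero => simp
  | succ n ih =>
    rw [Finset.sum_range_succ, ih, hermFunDeriv, hermFunDeriv]
    simp only [Nat.add_sub_cancel]
    push_cast
    ring

lemma eval_mul_exp_isBigO (p : ℝ[X]) (u : ℝ) :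
    (fun x => p.eval x * Real.exp (-x ^ 2 / 2)) =O[atTop] fun x => Real.exp (-(u * x)) := by
  have h1 : (fun x => p.eval x) =O[atTop] Real.exp := by
    induction p using Polynomial.induction_on' with
    | add p q hp hq => simpa only [eval_add] using hp.add hq
    | monomial n a =>
      simpa only [eval_monomial] using (Real.isLittleO_pow_exp_atTop (n := n)).isBigO.const_mul_left a
  have h2 : (fun x : ℝ => Real.exp x * Real.exp (-x ^ 2 / 2)) =O[atTop]
      fun x => Real.exp (-(u * x)) := by
    refine IsBigO.of_bound (Real.exp ((1 + u) ^ 2 / 2)) (Eventually.of_forall fun x => ?_)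
    rw [← Real.exp_add, Real.norm_of_nonneg (Real.exp_pos _).le,
      Real.norm_of_nonneg (Real.exp_pos _).le, ← Real.exp_add, Real.exp_le_exp]
    nlinarith [sq_nonneg (1 + u - x)]
  exact (h1.mul (isBigO_refl _ _)).trans h2

lemma norm_shiftL2_sq {F : ℝ → ℂ} (hF : Dec F) (t : ℝ) :
    ‖shiftL2 F t‖ ^ 2 = ∫ x in Ioi (0 : ℝ), ‖F (t + x)‖ ^ 2 := by
  rw [← inner_self_eq_norm_sq (𝕜 := ℂ), L2.inner_def, ← integral_re (L2.integrable_inner _ _)]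
  refine integral_congr_ae ?_
  filter_upwards [hF.coeFn t] with x hx
  rw [inner_self_eq_norm_sq, hx]

lemma integral_sum_hermFun_sq {n : ℕ} (a : Fin n → ℝ) :
    Integrable (fun x => (∑ j, a j * hermFun j x) ^ 2) ∧
      ∫ x, (∑ j, a j * hermFun j x) ^ 2 = ∑ j, a j ^ 2 := by
  have h1 : (fun x => (∑ j, a j * hermFun j x) ^ 2) = fun x =>
      ∑ j, ∑ k, a j * a k * (hermFun j x * hermFun k x) := by
    funext x
    rw [sq, Finset.sum_mul_sum]
    exact Finset.sum_congr rfl fun j _ => Finset.sum_congr rfl fun k _ => by ring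
  have h2 : ∀ j k : Fin n, Integrable fun x => a j * a k * (hermFun j x * hermFun k x) :=
    fun j k => (integrable_hermFun_mul j k).const_mul _
  rw [h1]
  refine ⟨integrable_finsetSum _ fun j _ => integrable_finsetSum _ fun k _ => h2 j k, ?_⟩
  rw [integral_finsetSum _ fun j _ => integrable_finsetSum _ fun k _ => h2 j k]
  refine Finset.sum_congr rfl fun j _ => ?_
  rw [integral_finsetSum _ fun k _ => h2 j k]
  simp only [integral_const_mul, integral_hermFun_mul, Fin.val_inj]
  simp [sq]

/-- A rescaled Hermite function. -/
def hermScaled (r l η : ℝ) (k : ℕ) (s : ℝ) : ℂ := ((r * hermFun k (l + η * s) : ℝ) : ℂ)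

variable {l η : ℝ} (hη : 0 < η)
include hη

lemma hermScaled_dec (r : ℝ) (k : ℕ) : Dec (hermScaled r l η k) := by
  refine ⟨Complex.continuous_ofReal.comp (continuous_const.mul
    ((continuous_hermFun k).comp (by fun_prop))), ?_⟩
  have h1 : Tendsto (fun s => l + η * s) atTop atTop :=
    tendsto_atTop_add_const_left _ _ (tendsto_id.const_mul_atTop hη)
  have h2 := (eval_mul_exp_isBigO (herm k) η⁻¹).comp_tendsto h1
  have h3 : ((fun x => Real.exp (-(η⁻¹ * x))) ∘ fun s => l + η * s) =O[atTop]
      fun s => Real.exp (-s) := by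
    refine IsBigO.of_bound (Real.exp (-(η⁻¹ * l))) (Eventually.of_forall fun s => le_of_eq ?_)
    rw [Function.comp, Real.norm_of_nonneg (Real.exp_pos _).le,
      Real.norm_of_nonneg (Real.exp_pos _).le, ← Real.exp_add]
    congr 1
    field_simp
    ring
  refine IsBigO.trans (IsBigO.of_bound (|r| / Real.sqrt (hermNorm k))
    (Eventually.of_forall fun s => le_of_eq ?_)) (h2.trans h3)
  rw [hermScaled, Complex.norm_real, hermFun, Function.comp, norm_mul, norm_div,
    Real.norm_eq_abs, Real.norm_of_nonneg (Real.sqrt_nonneg (hermNorm k))]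
  ring

lemma hermScaled_bessel {n : ℕ} (t : ℝ) (c : Fin n → ℂ) :
    ‖∑ j : Fin n, c j • shiftL2 (hermScaled (Real.sqrt η) l η j) t‖ ^ 2 ≤ ∑ j, ‖c j‖ ^ 2 := by
  have hd : ∀ j : Fin n, Dec (hermScaled (Real.sqrt η) l η j) := fun j => hermScaled_dec hη _ _
  obtain ⟨hi1, he1⟩ := integral_sum_hermFun_sq fun j => (c j).re
  obtain ⟨hi2, he2⟩ := integral_sum_hermFun_sq fun j => (c j).im
  rw [sum_smul_shiftL2 hd, norm_shiftL2_sq (Dec.sum fun j _ => (hd j).const_smul (c j))]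
  set G : ℝ → ℝ := fun x => (∑ j : Fin n, (c j).re * hermFun j x) ^ 2 +
    (∑ j : Fin n, (c j).im * hermFun j x) ^ 2 with hG
  have hGi : Integrable G := hi1.add hi2
  have hn : ∀ x, ‖∑ j : Fin n, c j • hermScaled (Real.sqrt η) l η j (t + x)‖ ^ 2 =
      η * G (l + η * t + η * x) := by
    intro x
    have h2 := Real.sq_sqrt hη.le
    rw [← Complex.normSq_eq_norm_sq, Complex.normSq_apply, Complex.re_sum, Complex.im_sum]
    have e1 : ∀ j : Fin n, (c j • hermScaled (Real.sqrt η) l η j (t + x)).re =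
        Real.sqrt η * ((c j).re * hermFun j (l + η * t + η * x)) := by
      intro j
      rw [hermScaled, smul_eq_mul, Complex.re_mul_ofReal, mul_add, add_assoc]; ring
    have e2 : ∀ j : Fin n, (c j • hermScaled (Real.sqrt η) l η j (t + x)).im =
        Real.sqrt η * ((c j).im * hermFun j (l + η * t + η * x)) := by
      intro j
      rw [hermScaled, smul_eq_mul, Complex.im_mul_ofReal, mul_add, add_assoc]; ring
    simp only [e1, e2, ← Finset.mul_sum, hG]
    linear_combination ((∑ j : Fin n, (c j).re * hermFun j (l + η * t + η * x)) ^ 2 +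
      (∑ j : Fin n, (c j).im * hermFun j (l + η * t + η * x)) ^ 2) * h2
  simp only [hn]
  have hi3 : Integrable fun x => η * G (l + η * t + η * x) :=
    (((hGi.comp_add_left (l + η * t)).comp_mul_left' hη.ne')).const_mul η
  refine (setIntegral_le_integral hi3 (Eventually.of_forall fun x => by
    simp only [hG, Pi.zero_apply]; positivity)).trans (le_of_eq ?_)
  rw [integral_const_mul, Measure.integral_comp_mul_left (fun x => G (l + η * t + x)),
    integral_add_left_eq_self G, abs_of_pos (inv_pos.2 hη), smul_eq_mul, ← mul_assoc,
    mul_inv_cancel₀ hη.ne', one_mul, hG, integral_add hi1 hi2, he1, he2, ← Finset.sum_add_distrib]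
  refine Finset.sum_congr rfl fun j _ => ?_
  rw [← Complex.normSq_eq_norm_sq, Complex.normSq_apply]; ring

lemma hermScaled_edgeFam (n : ℕ) : EdgeFam (n := n)
    (fun k => hermScaled (Real.sqrt η) l η k)
    (fun k s => ((Real.sqrt η * (η * hermFunDeriv k (l + η * s)) : ℝ) : ℂ))
    (hermScaled (η * Real.sqrt (2 * Real.sqrt (n / 2))) l η n)
    (hermScaled (η * Real.sqrt (2 * Real.sqrt (n / 2))) l η (n - 1)) where
  deriv j s := by
    have h1 : HasDerivAt (fun s => l + η * s) η s := by
      simpa using ((hasDerivAt_id s).const_mul η).const_add l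
    have h2 := ((hasDerivAt_hermFun j (l + η * s)).comp s h1).const_mul (Real.sqrt η)
    refine HasDerivAt.ofReal_comp (h2.congr_deriv ?_)
    ring
  dec j := hermScaled_dec hη _ _
  dec₁ j := by
    have h := ((hermScaled_dec (l := l) hη (Real.sqrt η * η * Real.sqrt (j / 2)) (j - 1))).sub
      (hermScaled_dec (l := l) hη (Real.sqrt η * η * Real.sqrt ((j + 1) / 2)) (j + 1))
    convert h using 2 with s
    simp only [hermScaled, hermFunDeriv]
    push_cast
    ring
  real j s := Complex.conj_ofReal _
  bessel t c := hermScaled_bessel hη t c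
  dec_left := hermScaled_dec hη _ _
  dec_right := hermScaled_dec hη _ _
  telescope x y := by
    have h1 := sum_hermFunDeriv n (l + η * x) (l + η * y)
    rw [← Fin.sum_univ_eq_sum_range (fun k => hermFunDeriv k (l + η * x) * hermFun k (l + η * y) +
      hermFun k (l + η * x) * hermFunDeriv k (l + η * y))] at h1
    have h2 := Real.mul_self_sqrt hη.le
    have h3 := Real.mul_self_sqrt (show 0 ≤ 2 * Real.sqrt ((n : ℝ) / 2) by positivity)
    simp only [hermScaled]
    have h4 : ∀ j : Fin n, Real.sqrt η * (η * hermFunDeriv j (l + η * x)) *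
        (Real.sqrt η * hermFun j (l + η * y)) + Real.sqrt η * hermFun j (l + η * x) *
        (Real.sqrt η * (η * hermFunDeriv j (l + η * y))) = η ^ 2 *
        (hermFunDeriv j (l + η * x) * hermFun j (l + η * y) +
        hermFun j (l + η * x) * hermFunDeriv j (l + η * y)) := fun j => by
      linear_combination η * (hermFunDeriv j (l + η * x) * hermFun j (l + η * y) +
        hermFun j (l + η * x) * hermFunDeriv j (l + η * y)) * h2
    have h5 := Finset.sum_congr (rfl : (Finset.univ : Finset (Fin n)) = _) fun j _ => h4 j
    rw [← Finset.mul_sum, h1] at h5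
    have h6 := congrArg (fun r : ℝ => (r : ℂ)) h5
    have h7 := congrArg (fun r : ℝ => (r : ℂ)) h3
    push_cast at h6 h7 ⊢
    rw [h6]
    linear_combination ((η : ℂ) ^ 2 / 2 * (hermFun n (l + η * x) * hermFun (n - 1) (l + η * y) +
      hermFun (n - 1) (l + η * x) * hermFun n (l + η * y))) * h7

lemma gram_hermScaled (n : ℕ) (t : ℝ) :
    gram (fun k : Fin n => hermScaled (Real.sqrt η) l η k) t = Matrix.of fun j k : Fin n =>
      ((∫ x in Ioi (l + η * t), hermFun j x * hermFun k x : ℝ) : ℂ) := by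
  ext j k
  simp only [gram, Matrix.of_apply]
  rw [pair_shiftL2 (hermScaled_dec hη _ _) (hermScaled_dec hη _ _)]
  have h2 := Real.mul_self_sqrt hη.le
  have e : ∀ x, hermScaled (Real.sqrt η) l η j (t + x) • hermScaled (Real.sqrt η) l η k (t + x) =
      ((η * (hermFun j (l + η * t + η * x) * hermFun k (l + η * t + η * x)) : ℝ) : ℂ) := by
    intro x
    rw [hermScaled, hermScaled, smul_eq_mul, ← Complex.ofReal_mul, mul_add, ← add_assoc]
    congr 1
    linear_combination (hermFun j (l + η * t + η * x) * hermFun k (l + η * t + η * x)) * h2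
  simp only [e]
  rw [integral_complex_ofReal, integral_const_mul,
    integral_comp_mul_left_Ioi (fun x => hermFun j (l + η * t + x) * hermFun k (l + η * t + x)) 0 hη]
  rw [smul_eq_mul, ← mul_assoc, mul_inv_cancel₀ hη.ne', one_mul, mul_zero]
  have := (measurePreserving_add_left volume (l + η * t)).setIntegral_preimage_emb
    (measurableEmbedding_addLeft (l + η * t)) (fun x => hermFun j x * hermFun k x)
    (Ioi (l + η * t))
  rw [← this]
  congr 3
  ext x; simp

end Functions

section HermiteIntegral

/-- The integrand of the Gaussian representation of the Hermite polynomials on the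
line `Im = c`. -/
def hermKernel (x c : ℝ) (m : ℕ) (y : ℝ) : ℂ :=
  ((x - c : ℝ) + Complex.I * y) ^ m * Complex.exp (-(y + Complex.I * c) ^ 2)

lemma norm_cexp_neg_sq (c y : ℝ) :
    ‖Complex.exp (-((y : ℂ) + Complex.I * c) ^ 2)‖ = Real.exp (c ^ 2) * Real.exp (-y ^ 2) := by
  rw [Complex.norm_exp, ← Real.exp_add]
  congr 1
  simp [sq]
  ring

lemma integrable_hermKernel (x c : ℝ) (m : ℕ) : Integrable (hermKernel x c m) := by
  have h := ((integrable_eval_mul_exp ((C (1 + (x - c) ^ 2) + X ^ 2) ^ m)).const_mul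
    (Real.exp (c ^ 2)))
  refine h.mono' (by unfold hermKernel; fun_prop) (Eventually.of_forall fun y => ?_)
  rw [hermKernel, norm_mul, norm_pow, norm_cexp_neg_sq]
  have h1 : ‖((x - c : ℝ) : ℂ) + Complex.I * y‖ ≤ 1 + (x - c) ^ 2 + y ^ 2 := by
    refine (norm_add_le _ _).trans ?_
    rw [norm_mul, Complex.norm_I, one_mul, Complex.norm_real, Complex.norm_real, Real.norm_eq_abs,
      Real.norm_eq_abs, ← sq_abs (x - c), ← sq_abs y]
    nlinarith [sq_nonneg (|x - c| - 1), sq_nonneg (|y| - 1)]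
  have h3 := pow_le_pow_left₀ (norm_nonneg _) h1 m
  simp only [eval_add, eval_C, eval_pow, eval_X]
  calc _ ≤ (1 + (x - c) ^ 2 + y ^ 2) ^ m * (Real.exp (c ^ 2) * Real.exp (-y ^ 2)) := by gcongr
    _ = _ := by ring

lemma integral_hermKernel_zero (x c : ℝ) : ∫ y, hermKernel x c 0 y = (Real.sqrt Real.pi : ℂ) := by
  have h := GaussianFourier.integral_cexp_neg_mul_sq_add_real_mul_I (b := 1) (by simp) c
  have e : ∀ y : ℝ, hermKernel x c 0 y = Complex.exp (-1 * ((y : ℂ) + c * Complex.I) ^ 2) := by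
    intro y
    simp only [hermKernel, pow_zero, one_mul]
    congr 1; ring
  simp only [e]
  rw [h, div_one, ← Complex.ofReal_ofNat, ← Complex.ofReal_one, ← Complex.ofReal_div,
    ← Complex.ofReal_cpow Real.pi_pos.le, Real.sqrt_eq_rpow]

lemma integral_hermKernel (x c : ℝ) (m : ℕ) :
    ∫ y, hermKernel x c m y = Real.sqrt Real.pi * (((herm m).eval x : ℝ) : ℂ) := by
  have hrec : ∀ m : ℕ, ∫ y, hermKernel x c (m + 1) y = x * (∫ y, hermKernel x c m y) -
      (m : ℂ) / 2 * ∫ y, hermKernel x c (m - 1) y := by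
    intro m
    have hd : ∀ y : ℝ, HasDerivAt (hermKernel x c m) ((m : ℂ) * Complex.I * hermKernel x c (m - 1) y
        - 2 * (y + Complex.I * c) * hermKernel x c m y) y := by
      intro y
      have h1 : HasDerivAt (fun y : ℝ => ((x - c : ℝ) : ℂ) + Complex.I * y) Complex.I y := by
        simpa using ((Complex.ofRealCLM.hasDerivAt (x := y)).const_mul Complex.I).const_add
          ((x - c : ℝ) : ℂ)
      have h2 : HasDerivAt (fun y : ℝ => (y : ℂ) + Complex.I * c) 1 y := by
        simpa using (Complex.ofRealCLM.hasDerivAt (x := y)).add_const (Complex.I * c)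
      refine ((h1.pow m).mul (h2.pow 2).neg.cexp).congr_deriv ?_
      simp only [hermKernel, Pi.pow_apply, Pi.neg_apply]
      ring
    have e : ∀ y : ℝ, hermKernel x c (m + 1) y = x * hermKernel x c m y -
        (m : ℂ) / 2 * hermKernel x c (m - 1) y - Complex.I / 2 *
        ((m : ℂ) * Complex.I * hermKernel x c (m - 1) y
        - 2 * (y + Complex.I * c) * hermKernel x c m y) := by
      intro y
      simp only [hermKernel]
      push_cast
      linear_combination (((m : ℂ) / 2) * (x - c + Complex.I * y) ^ (m - 1) *
        Complex.exp (-(y + Complex.I * c) ^ 2) - (c : ℂ) * (x - c + Complex.I * y) ^ m *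
        Complex.exp (-(y + Complex.I * c) ^ 2)) * Complex.I_sq
    have i1 := integrable_hermKernel x c m
    have i2 := integrable_hermKernel x c (m - 1)
    have i0 := integrable_hermKernel x c (m + 1)
    have i3 : Integrable fun y : ℝ => ((m : ℂ) * Complex.I * hermKernel x c (m - 1) y
        - 2 * (y + Complex.I * c) * hermKernel x c m y) := by
      have : Integrable fun y : ℝ => 2 * Complex.I * (hermKernel x c (m + 1) y -
        x * hermKernel x c m y) + ((m : ℂ) * Complex.I * hermKernel x c (m - 1) y) :=
        ((i0.sub (i1.const_mul _)).const_mul _).add (i2.const_mul _)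
      refine this.congr (Eventually.of_forall fun y => ?_)
      simp only [e]
      linear_combination (-1) * ((m : ℂ) * Complex.I * hermKernel x c (m - 1) y
        - 2 * (y + Complex.I * c) * hermKernel x c m y) * Complex.I_sq
    have h0 := integral_eq_zero_of_hasDerivAt_of_integrable hd i3 i1
    simp only [e]
    have j1 : Integrable fun y => (x : ℂ) * hermKernel x c m y := i1.const_mul _
    have j2 : Integrable fun y => (m : ℂ) / 2 * hermKernel x c (m - 1) y := i2.const_mul _
    rw [integral_sub (j1.sub' j2) (i3.const_mul _),
      integral_sub j1 j2, integral_const_mul, integral_const_mul,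
      integral_const_mul, h0]
    ring
  induction m using Nat.strong_induction_on with
  | _ m ih =>
    match m with
    | 0 => rw [integral_hermKernel_zero]; simp [herm]
    | 1 => rw [hrec, integral_hermKernel_zero]; simp [herm]; ring
    | m + 2 =>
      have h : herm (m + 2) = X * herm (m + 1) - C (1 / 2) * derivative (herm (m + 1)) := rfl
      rw [hrec, ih (m + 1) (by omega), Nat.add_sub_cancel, ih m (by omega), h,
        derivative_herm_succ]
      simp only [eval_sub, eval_mul, eval_X, eval_C]
      push_cast
      ring

end HermiteIntegral

section EdgeIntegral

/-- The rescaled kernel of the Gaussian representation of the Hermite functions. -/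
def edgeKernel (N : ℝ) (m : ℕ) (s k : ℝ) : ℂ :=
  (1 + (2 + k * Complex.I) / N + s / (N : ℂ) ^ 2) ^ m *
    Complex.exp ((N : ℂ) ^ 3 / 2 * ((1 - (2 + k * Complex.I) / N) ^ 2 - 1) - N * s -
      (s : ℂ) ^ 2 / (4 * N))

lemma hermKernel_mul_exp {n m : ℕ} {N R : ℝ} (hN : 0 < N) (hNn : N ^ 3 = n) (hR : R ^ 2 = n / 2)
    (s k : ℝ) :
    hermKernel (2 * R + R / N ^ 2 * s) (R * (1 - 2 / N)) m (R / N * k) *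
      Complex.exp (-((2 * R + R / N ^ 2 * s : ℝ) : ℂ) ^ 2 / 2) =
    (R : ℂ) ^ m * Complex.exp (-(n : ℂ) / 2) * edgeKernel N m s k := by
  have hN' : (N : ℂ) ≠ 0 := by exact_mod_cast hN.ne'
  have hR' : (R : ℂ) ^ 2 = (N : ℂ) ^ 3 / 2 := by exact_mod_cast hNn ▸ hR
  have hNn' : (n : ℂ) = (N : ℂ) ^ 3 := by exact_mod_cast hNn.symm
  have h1 : ((2 * R + R / N ^ 2 * s - R * (1 - 2 / N) : ℝ) : ℂ) + Complex.I * (R / N * k : ℝ) =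
      R * (1 + (2 + k * Complex.I) / N + s / (N : ℂ) ^ 2) := by
    push_cast
    field_simp
    ring
  have h2 : -(((R / N * k : ℝ) : ℂ) + Complex.I * (R * (1 - 2 / N) : ℝ)) ^ 2 +
      -((2 * R + R / N ^ 2 * s : ℝ) : ℂ) ^ 2 / 2 = -(n : ℂ) / 2 +
      ((N : ℂ) ^ 3 / 2 * ((1 - (2 + k * Complex.I) / N) ^ 2 - 1) - N * s -
      (s : ℂ) ^ 2 / (4 * N)) := by
    have e1 : -(((R / N * k : ℝ) : ℂ) + Complex.I * (R * (1 - 2 / N) : ℝ)) ^ 2 +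
        -((2 * R + R / N ^ 2 * s : ℝ) : ℂ) ^ 2 / 2 = -(R : ℂ) ^ 2 * (((k : ℂ) / N +
        Complex.I * (1 - 2 / N)) ^ 2 + (2 + s / N ^ 2) ^ 2 / 2) := by push_cast; ring
    rw [e1, hR', hNn']
    field_simp
    linear_combination (-8 * (N : ℂ) ^ 2 * ((k : ℂ) ^ 2 + (N - 2) ^ 2)) * Complex.I_sq
  have h3 := congrArg Complex.exp h2
  rw [Complex.exp_add, Complex.exp_add] at h3
  rw [hermKernel, edgeKernel, h1, mul_pow]
  linear_combination ((R : ℂ) ^ m * (1 + (2 + k * Complex.I) / N + s / (N : ℂ) ^ 2) ^ m) * h3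

/-- The prefactor of the rescaled Gaussian representation. -/
def edgeConst (n : ℕ) : ℝ :=
  Real.sqrt (1 / (4 * Real.pi * Real.sqrt Real.pi * Stirling.stirlingSeq n))

lemma edgeConst_eq {n : ℕ} {N R : ℝ} (hN : 0 < N) (hR0 : 0 < R) (hNn : N ^ 3 = n)
    (hR : R ^ 2 = n / 2) :
    R / N ^ 2 * Real.sqrt (2 * R) * (R / N) * R ^ n * Real.exp (-(n : ℝ) / 2) /
      (Real.sqrt Real.pi * Real.sqrt (hermNorm n)) = edgeConst n := by
  have hn : (0 : ℝ) < n := by rw [← hNn]; positivity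
  have h1 := hermNorm_pos n
  rw [edgeConst, eq_comm, Real.sqrt_eq_iff_mul_self_eq_of_pos (by positivity)]
  have e1 := Real.mul_self_sqrt (show 0 ≤ 2 * R by positivity)
  have e2 := Real.mul_self_sqrt h1.le
  have e3 := Real.mul_self_sqrt Real.pi_pos.le
  have e4 : Real.exp (-(n : ℝ) / 2) * Real.exp (-(n : ℝ) / 2) = (Real.exp 1 ^ n)⁻¹ := by
    rw [← Real.exp_add, ← Real.exp_nat_mul, ← Real.exp_neg]; congr 1; ring
  have e5 : R ^ n * R ^ n = (n : ℝ) ^ n / 2 ^ n := by rw [← mul_pow, ← sq, hR, div_pow]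
  have e6 : Real.sqrt (2 * n) = 2 * R := by
    rw [Real.sqrt_eq_iff_mul_self_eq_of_pos (by positivity)]; linear_combination 4 * hR
  calc _ = (R / N ^ 2 * (R / N)) ^ 2 * (Real.sqrt (2 * R) * Real.sqrt (2 * R)) * (R ^ n * R ^ n) *
        (Real.exp (-(n : ℝ) / 2) * Real.exp (-(n : ℝ) / 2)) /
        ((Real.sqrt Real.pi * Real.sqrt Real.pi) *
          (Real.sqrt (hermNorm n) * Real.sqrt (hermNorm n))) := by ring
    _ = _ := by
      rw [e1, e2, e3, e4, e5, Stirling.stirlingSeq, hermNorm, e6]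
      have e7 : N ^ 6 = (2 * R ^ 2) ^ 2 := by rw [hR]; linear_combination (N ^ 3 + n) * hNn
      have : (R / N ^ 2 * (R / N)) ^ 2 = 1 / 4 := by
        field_simp
        linear_combination (-1 : ℝ) * e7
      rw [this, div_pow]
      field_simp

lemma hermScaled_eq_integral {n e : ℕ} {N R : ℝ} (hN : 0 < N) (hR0 : 0 < R) (hNn : N ^ 3 = n)
    (hR : R ^ 2 = n / 2) (he : e ≤ 1) (s : ℝ) :
    hermScaled (R / N ^ 2 * Real.sqrt (2 * R)) (2 * R) (R / N ^ 2) (n - e) s =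
      edgeConst n * ∫ k, edgeKernel N (n - e) s k := by
  have hn : 0 < n := by
    have : (0 : ℝ) < n := by rw [← hNn]; positivity
    exact_mod_cast this
  have hRN : 0 < R / N := by positivity
  have hc : R ^ (n - e) / Real.sqrt (hermNorm (n - e)) = R ^ n / Real.sqrt (hermNorm n) := by
    interval_cases e
    · rfl
    · obtain ⟨m, rfl⟩ : ∃ m, n = m + 1 := ⟨n - 1, by omega⟩
      have h0 := (Real.sqrt_pos.2 (hermNorm_pos m)).ne'
      have : Real.sqrt (((m : ℝ) + 1) / 2) = R := by
        rw [Real.sqrt_eq_iff_mul_self_eq_of_pos hR0, ← sq, hR]; push_cast; rfl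
      rw [sqrt_hermNorm_succ, this, Nat.add_sub_cancel, pow_succ]
      field_simp
  set x := 2 * R + R / N ^ 2 * s with hx
  have h1 := integral_hermKernel x (R * (1 - 2 / N)) (n - e)
  have h2 := Measure.integral_comp_mul_left (hermKernel x (R * (1 - 2 / N)) (n - e)) (R / N)
  rw [h1, abs_of_pos (inv_pos.2 hRN)] at h2
  have h3 : (∫ k, hermKernel x (R * (1 - 2 / N)) (n - e) (R / N * k)) *
      Complex.exp (-(x : ℂ) ^ 2 / 2) =
      (R : ℂ) ^ (n - e) * Complex.exp (-(n : ℂ) / 2) * ∫ k, edgeKernel N (n - e) s k := by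
    rw [← integral_mul_const, ← integral_const_mul]
    exact integral_congr_ae (Eventually.of_forall fun k => hermKernel_mul_exp hN hNn hR s k)
  rw [h2] at h3
  rw [hermScaled, ← hx, hermFun, ← edgeConst_eq hN hR0 hNn hR]
  have h4 : Real.sqrt Real.pi ≠ 0 := (Real.sqrt_pos.2 Real.pi_pos).ne'
  have h5 := (Real.sqrt_pos.2 (hermNorm_pos n)).ne'
  have h6 := (Real.sqrt_pos.2 (hermNorm_pos (n - e))).ne'
  have hcC : (R : ℂ) ^ (n - e) / (Real.sqrt (hermNorm (n - e)) : ℂ) =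
      (R : ℂ) ^ n / (Real.sqrt (hermNorm n) : ℂ) := by exact_mod_cast hc
  have h4C : (Real.sqrt Real.pi : ℂ) ≠ 0 := by exact_mod_cast h4
  have hRC : (R : ℂ) ≠ 0 := by exact_mod_cast hR0.ne'
  have hNC : (N : ℂ) ≠ 0 := by exact_mod_cast hN.ne'
  push_cast
  rw [Complex.real_smul] at h3
  push_cast at h3
  have h7 : (((herm (n - e)).eval x : ℝ) : ℂ) * Complex.exp (-(x : ℂ) ^ 2 / 2) =
      (R / N) / Real.sqrt Real.pi * ((R : ℂ) ^ (n - e) * Complex.exp (-(n : ℂ) / 2) *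
        ∫ k, edgeKernel N (n - e) s k) := by
    rw [← h3]; field_simp
  rw [h7]
  linear_combination ((R / N ^ 2 : ℂ) * (Real.sqrt (2 * R) : ℂ) * (R / N) / Real.sqrt Real.pi *
    Complex.exp (-(n : ℂ) / 2) * ∫ k, edgeKernel N (n - e) s k) * hcC

lemma edgeConst_tendsto : Tendsto edgeConst atTop (𝓝 (1 / (2 * Real.pi))) := by
  have h : Real.sqrt (1 / (4 * Real.pi * Real.sqrt Real.pi * Real.sqrt Real.pi)) =
      1 / (2 * Real.pi) := by
    rw [Real.sqrt_eq_iff_mul_self_eq_of_pos (by positivity), mul_assoc _ (Real.sqrt _),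
      Real.mul_self_sqrt Real.pi_pos.le]
    ring
  rw [← h]
  refine (Real.continuous_sqrt.tendsto _).comp (Tendsto.div tendsto_const_nhds
    (tendsto_const_nhds.mul Stirling.tendsto_stirlingSeq_sqrt_pi) (by positivity))

end EdgeIntegral

section EdgeLimit

/-- The integrand of the contour integral of the Airy function on the line `Re z = 2`. -/
def airyKernel (s k : ℝ) : ℂ :=
  Complex.exp ((2 + k * Complex.I) ^ 3 / 3 - s * (2 + k * Complex.I))

/-- The contour integral of the Airy function. -/
def airyInt (s : ℝ) : ℂ := ((1 / (2 * Real.pi) : ℝ) : ℂ) * ∫ k, airyKernel s k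

lemma one_add_le_exp_cubic {ρ : ℝ} (h0 : 0 ≤ ρ) (h1 : ρ ≤ 1) :
    1 + ρ ≤ Real.exp (ρ - ρ ^ 2 / 2 + ρ ^ 3 / 2) := by
  have h2 : 0 ≤ ρ - ρ ^ 2 / 2 + ρ ^ 3 / 2 := by nlinarith [pow_nonneg h0 3]
  refine le_trans ?_ (Real.quadratic_le_exp_of_nonneg h2)
  have h3 : 1 + (ρ - ρ ^ 2 / 2 + ρ ^ 3 / 2) + (ρ - ρ ^ 2 / 2 + ρ ^ 3 / 2) ^ 2 / 2 - (1 + ρ) =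
      ρ ^ 4 / 8 * ((ρ - 1) ^ 2 + 4) := by ring
  nlinarith [show 0 ≤ ρ ^ 4 / 8 * ((ρ - 1) ^ 2 + 4) by positivity]

lemma norm_edgeKernel_le {n m : ℕ} {N T s : ℝ} (hN2 : 2 ≤ N) (hNT : |T| ≤ N) (hs : T ≤ s)
    (hNn : N ^ 3 = n) (hm : m ≤ n) (k : ℝ) :
    ‖edgeKernel N m s k‖ ≤ Real.exp (4 + |T|) * Real.exp (-s) * Real.exp (-(1 / 4) * k ^ 2) := by
  have hN : 0 < N := by linarith
  set ρ : ℝ := 2 / N with hρ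
  set q : ℝ := 1 + ρ + s / N ^ 2 with hq
  set κ : ℝ := k / N with hκ
  set x : ℝ := 1 / N with hx
  have hρ0 : 0 < ρ := by positivity
  have hρ1 : ρ ≤ 1 := by rw [hρ, div_le_one hN]; exact hN2
  have hx0 : 0 < x := by positivity
  have hx1 : x ≤ 1 := by rw [hx, div_le_one hN]; linarith
  have hsN : -N ≤ s := by linarith [neg_abs_le T]
  have hqx : 1 + x ≤ q := by
    have : -x ≤ s / N ^ 2 := by
      rw [hx, le_div_iff₀ (by positivity)]
      calc -(1 / N) * N ^ 2 = -N := by field_simp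
        _ ≤ s := hsN
    have h2 : ρ = 2 * x := by rw [hρ, hx]; ring
    linarith
  have hq0 : 0 < q := by linarith
  set B : ℝ := ρ - ρ ^ 2 / 2 + ρ ^ 3 / 2 + s / N ^ 2 / (1 + ρ) with hB
  have hqB : q ≤ Real.exp B := by
    have h1 : q = (1 + ρ) * (s / N ^ 2 / (1 + ρ) + 1) := by rw [hq]; field_simp; ring
    have h2 : 0 ≤ s / N ^ 2 / (1 + ρ) + 1 := by
      by_contra hneg
      have := mul_neg_of_pos_of_neg (show 0 < 1 + ρ by linarith) (not_le.1 hneg)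
      linarith
    rw [h1, hB, Real.exp_add]
    exact mul_le_mul (one_add_le_exp_cubic hρ0.le hρ1) (Real.add_one_le_exp _) h2
      (Real.exp_pos _).le
  set E : ℝ := B + κ ^ 2 * (1 - x / 2) / 2 with hE
  have hw : (1 + (2 + k * Complex.I) / N + s / (N : ℂ) ^ 2 : ℂ) = (q : ℂ) + (κ : ℂ) * Complex.I := by
    rw [hq, hκ, hρ]; push_cast; ring
  have hnorm : ‖(q : ℂ) + (κ : ℂ) * Complex.I‖ ^ 2 = q ^ 2 + κ ^ 2 := by
    rw [← Complex.normSq_eq_norm_sq, Complex.normSq_add_mul_I]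
  have hsq : ‖(q : ℂ) + (κ : ℂ) * Complex.I‖ ^ 2 ≤ Real.exp E ^ 2 := by
    have h1 : κ ^ 2 / q ^ 2 ≤ κ ^ 2 * (1 - x / 2) := by
      rw [div_le_iff₀ (by positivity), mul_assoc]
      refine le_mul_of_one_le_right (sq_nonneg _) ?_
      have : (1 + x) ^ 2 ≤ q ^ 2 := by gcongr
      have h3 : (1 - x / 2) * (1 + x) ^ 2 ≤ (1 - x / 2) * q ^ 2 :=
        mul_le_mul_of_nonneg_left this (by linarith)
      nlinarith [mul_nonneg hx0.le (mul_nonneg (sub_nonneg.2 hx1) hx0.le)]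
    calc _ = q ^ 2 * (κ ^ 2 / q ^ 2 + 1) := by rw [hnorm]; field_simp; ring
      _ ≤ Real.exp B ^ 2 * Real.exp (κ ^ 2 * (1 - x / 2)) := by
        refine mul_le_mul (by gcongr) ((Real.add_one_le_exp _).trans (Real.exp_le_exp.2 h1))
          (by positivity) (by positivity)
      _ = _ := by
        rw [sq (Real.exp _), sq (Real.exp _), ← Real.exp_add, ← Real.exp_add, ← Real.exp_add]
        congr 1; rw [hE]; ring
  have hle : ‖(q : ℂ) + (κ : ℂ) * Complex.I‖ ≤ Real.exp E :=
    (pow_le_pow_iff_left₀ (norm_nonneg _) (Real.exp_pos _).le two_ne_zero).1 hsq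
  have hge : 1 ≤ ‖(q : ℂ) + (κ : ℂ) * Complex.I‖ := by
    rw [← one_le_sq_iff₀ (norm_nonneg _), hnorm]
    nlinarith [sq_nonneg κ]
  have hpow : ‖(q : ℂ) + (κ : ℂ) * Complex.I‖ ^ m ≤ Real.exp (N ^ 3 * E) := by
    rw [hNn, Real.exp_nat_mul]
    exact (pow_le_pow_right₀ hge hm).trans (pow_le_pow_left₀ (norm_nonneg _) hle n)
  have hre : ((N : ℂ) ^ 3 / 2 * ((1 - (2 + k * Complex.I) / N) ^ 2 - 1) - N * s -
      (s : ℂ) ^ 2 / (4 * N)).re = N ^ 3 / 2 * ((1 - ρ) ^ 2 - κ ^ 2 - 1) - N * s - s ^ 2 / (4 * N) := by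
    have : ((N : ℂ) ^ 3 / 2 * ((1 - (2 + k * Complex.I) / N) ^ 2 - 1) - N * s -
      (s : ℂ) ^ 2 / (4 * N)) = ((N ^ 3 / 2 * ((1 - ρ) ^ 2 - κ ^ 2 - 1) - N * s -
        s ^ 2 / (4 * N) : ℝ) : ℂ) + ((-(N ^ 3 * (1 - ρ) * κ) : ℝ) : ℂ) * Complex.I := by
      have h1 : (2 + k * Complex.I) / (N : ℂ) = ρ + κ * Complex.I := by
        rw [hκ, hρ]; push_cast; ring
      rw [h1]
      push_cast
      linear_combination ((N : ℂ) ^ 3 / 2 * κ ^ 2) * Complex.I_sq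
    rw [this, Complex.add_re, Complex.ofReal_re, Complex.re_ofReal_mul, Complex.I_re]
    ring
  rw [edgeKernel, norm_mul, norm_pow, hw, Complex.norm_exp, hre]
  refine (mul_le_mul_of_nonneg_right hpow (Real.exp_pos _).le).trans ?_
  rw [← Real.exp_add, ← Real.exp_add, ← Real.exp_add, Real.exp_le_exp]
  have e1 : N ^ 3 * E + (N ^ 3 / 2 * ((1 - ρ) ^ 2 - κ ^ 2 - 1) - N * s - s ^ 2 / (4 * N)) =
      4 - 2 * s / (1 + ρ) - k ^ 2 / 4 - s ^ 2 / (4 * N) := by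
    have : 1 + 2 / N ≠ 0 := by positivity
    rw [hE, hB, hκ, hx, hρ]
    field_simp
    ring
  have e2 : -(2 * s / (1 + ρ)) ≤ |T| - s := by
    rw [neg_le, le_div_iff₀ (by linarith)]
    rcases le_total 0 s with h | h
    · linarith [mul_nonneg h (sub_nonneg.2 hρ1), mul_nonneg (abs_nonneg T) hρ0.le, abs_nonneg T]
    · linarith [neg_abs_le T, mul_nonneg (show 0 ≤ |T| - s by linarith [abs_nonneg T]) hρ0.le]
  have e3 : 0 ≤ s ^ 2 / (4 * N) := by positivity
  rw [e1]
  linarith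

lemma tendsto_log_remainder (a b : ℂ) : Tendsto (fun N : ℝ => (N : ℂ) ^ 3 *
    (Complex.log (1 + (a / N + b / (N : ℂ) ^ 2)) - ((a / N + b / (N : ℂ) ^ 2) -
      (a / N + b / (N : ℂ) ^ 2) ^ 2 / 2 + (a / N + b / (N : ℂ) ^ 2) ^ 3 / 3))) atTop (𝓝 0) := by
  set c := ‖a‖ + ‖b‖ with hc
  have hc0 : 0 ≤ c := by positivity
  refine squeeze_zero_norm' (a := fun N : ℝ => c ^ 4 * N⁻¹) ?_ ?_
  · filter_upwards [eventually_ge_atTop 1, eventually_ge_atTop (2 * c)] with N hN1 hNc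
    have hN : 0 < N := by linarith
    set w := a / N + b / (N : ℂ) ^ 2 with hw
    have hwn : ‖w‖ ≤ c / N := by
      refine (norm_add_le _ _).trans ?_
      rw [norm_div, norm_div, norm_pow, Complex.norm_real, Real.norm_of_nonneg hN.le, hc, add_div]
      gcongr
      nlinarith
    have hw2 : ‖w‖ ≤ 1 / 2 := hwn.trans (by rw [div_le_iff₀ hN]; linarith)
    have h1 := Complex.norm_log_sub_logTaylor_le 3 (show ‖w‖ < 1 by linarith)
    have h2 : Complex.logTaylor (3 + 1) w = w - w ^ 2 / 2 + w ^ 3 / 3 := by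
      simp only [Complex.logTaylor_succ, Complex.logTaylor_zero, Pi.add_apply]
      norm_num
      ring
    rw [h2] at h1
    have h3 : (1 - ‖w‖)⁻¹ ≤ 2 := by
      rw [inv_le_comm₀ (by linarith) (by norm_num)]; linarith
    rw [norm_mul, norm_pow, Complex.norm_real, Real.norm_of_nonneg hN.le]
    calc _ ≤ N ^ 3 * (‖w‖ ^ 4 * (1 - ‖w‖)⁻¹ / 4) := by
          refine mul_le_mul_of_nonneg_left (h1.trans (le_of_eq ?_)) (by positivity)
          norm_num
      _ ≤ N ^ 3 * ((c / N) ^ 4 * 4 / 4) := by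
          have := mul_le_mul (pow_le_pow_left₀ (norm_nonneg _) hwn 4) (h3.trans (by norm_num : (2 : ℝ) ≤ 4))
            (inv_nonneg.2 (by linarith)) (by positivity)
          gcongr
      _ = c ^ 4 * N⁻¹ := by field_simp
  · simpa using tendsto_inv_atTop_zero.const_mul (c ^ 4)

lemma tendsto_edgeKernel {N : ℕ → ℝ} (hNt : Tendsto N atTop atTop) (hNn : ∀ n, N n ^ 3 = n)
    (e : ℕ) (s k : ℝ) :
    Tendsto (fun n => edgeKernel (N n) (n - e) s k) atTop (𝓝 (airyKernel s k)) := by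
  set z : ℂ := 2 + k * Complex.I with hz
  set w : ℕ → ℂ := fun n => z / N n + s / (N n : ℂ) ^ 2 with hw
  have hinv : Tendsto (fun n => ((N n : ℂ))⁻¹) atTop (𝓝 0) := by
    have := (Complex.continuous_ofReal.tendsto 0).comp (tendsto_inv_atTop_zero.comp hNt)
    simpa [Function.comp_def] using this
  have hw0 : Tendsto w atTop (𝓝 0) := by
    have := (hinv.const_mul z).add ((hinv.pow 2).const_mul (s : ℂ))
    simpa [hw, div_eq_mul_inv] using this
  have hpoly : Tendsto (fun n => (z + s * (N n : ℂ)⁻¹) ^ 3 / 3 - s * z -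
      3 * (s : ℂ) ^ 2 / 4 * (N n : ℂ)⁻¹) atTop (𝓝 (z ^ 3 / 3 - s * z)) := by
    have := ((((hinv.const_mul (s : ℂ)).const_add z).pow 3).div_const 3).sub_const (s * z) |>.sub
      (hinv.const_mul (3 * (s : ℂ) ^ 2 / 4))
    simpa using this
  have hexp := ((tendsto_log_remainder z s).comp hNt).add hpoly
  rw [zero_add] at hexp
  have hmain := (hexp.cexp).div ((hw0.const_add 1).pow e) (by simp)
  have hlim : Complex.exp (z ^ 3 / 3 - s * z) / (1 + 0) ^ e = airyKernel s k := by
    simp [airyKernel, hz]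
  rw [hlim] at hmain
  refine hmain.congr' ?_
  have hne : ∀ᶠ n in atTop, 1 + w n ≠ 0 :=
    (hw0.const_add 1).eventually_ne (by simp)
  filter_upwards [hne, eventually_ge_atTop e, hNt.eventually_gt_atTop 0] with n h1 h2 h3
  have hN : (N n : ℂ) ≠ 0 := by exact_mod_cast h3.ne'
  have hn : (N n : ℂ) ^ 3 = n := by exact_mod_cast hNn n
  have h4 : (1 + w n) ^ (n - e) = Complex.exp (n * Complex.log (1 + w n)) / (1 + w n) ^ e := by
    rw [Complex.exp_nat_mul, Complex.exp_log h1, eq_div_iff (pow_ne_zero _ h1), ← pow_add,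
      Nat.sub_add_cancel h2]
  rw [edgeKernel, add_assoc, ← hz]
  change _ = (1 + w n) ^ (n - e) * _
  rw [h4, div_mul_eq_mul_div, ← Complex.exp_add]
  refine congrArg (fun v => Complex.exp v / (1 + w n) ^ e) ?_
  simp only [Function.comp, ← hn]
  change (N n : ℂ) ^ 3 * (Complex.log (1 + w n) - (w n - w n ^ 2 / 2 + w n ^ 3 / 3)) + _ = _
  generalize Complex.log (1 + w n) = L
  simp only [hw]
  field_simp
  ring

lemma continuous_edgeKernel (N : ℝ) (m : ℕ) (s : ℝ) : Continuous (edgeKernel N m s) := by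
  unfold edgeKernel
  simp only [div_eq_mul_inv]
  fun_prop

lemma edgeConv_hermScaled {N R : ℕ → ℝ} (hNt : Tendsto N atTop atTop) (hNn : ∀ n, N n ^ 3 = n)
    (hR0 : ∀ n, 0 ≤ R n) (hR : ∀ n, R n ^ 2 = n / 2) {e : ℕ} (he : e ≤ 1) :
    EdgeConv (fun n => hermScaled (R n / N n ^ 2 * Real.sqrt (2 * R n)) (2 * R n)
      (R n / N n ^ 2) (n - e)) airyInt := by
  have hpos : ∀ᶠ n in atTop, 0 < N n ∧ 0 < R n := by
    filter_upwards [hNt.eventually_gt_atTop 0, eventually_gt_atTop 0] with n h1 h2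
    refine ⟨h1, lt_of_le_of_ne (hR0 n) fun h => ?_⟩
    have := hR n
    rw [← h] at this
    have h3 : (0 : ℝ) < n := by exact_mod_cast h2
    linarith
  have heq : ∀ᶠ n in atTop, ∀ s, hermScaled (R n / N n ^ 2 * Real.sqrt (2 * R n)) (2 * R n)
      (R n / N n ^ 2) (n - e) s = edgeConst n * ∫ k, edgeKernel (N n) (n - e) s k := by
    filter_upwards [hpos] with n hn s
    exact hermScaled_eq_integral hn.1 hn.2 (hNn n) (hR n) he s
  have hbd : ∀ T, ∀ᶠ n in atTop, ∀ s, T ≤ s → ∀ k, ‖edgeKernel (N n) (n - e) s k‖ ≤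
      Real.exp (4 + |T|) * Real.exp (-s) * Real.exp (-(1 / 4) * k ^ 2) := by
    intro T
    filter_upwards [hNt.eventually_ge_atTop 2, hNt.eventually_ge_atTop |T|] with n h1 h2 s hs k
    exact norm_edgeKernel_le h1 h2 hs (hNn n) (Nat.sub_le _ _) k
  have hInt : Integrable fun k : ℝ => Real.exp (-(1 / 4) * k ^ 2) :=
    integrable_exp_neg_mul_sq (by norm_num)
  refine ⟨?_, fun s => ?_, fun T => ?_⟩
  · filter_upwards [hpos] with n hn
    exact hermScaled_dec (div_pos hn.2 (pow_pos hn.1 2)) _ _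
  · have h1 : Tendsto (fun n => ∫ k, edgeKernel (N n) (n - e) s k) atTop
        (𝓝 (∫ k, airyKernel s k)) := by
      refine tendsto_integral_filter_of_dominated_convergence
        (fun k => Real.exp (4 + |s|) * Real.exp (-s) * Real.exp (-(1 / 4) * k ^ 2))
        (Eventually.of_forall fun n => (continuous_edgeKernel _ _ _).aestronglyMeasurable) ?_
        (hInt.const_mul _) (Eventually.of_forall fun k => tendsto_edgeKernel hNt hNn e s k)
      filter_upwards [hbd s] with n hn
      exact Eventually.of_forall fun k => hn s le_rfl k
    refine (((Complex.continuous_ofReal.tendsto _).comp edgeConst_tendsto).mul h1).congr' ?_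
    filter_upwards [heq] with n hn
    exact (hn s).symm
  · set J := ∫ k : ℝ, Real.exp (-(1 / 4) * k ^ 2) with hJ
    have hJ0 : 0 ≤ J := integral_nonneg fun k => (Real.exp_pos _).le
    refine ⟨Real.exp (4 + |T|) * J, by positivity, ?_⟩
    have hC : ∀ᶠ n in atTop, edgeConst n ≤ 1 := by
      refine edgeConst_tendsto.eventually_le_const ?_
      rw [div_lt_one (by positivity)]
      linarith [Real.pi_gt_three]
    filter_upwards [heq, hbd T, hC] with n h1 h2 h3 s hs
    have h4 : ‖∫ k, edgeKernel (N n) (n - e) s k‖ ≤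
        ∫ k, Real.exp (4 + |T|) * Real.exp (-s) * Real.exp (-(1 / 4) * k ^ 2) :=
      norm_integral_le_of_norm_le (hInt.const_mul _) (Eventually.of_forall fun k => h2 s hs k)
    rw [integral_const_mul] at h4
    have h5 : 0 ≤ edgeConst n := Real.sqrt_nonneg _
    rw [h1, norm_mul, Complex.norm_real, Real.norm_of_nonneg h5]
    calc _ ≤ 1 * (Real.exp (4 + |T|) * Real.exp (-s) * J) := by gcongr
      _ = _ := by ring

end EdgeLimit

section AiryIntegral

/-- The moments of the contour integral of the Airy function. -/
def airyMoment (m : ℕ) (s : ℝ) : ℂ := ∫ k : ℝ, (2 + k * Complex.I) ^ m * airyKernel s k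

lemma norm_two_add_le (k : ℝ) : ‖(2 + k * Complex.I : ℂ)‖ ≤ 3 + k ^ 2 := by
  refine (norm_add_le _ _).trans ?_
  have h : ‖(2 : ℂ)‖ = 2 := by norm_num
  rw [h, norm_mul, Complex.norm_I, mul_one, Complex.norm_real, Real.norm_eq_abs]
  nlinarith [sq_nonneg (|k| - 1), sq_abs k]

lemma norm_airyKernel (s k : ℝ) :
    ‖airyKernel s k‖ = Real.exp (-(2 * s)) * (Real.exp (8 / 3) * Real.exp (-(2 * k ^ 2))) := by
  rw [airyKernel, Complex.norm_exp, ← Real.exp_add, ← Real.exp_add]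
  congr 1
  have : (2 + k * Complex.I) ^ 3 / 3 - s * (2 + k * Complex.I) =
      ((8 / 3 - 2 * k ^ 2 - 2 * s : ℝ) : ℂ) + ((4 * k - k ^ 3 / 3 - s * k : ℝ) : ℂ) * Complex.I := by
    push_cast
    linear_combination (2 * (k : ℂ) ^ 2 + (k : ℂ) ^ 3 / 3 * Complex.I) * Complex.I_sq
  rw [this, Complex.add_re, Complex.ofReal_re, Complex.re_ofReal_mul, Complex.I_re]
  ring

lemma norm_pow_mul_airyKernel_le (m : ℕ) (s k : ℝ) :
    ‖(2 + k * Complex.I) ^ m * airyKernel s k‖ ≤ Real.exp (-(2 * s)) * (Real.exp (8 / 3) *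
      (((C 3 + X ^ 2) ^ m : ℝ[X]).eval k * Real.exp (-k ^ 2))) := by
  rw [norm_mul, norm_pow, norm_airyKernel]
  simp only [eval_pow, eval_add, eval_C, eval_X]
  have h1 := pow_le_pow_left₀ (norm_nonneg _) (norm_two_add_le k) m
  have h2 : Real.exp (-(2 * k ^ 2)) ≤ Real.exp (-k ^ 2) :=
    Real.exp_le_exp.2 (by nlinarith [sq_nonneg k])
  calc _ ≤ (3 + k ^ 2) ^ m * (Real.exp (-(2 * s)) * (Real.exp (8 / 3) * Real.exp (-k ^ 2))) := by
        gcongr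
    _ = _ := by ring

lemma continuous_pow_mul_airyKernel (m : ℕ) (s : ℝ) :
    Continuous fun k : ℝ => (2 + k * Complex.I) ^ m * airyKernel s k := by
  unfold airyKernel
  simp only [div_eq_mul_inv]
  fun_prop

lemma integrable_pow_mul_airyKernel (m : ℕ) (s : ℝ) :
    Integrable fun k : ℝ => (2 + k * Complex.I) ^ m * airyKernel s k :=
  (((integrable_eval_mul_exp ((C 3 + X ^ 2) ^ m)).const_mul _).const_mul _).mono'
    (continuous_pow_mul_airyKernel m s).aestronglyMeasurable
    (Eventually.of_forall fun k => norm_pow_mul_airyKernel_le m s k)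

lemma norm_airyMoment_le (m : ℕ) (s : ℝ) : ‖airyMoment m s‖ ≤ Real.exp (-(2 * s)) *
    (Real.exp (8 / 3) * ∫ k, ((C 3 + X ^ 2) ^ m : ℝ[X]).eval k * Real.exp (-k ^ 2)) := by
  have h := integrable_eval_mul_exp ((C 3 + X ^ 2) ^ m)
  rw [← integral_const_mul, ← integral_const_mul]
  exact norm_integral_le_of_norm_le ((h.const_mul _).const_mul _)
    (Eventually.of_forall fun k => norm_pow_mul_airyKernel_le m s k)

lemma airyMoment_isBigO (m : ℕ) : airyMoment m =O[atTop] fun s => Real.exp (-(2 * s)) := by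
  refine IsBigO.of_bound
    (Real.exp (8 / 3) * ∫ k, ((C 3 + X ^ 2) ^ m : ℝ[X]).eval k * Real.exp (-k ^ 2))
    (Eventually.of_forall fun s => (norm_airyMoment_le m s).trans (le_of_eq ?_))
  rw [Real.norm_of_nonneg (Real.exp_pos _).le, mul_comm]

lemma hasDerivAt_airyMoment (m : ℕ) (s : ℝ) :
    HasDerivAt (airyMoment m) (-airyMoment (m + 1) s) s := by
  have hi := integrable_eval_mul_exp ((C 3 + X ^ 2) ^ (m + 1))
  have h := (hasDerivAt_integral_of_dominated_loc_of_deriv_le (μ := volume)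
    (F := fun (s k : ℝ) => (2 + k * Complex.I) ^ m * airyKernel s k)
    (F' := fun (s k : ℝ) => -((2 + k * Complex.I) ^ (m + 1) * airyKernel s k))
    (bound := fun k => Real.exp (-(2 * (s - 1))) * (Real.exp (8 / 3) *
      (((C 3 + X ^ 2) ^ (m + 1) : ℝ[X]).eval k * Real.exp (-k ^ 2))))
    (Ioi_mem_nhds (show s - 1 < s by linarith))
    (Eventually.of_forall fun s => (continuous_pow_mul_airyKernel m s).aestronglyMeasurable)
    (integrable_pow_mul_airyKernel m s)
    (continuous_pow_mul_airyKernel (m + 1) s).neg.aestronglyMeasurable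
    (Eventually.of_forall fun k σ hσ => ?_) ((hi.const_mul _).const_mul _)
    (Eventually.of_forall fun k σ hσ => ?_)).2
  · rwa [integral_neg] at h
  · rw [norm_neg]
    refine (norm_pow_mul_airyKernel_le _ _ _).trans ?_
    have h1 : 0 ≤ ((C 3 + X ^ 2) ^ (m + 1) : ℝ[X]).eval k := by
      simp only [eval_pow, eval_add, eval_C, eval_X]; positivity
    have h2 : s - 1 < σ := hσ
    gcongr
  · have h1 := ((((Complex.ofRealCLM.hasDerivAt (x := σ)).mul_const (2 + k * Complex.I)).const_sub
      ((2 + k * Complex.I) ^ 3 / 3)).cexp).const_mul ((2 + k * Complex.I) ^ m)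
    refine h1.congr_deriv ?_
    simp only [airyKernel, Complex.ofRealCLM_apply, Complex.ofReal_one]
    ring

lemma airyMoment_two (s : ℝ) : airyMoment 2 s = s * airyMoment 0 s := by
  have hd : ∀ k : ℝ, HasDerivAt (airyKernel s)
      (Complex.I * ((2 + k * Complex.I) ^ 2 * airyKernel s k -
        s * ((2 + k * Complex.I) ^ 0 * airyKernel s k))) k := by
    intro k
    have h1 : HasDerivAt (fun k : ℝ => (2 + k * Complex.I : ℂ)) Complex.I k := by
      simpa using ((Complex.ofRealCLM.hasDerivAt (x := k)).mul_const Complex.I).const_add 2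
    refine (((h1.pow 3).div_const 3).sub (h1.const_mul (s : ℂ))).cexp.congr_deriv ?_
    simp only [airyKernel, Pi.pow_apply, Pi.sub_apply]
    push_cast
    ring
  have i2 := integrable_pow_mul_airyKernel 2 s
  have i0 := integrable_pow_mul_airyKernel 0 s
  have h := integral_eq_zero_of_hasDerivAt_of_integrable hd
    ((i2.sub (i0.const_mul (s : ℂ))).const_mul Complex.I)
    (by simpa using i0)
  rw [integral_const_mul, integral_sub i2 (i0.const_mul _), integral_const_mul] at h
  have h2 := (mul_eq_zero.1 h).resolve_left Complex.I_ne_zero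
  exact sub_eq_zero.1 h2

lemma airyInt_eq (s : ℝ) : airyInt s = ((1 / (2 * Real.pi) : ℝ) : ℂ) * airyMoment 0 s := by
  simp [airyInt, airyMoment]

lemma airyLike_airyInt :
    AiryLike airyInt (fun s => -(((1 / (2 * Real.pi) : ℝ) : ℂ) * airyMoment 1 s)) := by
  have h : airyInt = fun s => ((1 / (2 * Real.pi) : ℝ) : ℂ) * airyMoment 0 s := funext airyInt_eq
  refine ⟨fun s => ?_, fun s => ?_, ?_, ?_⟩
  · rw [h]
    refine ((hasDerivAt_airyMoment 0 s).const_mul _).congr_deriv ?_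
    simp
  · refine ((hasDerivAt_airyMoment 1 s).const_mul _).neg.congr_deriv ?_
    rw [airyInt_eq, airyMoment_two]
    ring
  · rw [h]
    exact (airyMoment_isBigO 0).const_mul_left _
  · exact ((airyMoment_isBigO 1).const_mul_left _).neg_left

end AiryIntegral

/-- A solution of the Airy equation with vanishing Cauchy data vanishes. -/
lemma airy_ode_eq_zero {y y₁ : ℝ → ℂ} (hy : ∀ s, HasDerivAt y (y₁ s) s)
    (hy₁ : ∀ s : ℝ, HasDerivAt y₁ (s * y s) s) {s₀ : ℝ} (h0 : y s₀ = 0) (h1 : y₁ s₀ = 0) (s : ℝ) :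
    y s = 0 := by
  set M := max |s| |s₀| + 1 with hM
  have hM0 : 0 ≤ M := by positivity
  let L : ℝ → (ℂ × ℂ) →L[ℝ] (ℂ × ℂ) := fun t =>
    (ContinuousLinearMap.snd ℝ ℂ ℂ).prod (t • ContinuousLinearMap.fst ℝ ℂ ℂ)
  have hL : ∀ t ∈ Ioo (-M) M, LipschitzOnWith (max 1 M).toNNReal (L t) univ := by
    intro t ht
    refine LipschitzWith.lipschitzOnWith (AddMonoidHomClass.lipschitz_of_bound (L t) _ fun v => ?_)
    have ht' : |t| ≤ M := abs_le.2 ⟨ht.1.le, ht.2.le⟩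
    change max ‖v.2‖ ‖t • v.1‖ ≤ max 1 M * max ‖v.1‖ ‖v.2‖
    refine max_le ?_ ?_
    · calc ‖v.2‖ = 1 * ‖v.2‖ := (one_mul _).symm
        _ ≤ _ := mul_le_mul (le_max_left _ _) (le_max_right _ _) (norm_nonneg _) (by positivity)
    · rw [norm_smul]
      exact mul_le_mul (ht'.trans (le_max_right _ _)) (le_max_left _ _) (norm_nonneg _)
        (by positivity)
  have hs : s ∈ Ioo (-M) M := abs_lt.1 (by rw [hM]; linarith [le_max_left |s| |s₀|])
  have hs₀ : s₀ ∈ Ioo (-M) M := abs_lt.1 (by rw [hM]; linarith [le_max_right |s| |s₀|])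
  have := ODE_solution_unique_of_mem_Ioo (v := fun t x => L t x) (f := fun t => (y t, y₁ t))
    (g := fun _ => 0) hL hs₀ (fun t _ => ⟨by
      refine ((hy t).prodMk (hy₁ t)).congr_deriv ?_
      simp [L], trivial⟩)
    (fun t _ => ⟨by simpa using hasDerivAt_const t (0 : ℂ × ℂ), trivial⟩) (by simp [h0, h1]) hs
  exact congrArg Prod.fst this

section AiryInitialValues

/-- The integrand of the Airy moments at the origin. -/
def airyBase (m : ℕ) (z : ℂ) : ℂ := z ^ m * Complex.exp (z ^ 3 / 3)

/-- The derivative of `airyBase m`. -/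
def airyBaseDeriv (m : ℕ) (z : ℂ) : ℂ :=
  m * z ^ (m - 1) * Complex.exp (z ^ 3 / 3) + z ^ (m + 2) * Complex.exp (z ^ 3 / 3)

/-- The homotopy between the ray of angle `π/3` and the vertical ray from `2`. -/
def airyPath (c η k : ℝ) : ℂ := ((2 * η + (1 - η) * (c * k) : ℝ) : ℂ) + k * Complex.I

lemma hasDerivAt_airyBase (m : ℕ) (z : ℂ) : HasDerivAt (airyBase m) (airyBaseDeriv m z) z := by
  have h : HasDerivAt (fun z : ℂ => z ^ 3 / 3) (z ^ 2) z := by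
    refine ((hasDerivAt_pow 3 z).div_const 3).congr_deriv ?_
    push_cast; ring
  refine ((hasDerivAt_pow m z).mul h.cexp).congr_deriv ?_
  simp only [airyBaseDeriv]
  ring

@[fun_prop]
lemma continuous_airyBase (m : ℕ) : Continuous (airyBase m) := by
  unfold airyBase
  simp only [div_eq_mul_inv]
  fun_prop

@[fun_prop]
lemma continuous_airyBaseDeriv (m : ℕ) : Continuous (airyBaseDeriv m) := by
  unfold airyBaseDeriv
  simp only [div_eq_mul_inv]
  fun_prop

lemma hasDerivAt_airyPath_right (c η k : ℝ) :
    HasDerivAt (airyPath c η) (((1 - η) * c : ℝ) + Complex.I) k := by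
  have h : HasDerivAt (fun k : ℝ => 2 * η + (1 - η) * (c * k)) ((1 - η) * c) k := by
    simpa using (((hasDerivAt_id k).const_mul c).const_mul (1 - η)).const_add (2 * η)
  have h2 : HasDerivAt (fun k : ℝ => (k : ℂ) * Complex.I) Complex.I k := by
    simpa using (Complex.ofRealCLM.hasDerivAt (x := k)).mul_const Complex.I
  exact h.ofReal_comp.add h2

lemma hasDerivAt_airyPath_left (c η k : ℝ) :
    HasDerivAt (fun η => airyPath c η k) ((2 - c * k : ℝ) : ℂ) η := by
  have h : HasDerivAt (fun η : ℝ => 2 * η + (1 - η) * (c * k)) (2 - c * k) η := by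
    refine (((hasDerivAt_id η).const_mul 2).add
      (((hasDerivAt_id η).const_sub 1).mul_const (c * k))).congr_deriv ?_
    ring
  exact h.ofReal_comp.add_const _

lemma airyPath_re_bounds {c η k : ℝ} (hc : 0 < c) (hc3 : 3 * c ^ 2 = 1) (hη : η ∈ Icc (0 : ℝ) 1)
    (hk : 0 ≤ k) : 0 ≤ 2 * η + (1 - η) * (c * k) ∧ 2 * η + (1 - η) * (c * k) ≤ 2 + k ∧
      (2 * η + (1 - η) * (c * k)) ^ 3 / 3 - (2 * η + (1 - η) * (c * k)) * k ^ 2 ≤ 10 - k ^ 2 := by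
  obtain ⟨h0, h1⟩ := hη
  have hc1 : c ≤ 1 := by nlinarith
  have hck : 0 ≤ c * k := by positivity
  have hck' : c * k ≤ k := by nlinarith
  have hsq : 3 * (c * k) ^ 2 = k ^ 2 := by rw [mul_pow, ← mul_assoc, hc3, one_mul]
  have e1 : 2 * η + (1 - η) * (c * k) = η * 2 + (1 - η) * (c * k) := by ring
  have ha0 : 0 ≤ 2 * η + (1 - η) * (c * k) :=
    add_nonneg (by positivity) (mul_nonneg (by linarith) hck)
  have ha2 : 2 * η + (1 - η) * (c * k) ≤ 2 + k := by nlinarith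
  refine ⟨ha0, ha2, ?_⟩
  set a := 2 * η + (1 - η) * (c * k) with ha
  rcases le_or_gt (3 / 2) (c * k) with h | h
  · have ha3 : 3 / 2 ≤ a := by nlinarith
    have hk2 : 2 ≤ k := by nlinarith
    have hak : a ≤ k := by nlinarith
    have h2 : a ^ 2 ≤ k ^ 2 := by nlinarith
    have h3 : a * a ^ 2 ≤ a * k ^ 2 := mul_le_mul_of_nonneg_left h2 ha0
    have h4 : 3 / 2 * k ^ 2 ≤ a * k ^ 2 := mul_le_mul_of_nonneg_right ha3 (sq_nonneg k)
    nlinarith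
  · have ha3 : a ≤ 2 := by nlinarith
    have h2 : a ^ 3 ≤ 2 ^ 3 := pow_le_pow_left₀ ha0 ha3 3
    have h4 : 0 ≤ a * k ^ 2 := by positivity
    nlinarith

lemma norm_airyPath_le {c η k : ℝ} (hc : 0 < c) (hc3 : 3 * c ^ 2 = 1) (hη : η ∈ Icc (0 : ℝ) 1)
    (hk : 0 ≤ k) : ‖airyPath c η k‖ ≤ 3 + k ^ 2 := by
  obtain ⟨h0, h1, -⟩ := airyPath_re_bounds hc hc3 hη hk
  refine (norm_add_le _ _).trans ?_
  rw [norm_mul, Complex.norm_I, mul_one, Complex.norm_real, Complex.norm_real,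
    Real.norm_of_nonneg h0, Real.norm_of_nonneg hk]
  nlinarith [sq_nonneg (k - 1)]

lemma norm_cexp_airyPath_le {c η k : ℝ} (hc : 0 < c) (hc3 : 3 * c ^ 2 = 1)
    (hη : η ∈ Icc (0 : ℝ) 1) (hk : 0 ≤ k) :
    ‖Complex.exp (airyPath c η k ^ 3 / 3)‖ ≤ Real.exp 10 * Real.exp (-k ^ 2) := by
  obtain ⟨-, -, h⟩ := airyPath_re_bounds hc hc3 hη hk
  rw [Complex.norm_exp, ← Real.exp_add]
  refine Real.exp_le_exp.2 (le_trans (le_of_eq ?_) (h.trans (by linarith)))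
  generalize ha : 2 * η + (1 - η) * (c * k) = a
  have : airyPath c η k ^ 3 / 3 = ((a ^ 3 / 3 - a * k ^ 2 : ℝ) : ℂ) +
      ((a ^ 2 * k - k ^ 3 / 3 : ℝ) : ℂ) * Complex.I := by
    rw [airyPath, ha]
    push_cast
    linear_combination ((a : ℂ) * k ^ 2 + (k : ℂ) ^ 3 / 3 * Complex.I) * Complex.I_sq
  rw [this, Complex.add_re, Complex.ofReal_re, Complex.re_ofReal_mul, Complex.I_re]
  ring

/-- The polynomial dominating the homotopy integrands. -/
def airyBound (m : ℕ) : ℝ[X] :=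
  C (Real.exp 10) * (2 * (C (m : ℝ) * (C 3 + X ^ 2) ^ (m + 2) + (C 3 + X ^ 2) ^ (m + 2)) *
    (C 3 + X ^ 2) + (C 3 + X ^ 2) ^ m)

lemma eval_airyBound (m : ℕ) (k : ℝ) : (airyBound m).eval k =
    Real.exp 10 * (2 * (m * (3 + k ^ 2) ^ (m + 2) + (3 + k ^ 2) ^ (m + 2)) * (3 + k ^ 2) +
      (3 + k ^ 2) ^ m) := by
  simp [airyBound]

lemma norm_airyBase_le (m : ℕ) {c η k : ℝ} (hc : 0 < c) (hc3 : 3 * c ^ 2 = 1)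
    (hη : η ∈ Icc (0 : ℝ) 1) (hk : 0 ≤ k) :
    ‖airyBase m (airyPath c η k)‖ ≤ (3 + k ^ 2) ^ m * (Real.exp 10 * Real.exp (-k ^ 2)) := by
  rw [airyBase, norm_mul, norm_pow]
  exact mul_le_mul (pow_le_pow_left₀ (norm_nonneg _) (norm_airyPath_le hc hc3 hη hk) m)
    (norm_cexp_airyPath_le hc hc3 hη hk) (norm_nonneg _) (by positivity)

lemma norm_airyBaseDeriv_le (m : ℕ) {c η k : ℝ} (hc : 0 < c) (hc3 : 3 * c ^ 2 = 1)
    (hη : η ∈ Icc (0 : ℝ) 1) (hk : 0 ≤ k) :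
    ‖airyBaseDeriv m (airyPath c η k)‖ ≤ (m * (3 + k ^ 2) ^ (m + 2) + (3 + k ^ 2) ^ (m + 2)) *
      (Real.exp 10 * Real.exp (-k ^ 2)) := by
  have hz := norm_airyPath_le hc hc3 hη hk
  have he := norm_cexp_airyPath_le hc hc3 hη hk
  have h1 : ‖airyPath c η k‖ ^ (m - 1) ≤ (3 + k ^ 2) ^ (m + 2) :=
    (pow_le_pow_left₀ (norm_nonneg _) hz _).trans
      (pow_le_pow_right₀ (by nlinarith [sq_nonneg k]) (by omega))
  have h2 : ‖airyPath c η k‖ ^ (m + 2) ≤ (3 + k ^ 2) ^ (m + 2) :=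
    pow_le_pow_left₀ (norm_nonneg _) hz _
  rw [airyBaseDeriv, ← add_mul, norm_mul]
  refine mul_le_mul ((norm_add_le _ _).trans ?_) he (norm_nonneg _) (by positivity)
  rw [norm_mul, norm_pow, norm_pow, Complex.norm_natCast]
  gcongr

lemma norm_dir_le {c η : ℝ} (hc : 0 < c) (hc3 : 3 * c ^ 2 = 1) (hη : η ∈ Icc (0 : ℝ) 1) :
    ‖(((1 - η) * c : ℝ) + Complex.I : ℂ)‖ ≤ 2 := by
  obtain ⟨h0, h1⟩ := hη
  have hc1 : c ≤ 1 := by nlinarith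
  refine (norm_add_le _ _).trans ?_
  rw [Complex.norm_I, Complex.norm_real, Real.norm_of_nonneg (mul_nonneg (by linarith) hc.le)]
  nlinarith

lemma norm_two_sub_le {c k : ℝ} (hc : 0 < c) (hc3 : 3 * c ^ 2 = 1) (hk : 0 ≤ k) :
    ‖((2 - c * k : ℝ) : ℂ)‖ ≤ 3 + k ^ 2 := by
  have hc1 : c ≤ 1 := by nlinarith
  have hck : 0 ≤ c * k := by positivity
  have hck' : c * k ≤ k := by nlinarith
  rw [Complex.norm_real, Real.norm_eq_abs, abs_le]
  constructor <;> nlinarith [sq_nonneg (k - 1)]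

/-- The integrand pulled back along the homotopy. -/
def airyPull (m : ℕ) (c η k : ℝ) : ℂ :=
  airyBase m (airyPath c η k) * (((1 - η) * c : ℝ) + Complex.I)

/-- The derivative of `airyPull` in the homotopy parameter. -/
def airyPullDeriv (m : ℕ) (c η k : ℝ) : ℂ :=
  airyBaseDeriv m (airyPath c η k) * ((2 - c * k : ℝ) : ℂ) * (((1 - η) * c : ℝ) + Complex.I) -
    airyBase m (airyPath c η k) * c

@[fun_prop]
lemma continuous_airyPath_right (c η : ℝ) : Continuous (airyPath c η) := by
  unfold airyPath; fun_prop

lemma norm_airyPull_le (m : ℕ) {c η k : ℝ} (hc : 0 < c) (hc3 : 3 * c ^ 2 = 1)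
    (hη : η ∈ Icc (0 : ℝ) 1) (hk : 0 ≤ k) :
    ‖airyPull m c η k‖ ≤ 2 * ((C (Real.exp 10) * (C 3 + X ^ 2) ^ m : ℝ[X]).eval k *
      Real.exp (-k ^ 2)) := by
  rw [airyPull, norm_mul]
  refine (mul_le_mul (norm_airyBase_le m hc hc3 hη hk) (norm_dir_le hc hc3 hη) (norm_nonneg _)
    (by positivity)).trans (le_of_eq ?_)
  simp
  ring

lemma norm_airyPullDeriv_le (m : ℕ) {c η k : ℝ} (hc : 0 < c) (hc3 : 3 * c ^ 2 = 1)
    (hη : η ∈ Icc (0 : ℝ) 1) (hk : 0 ≤ k) :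
    ‖airyPullDeriv m c η k‖ ≤ (airyBound m).eval k * Real.exp (-k ^ 2) := by
  have hc1 : c ≤ 1 := by nlinarith
  rw [airyPullDeriv, eval_airyBound]
  refine (norm_sub_le _ _).trans ?_
  have h1 := norm_airyBase_le m hc hc3 hη hk
  have h2 := norm_airyBaseDeriv_le m hc hc3 hη hk
  have h3 := norm_two_sub_le hc hc3 hk
  have h4 := norm_dir_le hc hc3 hη
  rw [norm_mul, norm_mul, norm_mul, Complex.norm_real c, Real.norm_of_nonneg hc.le]
  calc _ ≤ (m * (3 + k ^ 2) ^ (m + 2) + (3 + k ^ 2) ^ (m + 2)) *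
      (Real.exp 10 * Real.exp (-k ^ 2)) * (3 + k ^ 2) * 2 +
      (3 + k ^ 2) ^ m * (Real.exp 10 * Real.exp (-k ^ 2)) * 1 := by gcongr
    _ = _ := by ring

lemma hasDerivAt_airyPull (m : ℕ) (c η k : ℝ) :
    HasDerivAt (fun η => airyPull m c η k) (airyPullDeriv m c η k) η := by
  have h1 : HasDerivAt (fun η : ℝ => ((((1 - η) * c : ℝ) : ℂ) + Complex.I)) (-c : ℂ) η := by
    have : HasDerivAt (fun η : ℝ => (1 - η) * c) (-c) η := by
      simpa using ((hasDerivAt_id η).const_sub 1).mul_const c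
    simpa using this.ofReal_comp.add_const Complex.I
  have h2 := (hasDerivAt_airyBase m (airyPath c η k)).comp η (hasDerivAt_airyPath_left c η k)
  refine (h2.mul h1).congr_deriv ?_
  simp only [airyPullDeriv, Function.comp]
  ring

lemma hasDerivAt_airyPull_right (m : ℕ) (c η k : ℝ) :
    HasDerivAt (fun k => airyBase m (airyPath c η k) * ((2 - c * k : ℝ) : ℂ))
      (airyPullDeriv m c η k) k := by
  have h1 : HasDerivAt (fun k : ℝ => ((2 - c * k : ℝ) : ℂ)) (-c : ℂ) k := by
    have : HasDerivAt (fun k : ℝ => 2 - c * k) (-c) k := by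
      simpa using ((hasDerivAt_id k).const_mul c).const_sub 2
    simpa using this.ofReal_comp
  have h2 := (hasDerivAt_airyBase m (airyPath c η k)).comp k (hasDerivAt_airyPath_right c η k)
  refine (h2.mul h1).congr_deriv ?_
  simp only [airyPullDeriv, Function.comp]
  ring

lemma integrableOn_airyPull (m : ℕ) {c η : ℝ} (hc : 0 < c) (hc3 : 3 * c ^ 2 = 1)
    (hη : η ∈ Icc (0 : ℝ) 1) : IntegrableOn (airyPull m c η) (Ioi 0) := by
  refine Integrable.mono' ((integrable_eval_mul_exp _).const_mul 2).integrableOn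
    (Continuous.aestronglyMeasurable (by unfold airyPull; fun_prop))
    ((ae_restrict_iff' measurableSet_Ioi).2 (Eventually.of_forall fun k hk =>
      norm_airyPull_le m hc hc3 hη (le_of_lt hk)))

lemma integrableOn_airyPullDeriv (m : ℕ) {c η : ℝ} (hc : 0 < c) (hc3 : 3 * c ^ 2 = 1)
    (hη : η ∈ Icc (0 : ℝ) 1) : IntegrableOn (airyPullDeriv m c η) (Ioi 0) := by
  refine Integrable.mono' (integrable_eval_mul_exp _).integrableOn
    (Continuous.aestronglyMeasurable (by unfold airyPullDeriv; fun_prop))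
    ((ae_restrict_iff' measurableSet_Ioi).2 (Eventually.of_forall fun k hk =>
      norm_airyPullDeriv_le m hc hc3 hη (le_of_lt hk)))

lemma integral_airyPullDeriv (m : ℕ) {c η : ℝ} (hc : 0 < c) (hc3 : 3 * c ^ 2 = 1)
    (hη : η ∈ Icc (0 : ℝ) 1) :
    ∫ k in Ioi 0, airyPullDeriv m c η k = -(airyBase m (2 * η) * 2) := by
  have hd : ∀ k ∈ Ioi (0 : ℝ), HasDerivAt
      (fun k => airyBase m (airyPath c η k) * ((2 - c * k : ℝ) : ℂ)) (airyPullDeriv m c η k) k :=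
    fun k _ => hasDerivAt_airyPull_right m c η k
  have hf : IntegrableOn (fun k => airyBase m (airyPath c η k) * ((2 - c * k : ℝ) : ℂ))
      (Ioi 0) := by
    refine Integrable.mono' (integrable_eval_mul_exp
      (C (Real.exp 10) * (C 3 + X ^ 2) ^ (m + 1))).integrableOn
      (Continuous.aestronglyMeasurable (by fun_prop))
      ((ae_restrict_iff' measurableSet_Ioi).2 (Eventually.of_forall fun k hk => ?_))
    rw [norm_mul]
    refine (mul_le_mul (norm_airyBase_le m hc hc3 hη (le_of_lt hk))
      (norm_two_sub_le hc hc3 (le_of_lt hk)) (norm_nonneg _) (by positivity)).trans (le_of_eq ?_)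
    simp
    ring
  rw [integral_Ioi_of_hasDerivAt_of_tendsto
    (hasDerivAt_airyPull_right m c η 0).continuousAt.continuousWithinAt hd
    (integrableOn_airyPullDeriv m hc hc3 hη)
    (tendsto_zero_of_hasDerivAt_of_integrableOn_Ioi hd (integrableOn_airyPullDeriv m hc hc3 hη) hf)]
  simp [airyPath]

lemma airyBase_ofReal (m : ℕ) (x : ℝ) :
    airyBase m x = ((x ^ m * Real.exp (x ^ 3 / 3) : ℝ) : ℂ) := by
  simp [airyBase]

lemma im_integral_airyPull (m : ℕ) {c : ℝ} (hc : 0 < c) (hc3 : 3 * c ^ 2 = 1) :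
    (∫ k in Ioi 0, airyPull m c 1 k).im = (∫ k in Ioi 0, airyPull m c 0 k).im := by
  have hcont : ContinuousOn (fun η => ∫ k in Ioi 0, airyPull m c η k) (Icc 0 1) :=
    continuousOn_of_dominated (fun η hη => (integrableOn_airyPull m hc hc3 hη).aestronglyMeasurable)
      (fun η hη => (ae_restrict_iff' measurableSet_Ioi).2 (Eventually.of_forall fun k hk =>
        norm_airyPull_le m hc hc3 hη (le_of_lt hk)))
      ((integrable_eval_mul_exp _).const_mul 2).integrableOn
      (Eventually.of_forall fun k η _ =>
        (hasDerivAt_airyPull m c η k).continuousAt.continuousWithinAt)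
  have hd : ∀ η ∈ Ioo (0 : ℝ) 1, HasDerivAt (fun η => (∫ k in Ioi 0, airyPull m c η k).im) 0 η := by
    intro η hη
    have h := (hasDerivAt_integral_of_dominated_loc_of_deriv_le (μ := volume.restrict (Ioi 0))
      (F := airyPull m c) (F' := airyPullDeriv m c) (Ioo_mem_nhds hη.1 hη.2)
      (eventually_of_mem (Ioo_mem_nhds hη.1 hη.2) fun σ hσ =>
        (integrableOn_airyPull m hc hc3 (Ioo_subset_Icc_self hσ)).aestronglyMeasurable)
      (integrableOn_airyPull m hc hc3 (Ioo_subset_Icc_self hη))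
      (integrableOn_airyPullDeriv m hc hc3 (Ioo_subset_Icc_self hη)).aestronglyMeasurable
      ((ae_restrict_iff' measurableSet_Ioi).2 (Eventually.of_forall fun k hk σ hσ =>
        norm_airyPullDeriv_le m hc hc3 (Ioo_subset_Icc_self hσ) (le_of_lt hk)))
      (integrable_eval_mul_exp _).integrableOn
      (Eventually.of_forall fun k σ _ => hasDerivAt_airyPull m c σ k)).2
    rw [integral_airyPullDeriv m hc hc3 (Ioo_subset_Icc_self hη)] at h
    have h2 := (Complex.imCLM.hasFDerivAt.comp_hasDerivAt η h)
    refine h2.congr_deriv ?_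
    have h3 : airyBase m (2 * η) = airyBase m ((2 * η : ℝ) : ℂ) := by push_cast; rfl
    rw [h3, airyBase_ofReal, Complex.imCLM_apply, Complex.neg_im,
      ← Complex.ofReal_ofNat, ← Complex.ofReal_mul, Complex.ofReal_im, neg_zero]
  obtain ⟨x, hx, h⟩ := exists_hasDerivAt_eq_slope _ (fun _ => 0) (zero_lt_one (α := ℝ))
    (Complex.continuous_im.comp_continuousOn hcont) hd
  simp only [sub_zero, div_one, Function.comp] at h
  exact (sub_eq_zero.1 h.symm)

lemma airyMoment_zero_eq (m : ℕ) (c : ℝ) :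
    airyMoment m 0 = ((2 * (∫ k in Ioi 0, airyPull m c 1 k).im : ℝ) : ℂ) := by
  have hF : ∀ k : ℝ, (2 + k * Complex.I) ^ m * airyKernel 0 k = airyBase m (2 + k * Complex.I) := by
    intro k
    simp [airyKernel, airyBase]
  have hP : ∀ k : ℝ, airyPull m c 1 k = airyBase m (2 + k * Complex.I) * Complex.I := by
    intro k
    simp [airyPull, airyPath]
  have hi : Integrable fun k : ℝ => airyBase m (2 + k * Complex.I) := by
    simpa only [hF] using integrable_pow_mul_airyKernel m 0
  have hconj : ∀ k : ℝ, airyBase m (2 + (-k : ℝ) * Complex.I) =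
      (starRingEnd ℂ) (airyBase m (2 + k * Complex.I)) := by
    intro k
    simp [airyBase, ← Complex.exp_conj, Complex.conj_ofNat]
  have h1 : ∫ k in Iic (0 : ℝ), airyBase m (2 + k * Complex.I) =
      (starRingEnd ℂ) (∫ k in Ioi (0 : ℝ), airyBase m (2 + k * Complex.I)) := by
    rw [← integral_conj, ← neg_zero (G := ℝ),
      ← integral_comp_neg_Ioi 0 fun k : ℝ => airyBase m (2 + k * Complex.I), neg_zero]
    simp only [hconj]
  simp only [airyMoment, hF, hP]
  rw [integral_mul_const, Complex.mul_I_im, ← intervalIntegral.integral_Iic_add_Ioi (b := 0)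
    hi.integrableOn hi.integrableOn, h1, add_comm, Complex.add_conj]

lemma integral_airyPull_zero (m : ℕ) {c : ℝ} (hc : 0 < c) (hc3 : 3 * c ^ 2 = 1) :
    ∫ k in Ioi 0, airyPull m c 0 k = (c + Complex.I) ^ (m + 1) *
      (((8 * c / 9) ^ (-((m : ℝ) + 1) / 3) * (1 / 3) * Real.Gamma (((m : ℝ) + 1) / 3) : ℝ) : ℂ) := by
  have hm : (-1 : ℝ) < m := by linarith [(Nat.cast_nonneg m : (0 : ℝ) ≤ m)]
  rw [← integral_rpow_mul_exp_neg_mul_rpow (p := 3) (q := m) (b := 8 * c / 9) (by norm_num) hm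
    (by positivity), ← integral_complex_ofReal, ← integral_const_mul]
  refine setIntegral_congr_fun measurableSet_Ioi fun k hk => ?_
  have h3 : (3 * c ^ 2 : ℂ) = 1 := by exact_mod_cast hc3
  have h1 : airyPath c 0 k = k * (c + Complex.I) := by
    simp [airyPath]; ring
  have h2 : (c + Complex.I) ^ 3 = -(8 * c / 3 : ℂ) := by
    linear_combination (3 * c + Complex.I) * Complex.I_sq + (c / 3 + Complex.I) * h3
  have e3 : (k : ℝ) ^ (3 : ℝ) = k ^ 3 := by exact_mod_cast Real.rpow_natCast k 3
  simp only [airyPull, airyBase]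
  rw [h1, mul_pow _ _ 3, h2, Real.rpow_natCast, e3]
  push_cast
  rw [show (k : ℂ) ^ 3 * -(8 * c / 3) / 3 = -(8 * c / 9) * k ^ 3 by ring, mul_pow]
  ring

lemma gamma_third_mul {c : ℝ} (hc : 0 < c) (hc3 : 3 * c ^ 2 = 1) :
    Real.Gamma (1 / 3) * Real.Gamma (2 / 3) = 2 * Real.pi * c := by
  have h := Real.Gamma_mul_Gamma_one_sub (1 / 3)
  rw [show (1 : ℝ) - 1 / 3 = 2 / 3 by norm_num, show Real.pi * (1 / 3) = Real.pi / 3 by ring,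
    Real.sin_pi_div_three] at h
  have hs : √3 * c = 1 := by
    have h1 : (√3 * c) ^ 2 = 1 := by rw [mul_pow, Real.sq_sqrt (by norm_num), hc3]
    exact (pow_eq_one_iff_of_nonneg (by positivity) two_ne_zero).1 h1
  have h3 : √3 ≠ 0 := by positivity
  rw [h]
  field_simp
  linear_combination -hs

lemma eq_three_rpow {c : ℝ} (hc : 0 < c) (hc3 : 3 * c ^ 2 = 1) : c = 3 ^ (-(1 / 2) : ℝ) := by
  rw [Real.rpow_neg (by norm_num), ← Real.sqrt_eq_rpow, eq_comm, inv_eq_iff_eq_inv,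
    Real.sqrt_eq_iff_mul_self_eq (by norm_num) (by positivity)]
  field_simp
  linarith

lemma rpow_eight_mul {c : ℝ} (hc : 0 < c) (hc3 : 3 * c ^ 2 = 1) (p : ℝ) :
    (8 * c / 9) ^ (-p) = 2 ^ (-(3 * p)) * 3 ^ (5 / 2 * p) := by
  have h9 : (9 : ℝ) = 3 ^ (2 : ℝ) := by norm_num
  have h8 : (8 : ℝ) = 2 ^ (3 : ℝ) := by norm_num
  have h : 8 * c / 9 = 2 ^ (3 : ℝ) * 3 ^ (-(5 / 2) : ℝ) := by
    rw [eq_three_rpow hc hc3, h9, h8, mul_div_assoc, ← Real.rpow_sub (by norm_num)]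
    norm_num
  rw [h, Real.mul_rpow (by positivity) (by positivity), ← Real.rpow_mul (by norm_num),
    ← Real.rpow_mul (by norm_num)]
  ring_nf

lemma airyMoment_zero_zero : airyMoment 0 0 =
    ((2 * Real.pi * (3 ^ (-(2 : ℝ) / 3) / Real.Gamma (2 / 3)) : ℝ) : ℂ) := by
  have hc : (0 : ℝ) < 1 / √3 := by positivity
  have hc3 : 3 * (1 / √3) ^ 2 = 1 := by
    rw [div_pow, Real.sq_sqrt (by norm_num)]; norm_num
  generalize 1 / √3 = c at hc hc3
  have hG := gamma_third_mul hc hc3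
  have hΓ : 0 < Real.Gamma (2 / 3) := Real.Gamma_pos_of_pos (by norm_num)
  have h := rpow_eight_mul hc hc3 (1 / 3)
  rw [show -(3 * (1 / 3) : ℝ) = -1 by norm_num, Real.rpow_neg_one] at h
  have h3 : (3 : ℝ) ^ (5 / 2 * (1 / 3) : ℝ) * c = 3 * 3 ^ (-(2 : ℝ) / 3) := by
    rw [eq_three_rpow hc hc3, ← Real.rpow_add (by norm_num), ← Real.rpow_one_add' (by norm_num)
      (by norm_num)]
    norm_num
  rw [airyMoment_zero_eq 0 c, im_integral_airyPull 0 hc hc3, integral_airyPull_zero 0 hc hc3]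
  congr 1
  rw [zero_add, pow_one, Complex.im_mul_ofReal, Complex.add_im, Complex.ofReal_im, Complex.I_im,
    Nat.cast_zero, zero_add, neg_div, h, ← mul_div_assoc (2 * Real.pi),
    eq_div_iff hΓ.ne']
  linear_combination (1 / 3) * 3 ^ (5 / 2 * (1 / 3) : ℝ) * hG + (2 / 3) * Real.pi * h3

lemma airyMoment_one_zero : airyMoment 1 0 =
    ((2 * Real.pi * (3 ^ (-(1 : ℝ) / 3) / Real.Gamma (1 / 3)) : ℝ) : ℂ) := by
  have hc : (0 : ℝ) < 1 / √3 := by positivity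
  have hc3 : 3 * (1 / √3) ^ 2 = 1 := by
    rw [div_pow, Real.sq_sqrt (by norm_num)]; norm_num
  generalize 1 / √3 = c at hc hc3
  have hG := gamma_third_mul hc hc3
  have hΓ : 0 < Real.Gamma (1 / 3) := Real.Gamma_pos_of_pos (by norm_num)
  have h := rpow_eight_mul hc hc3 (2 / 3)
  rw [show -(3 * (2 / 3) : ℝ) = -2 by norm_num, 
    Real.rpow_neg (zero_le_two (α := ℝ)), Real.rpow_two] at h
  have h3 : (3 : ℝ) ^ (5 / 2 * (2 / 3) : ℝ) = 9 * 3 ^ (-(1 : ℝ) / 3) := by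
    rw [show (9 : ℝ) = 3 ^ (2 : ℝ) by norm_num, ← Real.rpow_add (by norm_num)]
    norm_num
  have him : ((c + Complex.I : ℂ) ^ 2).im = 2 * c := by
    simp [pow_two]; ring
  rw [airyMoment_zero_eq 1 c, im_integral_airyPull 1 hc hc3, integral_airyPull_zero 1 hc hc3]
  congr 1
  rw [Complex.im_mul_ofReal, him, Nat.cast_one, one_add_one_eq_two, neg_div, h, h3,
    ← mul_div_assoc (2 * Real.pi), eq_div_iff hΓ.ne']
  linear_combination 3 * c * 3 ^ (-(1 : ℝ) / 3) * hG + 2 * Real.pi * 3 ^ (-(1 : ℝ) / 3) * hc3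

end AiryInitialValues

section AiryFunction

variable {A A' : ℝ → ℝ} (hA : IsAiry A A')
include hA

lemma isAiry_eq_airyInt : (fun s => (A s : ℂ)) = airyInt := by
  obtain ⟨h1, h2, h3, h4⟩ := hA
  have hL := airyLike_airyInt
  have hpi : ((1 / (2 * Real.pi) : ℝ) : ℂ) * ((2 * Real.pi : ℝ) : ℂ) = 1 := by
    rw [← Complex.ofReal_mul, one_div_mul_cancel (by positivity), Complex.ofReal_one]
  have h5 : ∀ s, HasDerivAt (fun s => (A s : ℂ) - airyInt s) _ s :=
    fun s => (h1 s).ofReal_comp.sub (hL.deriv s)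
  have h6 := airy_ode_eq_zero (s₀ := 0) h5 (fun s => by
      refine ((h2 s).ofReal_comp.sub (hL.deriv₁ s)).congr_deriv ?_
      push_cast; ring)
    (by
      rw [h3, airyInt_eq, airyMoment_zero_zero, Complex.ofReal_mul (2 * Real.pi), ← mul_assoc, hpi,
        one_mul, sub_self])
    (by
      rw [h4, airyMoment_one_zero, Complex.ofReal_mul (2 * Real.pi), ← mul_assoc, hpi,
        one_mul, neg_div, Complex.ofReal_neg, sub_self])
  exact funext fun s => sub_eq_zero.1 (h6 s)

lemma isAiry_airyLike : AiryLike airyInt (fun s => (A' s : ℂ)) := by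
  have hL := airyLike_airyInt
  have h : ∀ s, HasDerivAt airyInt (A' s : ℂ) s := fun s => by
    rw [← isAiry_eq_airyInt hA]; exact (hA.1 s).ofReal_comp
  have h2 := funext fun s => (h s).unique (hL.deriv s)
  rwa [h2]

lemma isAiry_isBigO : A =O[atTop] (fun s => Real.exp (-(2 * s))) ∧
    A' =O[atTop] (fun s => Real.exp (-(2 * s))) := by
  have hL := isAiry_airyLike hA
  have h1 := hL.decay
  rw [← isAiry_eq_airyInt hA] at h1
  exact ⟨Complex.isBigO_ofReal_left.1 h1, Complex.isBigO_ofReal_left.1 hL.decay₁⟩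

lemma isAiry_mul_nonpos {s : ℝ} (hs : 1 ≤ s) : A s * (A s + A' s) ≤ 0 := by
  have hd : ∀ s, HasDerivAt (fun s => A s * (A s + A' s)) ((A s + A' s) ^ 2 + (s - 1) * A s ^ 2) s :=
    fun s => ((hA.1 s).mul ((hA.1 s).add (hA.2.1 s))).congr_deriv (by simp only [Pi.add_apply]; ring)
  have hmono : MonotoneOn (fun s => A s * (A s + A' s)) (Ici 1) := by
    refine monotoneOn_of_deriv_nonneg (convex_Ici 1)
      (fun s _ => (hd s).continuousAt.continuousWithinAt)
      (fun s _ => (hd s).differentiableAt.differentiableWithinAt) fun s hs => ?_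
    rw [interior_Ici] at hs
    rw [(hd s).deriv]
    have : 0 ≤ s - 1 := sub_nonneg.2 (le_of_lt hs)
    positivity
  obtain ⟨h1, h2⟩ := isAiry_isBigO hA
  have he : Tendsto (fun s : ℝ => Real.exp (-(2 * s))) atTop (𝓝 0) :=
    Real.tendsto_exp_neg_atTop_nhds_zero.comp (tendsto_id.const_mul_atTop two_pos)
  have ht : Tendsto (fun s => A s * (A s + A' s)) atTop (𝓝 0) := by
    simpa using (h1.trans_tendsto he).mul ((h1.trans_tendsto he).add (h2.trans_tendsto he))
  refine ge_of_tendsto ht ?_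
  filter_upwards [eventually_ge_atTop s] with x hx
  exact hmono hs (hs.trans hx) hx

lemma isAiry_abs_add_le {s x : ℝ} (hs : 1 ≤ s) (hx : 0 < x) : |A (s + x)| ≤ |A s| * Real.exp (-x) := by
  have hd : ∀ s, HasDerivAt (fun s => (Real.exp s * A s) ^ 2)
      (2 * Real.exp s ^ 2 * (A s * (A s + A' s))) s :=
    fun s => (((Real.hasDerivAt_exp s).mul (hA.1 s)).pow 2).congr_deriv (by
      simp only [Pi.mul_apply]; ring)
  have hanti : AntitoneOn (fun s => (Real.exp s * A s) ^ 2) (Ici 1) := by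
    refine antitoneOn_of_deriv_nonpos (convex_Ici 1)
      (fun s _ => (hd s).continuousAt.continuousWithinAt)
      (fun s _ => (hd s).differentiableAt.differentiableWithinAt) fun s hs => ?_
    rw [interior_Ici] at hs
    rw [(hd s).deriv]
    exact mul_nonpos_of_nonneg_of_nonpos (by positivity) (isAiry_mul_nonpos hA (le_of_lt hs))
  have h := sq_le_sq.1 (hanti (mem_Ici.2 hs) (mem_Ici.2 (by linarith)) (by linarith : s ≤ s + x))
  rw [abs_mul, abs_mul, Real.abs_exp, Real.abs_exp, Real.exp_add, mul_assoc] at h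
  have h2 := le_of_mul_le_mul_left h (Real.exp_pos s)
  rwa [Real.exp_neg, ← div_eq_mul_inv, le_div_iff₀ (Real.exp_pos x), mul_comm]

lemma isAiry_ne_zero {s : ℝ} (hs : 1 ≤ s) : A s ≠ 0 := by
  intro h0
  have h1 : ∀ x ∈ Ioi s, A x = 0 := fun x hx => by
    have := isAiry_abs_add_le hA hs (sub_pos.2 hx)
    rw [h0, abs_zero, zero_mul, add_sub_cancel] at this
    exact abs_eq_zero.1 (le_antisymm this (abs_nonneg _))
  have h2 : A' (s + 1) = 0 := by
    refine (hA.1 (s + 1)).unique ((hasDerivAt_const (s + 1) (0 : ℝ)).congr_of_eventuallyEq ?_)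
    filter_upwards [Ioi_mem_nhds (lt_add_one s)] with x hx using h1 x hx
  have h3 := airy_ode_eq_zero (y := fun s => (A s : ℂ)) (y₁ := fun s => (A' s : ℂ)) (s₀ := s + 1)
    (fun s => (hA.1 s).ofReal_comp)
    (fun s => (hA.2.1 s).ofReal_comp.congr_deriv (by push_cast; rfl))
    (by simpa using h1 (s + 1) (lt_add_one s)) (by simpa using h2) 0
  have h4 : A 0 = 0 := by exact_mod_cast h3
  have h5 : 0 < Real.Gamma (2 / 3) := Real.Gamma_pos_of_pos (by norm_num)
  rw [hA.2.2.1] at h4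
  exact absurd h4 (by positivity)

end AiryFunction

/-- The segment from `1` to `exp (-2πiβ)` stays away from the origin. -/
lemma exists_le_norm_one_sub {β : ℂ} (hβ : |β.re| < 1 / 2) : ∃ c : ℝ, 0 < c ∧
    ∀ r ∈ Icc (0 : ℝ) 1, c ≤ ‖1 - (1 - Complex.exp (-(2 * Real.pi * Complex.I * β))) * r‖ := by
  set v := -(2 * Real.pi * Complex.I * β) with hv
  have him : v.im = -(2 * Real.pi * β.re) := by simp [hv]
  obtain ⟨h1, h2⟩ := abs_lt.1 hβ
  have hpi := Real.pi_pos
  have harg : (Complex.exp v).arg = v.im := by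
    rw [← Complex.log_im, Complex.log_exp (by rw [him]; nlinarith) (by rw [him]; nlinarith)]
  have hs : Complex.exp v ∈ Complex.slitPlane := by
    rw [Complex.mem_slitPlane_iff_arg, harg]
    exact ⟨fun h => by rw [him] at h; nlinarith, Complex.exp_ne_zero v⟩
  have hne : ∀ r ∈ Icc (0 : ℝ) 1, 1 - (1 - Complex.exp v) * (r : ℂ) ≠ 0 := by
    intro r hr
    have := Complex.starConvex_one_slitPlane hs (sub_nonneg.2 hr.2) hr.1 (by ring)
    have e : (1 - r) • (1 : ℂ) + r • Complex.exp v = 1 - (1 - Complex.exp v) * (r : ℂ) := by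
      simp only [Complex.real_smul]; push_cast; ring
    rw [e] at this
    exact Complex.slitPlane_ne_zero this
  obtain ⟨r, hr, hmin⟩ := isCompact_Icc.exists_isMinOn (nonempty_Icc.2 (zero_le_one (α := ℝ)))
    (f := fun r : ℝ => ‖1 - (1 - Complex.exp v) * (r : ℂ)‖) (by fun_prop)
  exact ⟨_, norm_pos_iff.2 (hne r hr), fun s hs => hmin hs⟩

lemma lam0_eq {n : ℕ} (hn : 0 < n) (t : ℝ) : lam0 t n =
    2 * √((n : ℝ) / 2) + √((n : ℝ) / 2) / ((n : ℝ) ^ (1 / 3 : ℝ)) ^ 2 * t := by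
  have h1 : √(2 * n : ℝ) = 2 * √((n : ℝ) / 2) := by
    rw [show (2 * n : ℝ) = 2 ^ 2 * (n / 2) by ring, Real.sqrt_mul (by norm_num),
      Real.sqrt_sq (by norm_num)]
  have h2 : (n : ℝ) ^ (-(2 : ℝ) / 3) = (((n : ℝ) ^ (1 / 3 : ℝ)) ^ 2)⁻¹ := by
    rw [← Real.rpow_natCast, ← Real.rpow_mul (by positivity), ← Real.rpow_neg (by positivity)]
    norm_num
  rw [lam0, h1, h2]
  ring

lemma tendsto_H_div {β κ : ℂ} (hκ : κ ^ 2 = 1 - Complex.exp (-(2 * Real.pi * Complex.I * β)))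
    {c : ℝ} (hc : 0 < c) (hγ : ∀ r ∈ Icc (0 : ℝ) 1, c ≤ ‖1 - κ ^ 2 * r‖) (t : ℝ) :
    (∀ s, Resolvable (κ ^ 2) c (hankelOp airyInt s * hankelOp airyInt s)) ∧
    Tendsto (fun n : ℕ => H n (lam0 t n) β /
      (Complex.exp (Real.pi * Complex.I * β * n) * H n (lam0 t n) 0)) atTop
      (𝓝 (Complex.exp (-∫ s in Ioi t, edgeQ airyInt κ s))) := by
  set N : ℕ → ℝ := fun n => (n : ℝ) ^ (1 / 3 : ℝ) with hN
  set R : ℕ → ℝ := fun n => √((n : ℝ) / 2) with hR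
  have hNt : Tendsto N atTop atTop :=
    (tendsto_rpow_atTop (by norm_num)).comp tendsto_natCast_atTop_atTop
  have hNn : ∀ n, N n ^ 3 = n := fun n => by
    rw [hN, ← Real.rpow_natCast, ← Real.rpow_mul (by positivity)]
    norm_num
  have hR0 : ∀ n, 0 ≤ R n := fun n => Real.sqrt_nonneg _
  have hR2 : ∀ n, R n ^ 2 = n / 2 := fun n => Real.sq_sqrt (by positivity)
  have ha := edgeConv_hermScaled hNt hNn hR0 hR2 (zero_le_one (α := ℕ))
  have hb := edgeConv_hermScaled hNt hNn hR0 hR2 (le_refl 1)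
  have hη : ∀ n : ℕ, 0 < n → 0 < R n / N n ^ 2 := fun n hn => by
    simp only [hN, hR]; positivity
  have hfam := (eventually_gt_atTop 0).mono fun (n : ℕ) hn =>
    hermScaled_edgeFam (l := 2 * R n) (hη n hn) n
  have hD := airyLike_airyInt.dec
  refine ⟨EdgeConv.resolvable hfam ha hb hD hc hγ, ?_⟩
  have hlim := EdgeConv.tendsto_famDet hfam ha hb hD hc hγ t
  have hQ : ∀ s, κ ^ 2 * pair (shiftL2 airyInt s) (resolv (κ ^ 2)
      (hankelOp airyInt s * hankelOp airyInt s) (shiftL2 airyInt s)) = edgeQ airyInt κ s := by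
    intro s
    rw [edgeQ, edgeV, map_smul, smul_eq_mul]
    ring
  simp only [hQ] at hlim
  refine hlim.congr' ?_
  filter_upwards [eventually_gt_atTop 0] with n hn
  rw [H_div, ← hκ, lam0_eq hn, famDet, gram_hermScaled (hη n hn)]

end HankelEdge

/-- Asymptotics of the Hankel determinant with discontinuous Gaussian weight in the
critical edge scaling, in terms of an Ablowitz–Segur Painlevé II transcendent. -/
theorem hankel_det_asymptotics
    (β κ : ℂ) (hβ : |β.re| < 1 / 2)
    (hκ : κ ^ 2 = 1 - Complex.exp (-(2 * Real.pi * Complex.I * β)))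
    (t : ℝ) (A A' : ℝ → ℝ) (hA : IsAiry A A') :
    ∃ u : ℝ → ℂ, IsAblowitzSegur A κ u ∧
      IntegrableOn (fun τ : ℝ => ((τ : ℂ) - t) * u τ ^ 2) (Set.Ici t) ∧
      Tendsto
        (fun n : ℕ =>
          H n (lam0 t n) β / (Complex.exp (Real.pi * Complex.I * β * n) * H n (lam0 t n) 0))
        atTop
        (nhds (Complex.exp (-(∫ τ in Set.Ici t, ((τ : ℂ) - t) * u τ ^ 2)))) := by
  obtain ⟨c, hc, hγ⟩ := HankelEdge.exists_le_norm_one_sub hβ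
  rw [← hκ] at hγ
  obtain ⟨hr, hlim⟩ := HankelEdge.tendsto_H_div hκ hc hγ t
  have hL := HankelEdge.isAiry_airyLike hA
  refine ⟨HankelEdge.edgeU HankelEdge.airyInt κ, ⟨fun s => (hL.hasDerivAt_edgeU hr s).differentiableAt,
    fun s => (hL.hasDerivAt_deriv_edgeU hr s).differentiableAt,
    fun s => (hL.hasDerivAt_deriv_edgeU hr s).deriv, ?_⟩, ?_, ?_⟩
  · have hAi : ∀ s, HankelEdge.airyInt s = A s :=
      fun s => (congrFun (HankelEdge.isAiry_eq_airyInt hA) s).symm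
    have h := hL.tendsto_edgeU_div hr ((eventually_ge_atTop 1).mono fun s hs => by
      refine ⟨by rw [hAi]; exact_mod_cast HankelEdge.isAiry_ne_zero hA hs, fun x hx => ?_⟩
      rw [hAi, hAi, Complex.norm_real, Complex.norm_real]
      exact HankelEdge.isAiry_abs_add_le hA hs hx)
    simpa only [hAi] using h
  · rw [integrableOn_Ici_iff_integrableOn_Ioi]
    exact (hL.edgeU_sq_dec hr t).integrable t
  · rwa [integral_Ici_eq_integral_Ioi, ← hL.integral_edgeQ hr]
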